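/- There exists a constant d₂ > 0 such that for every δ > 0 one has ∫₁^T R(t)² dt = d₂·T^{5/2} + O_δ(T^{9/4+δ}) as T → ∞. (This is the second moment of the remainder term in Weyl's law for the 3-dimensional Heisenberg manifold with the arithmetic metric.) -/

import Mathlib

open scoped Classical
open Real MeasureTheory

/-- Counting function of the type I (torus) eigenvalues `4π²(m²+n²)`. -/
noncomputable def NT (t : ℝ) : ℝ :=
  Set.ncard {q : ℤ × ℤ | 4 * π ^ 2 * ((q.1 : ℝ) ^ 2 + (q.2 : ℝ) ^ 2) ≤ t}

/-- Counting function of the type II eigenvalues `2πc(c+2k+1)`, counted with multiplicity `2c`. -/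
noncomputable def NH (t : ℝ) : ℝ :=
  ∑' p : ℕ × ℕ,
    if 2 * π * (p.1 + 1 : ℝ) * ((p.1 + 1 : ℝ) + 2 * (p.2 : ℝ) + 1) ≤ t then
      2 * (p.1 + 1 : ℝ) else 0

/-- The Weyl remainder for the 3-dimensional Heisenberg manifold with arithmetic metric. -/
noncomputable def R (t : ℝ) : ℝ :=
  NT t + NH t - (Real.sqrt (2 * π) / (6 * π ^ 2)) * t ^ ((3 : ℝ) / 2)

/-- The point `e^{iθ}` of the unit circle. -/
noncomputable def cis (θ : ℝ) : ℂ := Complex.exp (θ * Complex.I)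

lemma norm_cis (θ : ℝ) : ‖cis θ‖ = 1 := Complex.norm_exp_ofReal_mul_I θ

lemma cis_add (a b : ℝ) : cis (a + b) = cis a * cis b := by
  simp only [cis, ← Complex.exp_add]; congr 1; push_cast; ring

lemma cis_im (θ : ℝ) : (cis θ).im = Real.sin θ := by
  simp [cis, Complex.exp_ofReal_mul_I_im]

lemma cis_re (θ : ℝ) : (cis θ).re = Real.cos θ := by
  simp [cis, Complex.exp_ofReal_mul_I_re]

lemma cis_zero : cis 0 = 1 := by simp [cis]

lemma continuous_cis : Continuous cis := by unfold cis; fun_prop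

lemma HasDerivAt.cis {θ : ℝ → ℝ} {θ' x : ℝ} (h : HasDerivAt θ θ' x) :
    HasDerivAt (fun x => cis (θ x)) (cis (θ x) * (θ' * Complex.I)) x := by
  unfold _root_.cis
  exact (h.ofReal_comp.mul_const Complex.I).cexp

lemma norm_cis_sub_one_le (θ : ℝ) : ‖cis θ - 1‖ ≤ |θ| := by
  have := Real.norm_exp_I_mul_ofReal_sub_one_le (x := θ)
  rw [mul_comm] at this
  simpa [cis] using this

/-- Integration by parts for an oscillating integral with monotone amplitude. -/
lemma norm_integral_mul_deriv_cis_le_of_mono {a b : ℝ} (hab : a ≤ b) {h h' θ θ' : ℝ → ℝ}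
    (hh : ∀ x ∈ Set.Icc a b, HasDerivAt h (h' x) x)
    (hθ : ∀ x ∈ Set.Icc a b, HasDerivAt θ (θ' x) x)
    (hh' : ContinuousOn h' (Set.Icc a b)) (hθ' : ContinuousOn θ' (Set.Icc a b))
    (hpos : ∀ x ∈ Set.Icc a b, 0 ≤ h' x) :
    ‖∫ x in a..b, ((h x * θ' x : ℝ) : ℂ) * cis (θ x)‖ ≤ |h a| + |h b| + (h b - h a) := by
  have hu : Set.uIcc a b = Set.Icc a b := Set.uIcc_of_le hab
  have chc : ContinuousOn h (Set.Icc a b) := fun x hx => (hh x hx).continuousAt.continuousWithinAt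
  have cθ : ContinuousOn (fun x => cis (θ x)) (Set.Icc a b) := continuous_cis.comp_continuousOn
    fun x hx => (hθ x hx).continuousAt.continuousWithinAt
  have i1 : IntervalIntegrable (fun x => ((h' x : ℝ) : ℂ) * cis (θ x)) volume a b := by
    apply ContinuousOn.intervalIntegrable; rw [hu]; fun_prop
  have i2 : IntervalIntegrable (fun x => ((h x * θ' x : ℝ) : ℂ) * cis (θ x)) volume a b := by
    apply ContinuousOn.intervalIntegrable; rw [hu]; fun_prop
  have key : ∫ x in a..b, (((h' x : ℝ) : ℂ) * cis (θ x) +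
      Complex.I * (((h x * θ' x : ℝ) : ℂ) * cis (θ x))) =
      (h b : ℂ) * cis (θ b) - (h a : ℂ) * cis (θ a) := by
    apply intervalIntegral.integral_eq_sub_of_hasDerivAt (f := fun x => (h x : ℂ) * cis (θ x))
    · intro x hx
      rw [hu] at hx
      exact ((hh x hx).ofReal_comp.mul (hθ x hx).cis).congr_deriv (by push_cast; ring)
    · exact i1.add (i2.const_mul _)
  rw [intervalIntegral.integral_add i1 (i2.const_mul _), intervalIntegral.integral_const_mul] at key
  have hI : ∫ x in a..b, ((h x * θ' x : ℝ) : ℂ) * cis (θ x) = -Complex.I *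
      ((h b : ℂ) * cis (θ b) - (h a : ℂ) * cis (θ a) - ∫ x in a..b, ((h' x : ℝ) : ℂ) * cis (θ x)) := by
    rw [← key]
    linear_combination (∫ x in a..b, ((h x * θ' x : ℝ) : ℂ) * cis (θ x)) * Complex.I_mul_I
  have hn : ‖∫ x in a..b, ((h' x : ℝ) : ℂ) * cis (θ x)‖ ≤ h b - h a := by
    have e : ∫ x in a..b, h' x = h b - h a :=
      intervalIntegral.integral_eq_sub_of_hasDerivAt (fun x hx => hh x (hu ▸ hx))
        (ContinuousOn.intervalIntegrable (by rwa [hu]))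
    rw [← e]
    apply intervalIntegral.norm_integral_le_of_norm_le hab
    · refine Filter.Eventually.of_forall fun x hx => ?_
      rw [norm_mul, norm_cis, Complex.norm_real, mul_one, Real.norm_of_nonneg]
      exact hpos x ⟨hx.1.le, hx.2⟩
    · exact ContinuousOn.intervalIntegrable (by rwa [hu])
  rw [hI, norm_mul, norm_neg, Complex.norm_I, one_mul]
  calc _ ≤ ‖(h b : ℂ) * cis (θ b) - (h a : ℂ) * cis (θ a)‖ +
        ‖∫ x in a..b, ((h' x : ℝ) : ℂ) * cis (θ x)‖ := norm_sub_le _ _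
    _ ≤ (‖(h b : ℂ) * cis (θ b)‖ + ‖(h a : ℂ) * cis (θ a)‖) + (h b - h a) :=
        add_le_add (norm_sub_le _ _) hn
    _ = _ := by simp [norm_cis]; ring

lemma norm_integral_mul_deriv_cis_le_of_anti {a b : ℝ} (hab : a ≤ b) {h h' θ θ' : ℝ → ℝ}
    (hh : ∀ x ∈ Set.Icc a b, HasDerivAt h (h' x) x)
    (hθ : ∀ x ∈ Set.Icc a b, HasDerivAt θ (θ' x) x)
    (hh' : ContinuousOn h' (Set.Icc a b)) (hθ' : ContinuousOn θ' (Set.Icc a b))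
    (hneg : ∀ x ∈ Set.Icc a b, h' x ≤ 0) :
    ‖∫ x in a..b, ((h x * θ' x : ℝ) : ℂ) * cis (θ x)‖ ≤ |h a| + |h b| + (h a - h b) := by
  have := norm_integral_mul_deriv_cis_le_of_mono hab (h := fun x => -h x) (h' := fun x => -h' x)
    (fun x hx => (hh x hx).neg) hθ hh'.neg hθ' (fun x hx => neg_nonneg.2 (hneg x hx))
  simp only [neg_mul, Complex.ofReal_neg, intervalIntegral.integral_neg, norm_neg, abs_neg] at this
  linarith

/-- The absolutely convergent integrand left after integrating the Fresnel integral by parts. -/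
noncomputable def fresnelKernel (u : ℝ) : ℂ := (cis (π * u ^ 2) - 1) / (2 * π * Complex.I * u ^ 2)

/-- The value of the Fresnel integral `∫ e^{iπu²} du` over the real line. -/
noncomputable def fresnelConst : ℂ := 2 * ∫ u in Set.Ioi (0 : ℝ), fresnelKernel u

lemma norm_fresnelKernel (u : ℝ) : ‖fresnelKernel u‖ = ‖cis (π * u ^ 2) - 1‖ / (2 * π * u ^ 2) := by
  rw [fresnelKernel, norm_div]
  congr 1
  simp [abs_of_pos Real.pi_pos]

lemma norm_fresnelKernel_le_half (u : ℝ) : ‖fresnelKernel u‖ ≤ 1 / 2 := by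
  rw [norm_fresnelKernel]
  rcases eq_or_ne u 0 with rfl | hu
  · simp
  rw [div_le_iff₀ (by positivity)]
  have := norm_cis_sub_one_le (π * u ^ 2)
  rw [abs_of_nonneg (by positivity)] at this
  linarith

lemma norm_fresnelKernel_le (u : ℝ) : ‖fresnelKernel u‖ ≤ (1 / π) * u ^ (-2 : ℝ) := by
  rw [norm_fresnelKernel]
  have h : ‖cis (π * u ^ 2) - 1‖ ≤ 2 := by
    refine (norm_sub_le _ _).trans ?_
    rw [norm_cis]; norm_num
  have e : u ^ (-2 : ℝ) = (u ^ 2)⁻¹ := by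
    rw [show (-2 : ℝ) = ((-2 : ℤ) : ℝ) by norm_num, Real.rpow_intCast]; rfl
  rw [e]
  calc _ ≤ 2 / (2 * π * u ^ 2) := by gcongr
    _ = _ := by field_simp

lemma measurable_fresnelKernel : Measurable fresnelKernel := by
  unfold fresnelKernel
  have := continuous_cis.measurable
  fun_prop

lemma integrableOn_fresnelKernel : IntegrableOn fresnelKernel (Set.Ioi 0) := by
  rw [← Set.Ioc_union_Ioi_eq_Ioi (zero_le_one : (0 : ℝ) ≤ 1)]
  refine IntegrableOn.union ?_ ?_
  · refine Measure.integrableOn_of_bounded (M := 1 / 2) (by simp)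
      measurable_fresnelKernel.aestronglyMeasurable ?_
    exact Filter.Eventually.of_forall norm_fresnelKernel_le_half
  · refine Integrable.mono' ((integrableOn_Ioi_rpow_of_lt (by norm_num : (-2 : ℝ) < -1)
      one_pos).const_mul (1 / π)) measurable_fresnelKernel.aestronglyMeasurable ?_
    exact Filter.Eventually.of_forall norm_fresnelKernel_le

lemma norm_integral_Ioi_fresnelKernel_le {P : ℝ} (hP : 0 < P) :
    ‖∫ u in Set.Ioi P, fresnelKernel u‖ ≤ 1 / (π * P) := by
  have h := norm_integral_le_of_norm_le ((integrableOn_Ioi_rpow_of_lt (by norm_num : (-2 : ℝ) < -1)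
      hP).const_mul (1 / π)) (Filter.Eventually.of_forall norm_fresnelKernel_le)
  refine h.trans (le_of_eq ?_)
  rw [integral_const_mul, integral_Ioi_rpow_of_lt (by norm_num) hP]
  norm_num
  rw [Real.rpow_neg_one]; field_simp

lemma integral_cis_sq_eq {P : ℝ} (hP : 0 < P) :
    ∫ u in (0 : ℝ)..P, cis (π * u ^ 2) =
      (cis (π * P ^ 2) - 1) / (2 * π * Complex.I * P) + ∫ u in (0 : ℝ)..P, fresnelKernel u := by
  have ik : IntervalIntegrable fresnelKernel volume 0 P := by
    rw [intervalIntegrable_iff_integrableOn_Ioc_of_le hP.le]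
    exact integrableOn_fresnelKernel.mono_set Set.Ioc_subset_Ioi_self
  have ic : IntervalIntegrable (fun u : ℝ => cis (π * u ^ 2)) volume 0 P := by
    apply Continuous.intervalIntegrable
    exact continuous_cis.comp (by fun_prop)
  set F : ℝ → ℂ := fun u => (cis (π * u ^ 2) - 1) / (2 * π * Complex.I * u) with hF
  have hπ : (π : ℂ) ≠ 0 := by exact_mod_cast Real.pi_ne_zero
  have F0 : F 0 = 0 := by simp [hF]
  have hnF : ∀ u, ‖F u‖ ≤ |u| / 2 := by
    intro u
    simp only [hF, norm_div, norm_mul, Complex.norm_I, Complex.norm_real, Complex.norm_ofNat, mul_one,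
      Real.norm_eq_abs, abs_of_pos Real.pi_pos]
    rcases eq_or_ne u 0 with rfl | hu
    · simp
    have hu' : 0 < |u| := abs_pos.2 hu
    rw [div_le_iff₀ (by positivity)]
    have := norm_cis_sub_one_le (π * u ^ 2)
    rw [abs_of_nonneg (by positivity)] at this
    have e : |u| / 2 * (2 * π * |u|) = π * u ^ 2 := by rw [← sq_abs u]; ring
    rwa [e]
  have h := intervalIntegral.integral_eq_sub_of_hasDeriv_right_of_le hP.le (f := F)
    (f' := fun u => cis (π * u ^ 2) - fresnelKernel u) (fun u hu => ?_) (fun u hu => ?_) (ic.sub ik)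
  · rw [intervalIntegral.integral_sub ic ik, F0] at h
    simp only [sub_zero] at h
    change _ = F P + _
    rw [← h]; ring
  · rcases eq_or_ne u 0 with rfl | hu0
    · apply ContinuousAt.continuousWithinAt
      unfold ContinuousAt
      rw [F0]
      refine squeeze_zero_norm hnF ?_
      have : Filter.Tendsto (fun t : ℝ => |t| / 2) (nhds 0) (nhds (|0| / 2)) := by
        apply Continuous.tendsto; fun_prop
      simpa using this
    · apply ContinuousAt.continuousWithinAt
      have h0 : (2 * π * Complex.I * u : ℂ) ≠ 0 := by
        simp [hπ, hu0]
      have := continuous_cis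
      simp only [hF]
      exact ContinuousAt.div (by fun_prop) (by fun_prop) h0
  · have hu0 : (u : ℂ) ≠ 0 := by exact_mod_cast hu.1.ne'
    apply HasDerivAt.hasDerivWithinAt
    have d1 : HasDerivAt (fun u : ℝ => π * u ^ 2) (π * (2 * u)) u := by
      simpa using (hasDerivAt_pow 2 u).const_mul π
    have d2 : HasDerivAt (fun u : ℝ => (2 * π * Complex.I * u : ℂ)) (2 * π * Complex.I) u := by
      simpa using (Complex.ofRealCLM.hasDerivAt (x := u)).const_mul (2 * π * Complex.I)
    refine ((d1.cis.sub_const 1).div d2 (by simp [hπ, hu0])).congr_deriv ?_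
    simp only [fresnelKernel]
    have := Complex.I_ne_zero
    push_cast
    field_simp

lemma norm_integral_cis_sq_sub_le {P : ℝ} (hP : 0 < P) :
    ‖(∫ u in (0 : ℝ)..P, cis (π * u ^ 2)) - fresnelConst / 2‖ ≤ 1 / P := by
  have e : fresnelConst / 2 = (∫ u in (0 : ℝ)..P, fresnelKernel u) +
      ∫ u in Set.Ioi P, fresnelKernel u := by
    rw [fresnelConst, mul_div_cancel_left₀ _ (two_ne_zero),
      intervalIntegral.integral_of_le hP.le, ← setIntegral_union (Set.Ioc_disjoint_Ioi le_rfl)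
      measurableSet_Ioi (integrableOn_fresnelKernel.mono_set Set.Ioc_subset_Ioi_self)
      (integrableOn_fresnelKernel.mono_set (Set.Ioi_subset_Ioi hP.le)),
      Set.Ioc_union_Ioi_eq_Ioi hP.le]
  rw [integral_cis_sq_eq hP, e]
  have h1 : ‖(cis (π * P ^ 2) - 1) / (2 * π * Complex.I * P)‖ ≤ 1 / (π * P) := by
    have h : ‖cis (π * P ^ 2) - 1‖ ≤ 2 := by
      refine (norm_sub_le _ _).trans ?_
      rw [norm_cis]; norm_num
    simp only [norm_div, norm_mul, Complex.norm_I, Complex.norm_real, Complex.norm_ofNat, mul_one,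
      Real.norm_eq_abs, abs_of_pos Real.pi_pos, abs_of_pos hP]
    calc _ ≤ 2 / (2 * π * P) := by gcongr
      _ = _ := by field_simp
  have h2 := norm_integral_Ioi_fresnelKernel_le hP
  have h3 : 1 / (π * P) + 1 / (π * P) ≤ 1 / P := by
    have := Real.pi_gt_three
    rw [← add_div, div_le_div_iff₀ (by positivity) hP]
    nlinarith
  calc _ = ‖(cis (π * P ^ 2) - 1) / (2 * π * Complex.I * P) -
        ∫ u in Set.Ioi P, fresnelKernel u‖ := by congr 1; ring
    _ ≤ _ := (norm_sub_le _ _).trans ((add_le_add h1 h2).trans h3)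

lemma norm_integral_cis_sq_sub_le_const {P : ℝ} (hP : 0 ≤ P) :
    ‖(∫ u in (0 : ℝ)..P, cis (π * u ^ 2)) - fresnelConst / 2‖ ≤ 1 + ‖fresnelConst‖ := by
  rcases le_or_gt 1 P with h | h
  · refine (norm_integral_cis_sq_sub_le (by linarith)).trans ?_
    have : 1 / P ≤ 1 := by rw [div_le_one (by linarith)]; exact h
    linarith [norm_nonneg fresnelConst]
  · have h1 : ‖∫ u in (0 : ℝ)..P, cis (π * u ^ 2)‖ ≤ 1 * |P - 0| :=
      intervalIntegral.norm_integral_le_of_norm_le_const fun x _ => (norm_cis _).le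
    rw [sub_zero, abs_of_nonneg hP] at h1
    refine (norm_sub_le _ _).trans ?_
    rw [norm_div, Complex.norm_ofNat]
    linarith [norm_nonneg fresnelConst]

lemma fresnelConst_im_pos : 0 < fresnelConst.im := by
  have e : ∀ u : ℝ, (fresnelKernel u).im = (1 - Real.cos (π * u ^ 2)) / (2 * π * u ^ 2) := by
    intro u
    have : fresnelKernel u = (cis (π * u ^ 2) - 1) * (-Complex.I) * ((1 / (2 * π * u ^ 2) : ℝ) : ℂ) := by
      unfold fresnelKernel
      push_cast
      rw [mul_right_comm (2 * (π : ℂ)) Complex.I, div_mul_eq_div_div, div_eq_mul_inv _ Complex.I,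
        Complex.inv_I]
      ring
    rw [this, Complex.im_mul_ofReal]
    simp [cis_re, cis_im, Complex.mul_im]
    ring
  have e2 : fresnelConst.im = 2 * ∫ u in Set.Ioi (0 : ℝ), (fresnelKernel u).im := by
    rw [fresnelConst]
    have := integral_im (𝕜 := ℂ) integrableOn_fresnelKernel
    simp only [RCLike.im_to_complex] at this
    rw [this]
    simp [Complex.mul_im]
  rw [e2]
  refine mul_pos two_pos ?_
  have hnn : ∀ u : ℝ, 0 ≤ (fresnelKernel u).im := fun u => by
    rw [e]; exact div_nonneg (by linarith [Real.cos_le_one (π * u ^ 2)]) (by positivity)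
  have hInt : IntegrableOn (fun u => (fresnelKernel u).im) (Set.Ioi 0) :=
    integrableOn_fresnelKernel.im
  rw [setIntegral_pos_iff_support_of_nonneg_ae (Filter.Eventually.of_forall hnn) hInt]
  refine lt_of_lt_of_le (b := volume (Set.Ioo (0 : ℝ) 1)) (by simp) (measure_mono ?_)
  intro u hu
  refine ⟨?_, hu.1⟩
  simp only [Function.mem_support, e]
  apply ne_of_gt
  have hu0 := hu.1
  have : Real.cos (π * u ^ 2) < 1 := by
    rw [← Real.cos_zero]
    apply Real.cos_lt_cos_of_nonneg_of_le_pi le_rfl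
    · have : u ^ 2 ≤ 1 := by nlinarith [hu.1, hu.2]
      nlinarith [Real.pi_pos]
    · have := Real.pi_pos; positivity
  have h2 : 0 < 1 - Real.cos (π * u ^ 2) := by linarith
  positivity

lemma integral_cis_mul_sq_eq {z : ℝ} (hz : 0 < z) (P : ℝ) :
    (∫ p in (0 : ℝ)..P, cis (π * z * p ^ 2)) =
      (∫ u in (0 : ℝ)..(√z * P), cis (π * u ^ 2)) / (√z : ℝ) := by
  have hs : 0 < √z := Real.sqrt_pos.2 hz
  have := intervalIntegral.integral_comp_mul_left (a := 0) (b := P)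
    (fun u : ℝ => cis (π * u ^ 2)) hs.ne'
  rw [mul_zero] at this
  rw [div_eq_inv_mul, ← Complex.ofReal_inv, ← Complex.real_smul, ← this]
  congr 1; ext p; rw [mul_pow, Real.sq_sqrt hz.le]; ring_nf

lemma norm_integral_cis_mul_sq_sub_le {z P : ℝ} (hz : 0 < z) (hP : 0 < P) :
    ‖(∫ p in (0 : ℝ)..P, cis (π * z * p ^ 2)) - fresnelConst / 2 / (√z : ℝ)‖ ≤ 1 / (z * P) := by
  have hs : 0 < √z := Real.sqrt_pos.2 hz
  rw [integral_cis_mul_sq_eq hz, ← sub_div, norm_div, Complex.norm_real,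
    Real.norm_of_nonneg hs.le]
  calc _ ≤ (1 / (√z * P)) / √z := by gcongr; exact norm_integral_cis_sq_sub_le (by positivity)
    _ = _ := by
      rw [div_div]; congr 1
      nlinarith [Real.sq_sqrt hz.le]

lemma norm_integral_cis_mul_sq_sub_le_const {z P : ℝ} (hz : 0 < z) (hP : 0 ≤ P) :
    ‖(∫ p in (0 : ℝ)..P, cis (π * z * p ^ 2)) - fresnelConst / 2 / (√z : ℝ)‖ ≤
      (1 + ‖fresnelConst‖) / √z := by
  have hs : 0 < √z := Real.sqrt_pos.2 hz
  rw [integral_cis_mul_sq_eq hz, ← sub_div, norm_div, Complex.norm_real,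
    Real.norm_of_nonneg hs.le]
  gcongr; exact norm_integral_cis_sq_sub_le_const (by positivity)

lemma hasDerivAt_sub_inv {w : ℝ} (hw : w ≠ 0) :
    HasDerivAt (fun w : ℝ => w - w⁻¹) (1 + (w ^ 2)⁻¹) w := by
  refine ((hasDerivAt_id w).sub (hasDerivAt_inv hw)).congr_deriv ?_
  ring

/-- Replacing the amplitude `2w³` by `1 + w⁻²`, the derivative of `w - w⁻¹`, in an oscillatory
integral with stationary point `1`. -/
lemma norm_integral_amplitude_sub_le {z w₀ w₁ : ℝ} (hz : 0 < z) (h0 : 0 < w₀) (h01 : w₀ ≤ w₁)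
    (h1 : 1 ≤ w₁) :
    ‖∫ w in w₀..w₁, ((2 * w ^ 3 - (1 + (w ^ 2)⁻¹) : ℝ) : ℂ) * cis (π * z * (w - w⁻¹) ^ 2)‖ ≤
      3 * w₁ ^ 2 / z := by
  have hpi := Real.pi_gt_three
  set N : ℝ → ℝ := fun w => 2 * w ^ 5 + 2 * w ^ 4 + 2 * w ^ 3 + w ^ 2 + w with hN
  set D : ℝ → ℝ := fun w => w ^ 3 + w ^ 2 + w + 1 with hD
  set N' : ℝ → ℝ := fun w => 10 * w ^ 4 + 8 * w ^ 3 + 6 * w ^ 2 + 2 * w + 1 with hN'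
  set D' : ℝ → ℝ := fun w => 3 * w ^ 2 + 2 * w + 1 with hD'
  have dN : ∀ w, HasDerivAt N (N' w) w := fun w => by
    refine ((((((hasDerivAt_pow 5 w).const_mul 2).add ((hasDerivAt_pow 4 w).const_mul 2)).add
      ((hasDerivAt_pow 3 w).const_mul 2)).add (hasDerivAt_pow 2 w)).add
      (hasDerivAt_id w)).congr_deriv ?_
    simp only [hN']; norm_num; ring
  have dD : ∀ w, HasDerivAt D (D' w) w := fun w => by
    refine (((((hasDerivAt_pow 3 w)).add (hasDerivAt_pow 2 w)).add
      (hasDerivAt_id w)).add_const 1).congr_deriv ?_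
    simp only [hD']; norm_num
  have Dpos : ∀ w, 0 < w → 0 < D w := fun w hw => by simp only [hD]; positivity
  set h : ℝ → ℝ := fun w => N w / D w / (2 * π * z) with hh
  have hpw : ∀ w ∈ Set.Icc w₀ w₁, 0 < w := fun w hw => h0.trans_le hw.1
  have key := norm_integral_mul_deriv_cis_le_of_mono h01 (h := h)
    (h' := fun w => (N' w * D w - N w * D' w) / D w ^ 2 / (2 * π * z))
    (θ := fun w => π * z * (w - w⁻¹) ^ 2)
    (θ' := fun w => π * z * (2 * (w - w⁻¹) * (1 + (w ^ 2)⁻¹)))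
    (fun w hw => ((dN w).div (dD w) (Dpos w (hpw w hw)).ne').div_const _)
    (fun w hw => by
      refine (((hasDerivAt_sub_inv (hpw w hw).ne').pow 2).const_mul (π * z)).congr_deriv ?_
      norm_num) ?_ ?_ ?_
  · have e : ∫ w in w₀..w₁, ((2 * w ^ 3 - (1 + (w ^ 2)⁻¹) : ℝ) : ℂ) * cis (π * z * (w - w⁻¹) ^ 2) =
        ∫ w in w₀..w₁, ((h w * (π * z * (2 * (w - w⁻¹) * (1 + (w ^ 2)⁻¹))) : ℝ) : ℂ) *
          cis (π * z * (w - w⁻¹) ^ 2) := by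
      apply intervalIntegral.integral_congr
      intro w hw
      rw [Set.uIcc_of_le h01] at hw
      have hw0 := hpw w hw
      have hd := Dpos w hw0
      simp only
      congr 2
      simp only [hh]
      rw [div_div, div_mul_eq_mul_div, eq_div_iff (by positivity)]
      simp only [hN, hD]
      field_simp
      ring
    rw [e]
    refine key.trans ?_
    have hnn : ∀ w, 0 < w → 0 ≤ h w := fun w hw => by
      have := Dpos w hw
      have : 0 < N w := by simp only [hN]; positivity
      simp only [hh]; positivity
    rw [abs_of_nonneg (hnn _ h0), abs_of_nonneg (hnn _ (h0.trans_le h01))]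
    have hb : h w₁ ≤ 3 / 2 * w₁ ^ 2 / z := by
      have hw1 : 0 < w₁ := by linarith
      have hd := Dpos w₁ hw1
      simp only [hh]
      rw [div_div, div_le_div_iff₀ (by positivity) hz]
      have h8 : N w₁ ≤ 8 * w₁ ^ 2 * D w₁ := by
        simp only [hN, hD]
        have : w₁ ≤ w₁ ^ 2 := by nlinarith
        nlinarith [pow_pos hw1 2, pow_pos hw1 3, pow_pos hw1 4, pow_pos hw1 5]
      have : 0 < w₁ ^ 2 * D w₁ := by positivity
      nlinarith [mul_le_mul_of_nonneg_right h8 hz.le, mul_pos hz this]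
    calc _ = 2 * h w₁ := by ring
      _ ≤ 2 * (3 / 2 * w₁ ^ 2 / z) := by linarith
      _ = _ := by ring
  · have : ∀ w ∈ Set.Icc w₀ w₁, D w ^ 2 ≠ 0 := fun w hw => (pow_pos (Dpos w (hpw w hw)) 2).ne'
    simp only [hN, hD, hN', hD'] at this ⊢
    exact ((by fun_prop : ContinuousOn _ _).div (by fun_prop) this).div_const _
  · have h1 : ∀ w ∈ Set.Icc w₀ w₁, w ≠ 0 := fun w hw => (hpw w hw).ne'
    have h2 : ∀ w ∈ Set.Icc w₀ w₁, w ^ 2 ≠ 0 := fun w hw => (pow_pos (hpw w hw) 2).ne'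
    fun_prop (disch := assumption)
  · intro w hw
    have hw0 := hpw w hw
    have hd := Dpos w hw0
    have : 0 ≤ N' w * D w - N w * D' w := by
      have e : N' w * D w - N w * D' w = 4 * w ^ 7 + 8 * w ^ 6 + 12 * w ^ 5 + 17 * w ^ 4 +
          10 * w ^ 3 + 6 * w ^ 2 + 2 * w + 1 := by
        simp only [hN, hD, hN', hD']; ring
      rw [e]; positivity
    positivity

lemma continuous_cis_mul_sq (z : ℝ) : Continuous fun p : ℝ => cis (π * z * p ^ 2) :=
  continuous_cis.comp (by fun_prop)

lemma integral_substitution_sub_inv {z w₀ w₁ : ℝ} (h0 : 0 < w₀) (h01 : w₀ ≤ w₁) :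
    ∫ w in w₀..w₁, ((1 + (w ^ 2)⁻¹ : ℝ) : ℂ) * cis (π * z * (w - w⁻¹) ^ 2) =
      (∫ p in (0 : ℝ)..(w₁ - w₁⁻¹), cis (π * z * p ^ 2)) +
        ∫ p in (0 : ℝ)..(w₀⁻¹ - w₀), cis (π * z * p ^ 2) := by
  have hpw : ∀ w ∈ Set.uIcc w₀ w₁, w ≠ 0 := fun w hw => by
    rw [Set.uIcc_of_le h01] at hw; exact (h0.trans_le hw.1).ne'
  have h2 : ∀ w ∈ Set.uIcc w₀ w₁, w ^ 2 ≠ 0 := fun w hw => pow_ne_zero 2 (hpw w hw)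
  have h := intervalIntegral.integral_deriv_smul_comp (a := w₀) (b := w₁)
    (f := fun w : ℝ => w - w⁻¹) (f' := fun w => 1 + (w ^ 2)⁻¹)
    (g := fun p : ℝ => cis (π * z * p ^ 2))
    (fun w hw => hasDerivAt_sub_inv (hpw w hw)) (by fun_prop (disch := assumption))
    (continuous_cis_mul_sq z)
  simp only [Complex.real_smul, Function.comp_apply] at h
  rw [h]
  have e : ∫ p in (0 : ℝ)..(w₀⁻¹ - w₀), cis (π * z * p ^ 2) =
      -∫ p in (0 : ℝ)..(w₀ - w₀⁻¹), cis (π * z * p ^ 2) := by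
    have := intervalIntegral.integral_comp_neg (a := w₀ - w₀⁻¹) (b := 0)
      (fun p : ℝ => cis (π * z * p ^ 2))
    simp only [neg_zero, neg_sub, neg_sq] at this
    rw [← this, intervalIntegral.integral_symm]
  rw [e, ← sub_eq_add_neg]
  rw [intervalIntegral.integral_interval_sub_left]
  all_goals exact (continuous_cis_mul_sq z).intervalIntegrable _ _

/-- The integrals arising from Poisson summation over `c`. -/
noncomputable def phaseIntegral (s ρ n v : ℝ) : ℂ :=
  ∫ c in (s / ρ)..s, (c : ℂ) * cis (π * (n * s ^ 2 / c + v * c))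

lemma phaseIntegral_eq {s ρ n r σ : ℝ} (hs : 0 < s) (hr : 0 < r) (hσ : 0 < σ) (hσ1 : 1 ≤ σ)
    (hρ : ρ = σ ^ 2) :
    phaseIntegral s ρ n (n * r ^ 4) = ((s ^ 2 / r ^ 4 : ℝ) : ℂ) * cis (2 * π * (n * r ^ 2 * s)) *
      ∫ w in (r / σ)..r, ((2 * w ^ 3 : ℝ) : ℂ) * cis (π * (n * r ^ 2 * s) * (w - w⁻¹) ^ 2) := by
  have h01 : r / σ ≤ r := div_le_self hr.le hσ1
  have hw0 : 0 < r / σ := by positivity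
  have hpw : ∀ w ∈ Set.uIcc (r / σ) r, 0 < w := fun w hw => by
    rw [Set.uIcc_of_le h01] at hw; exact (hw0.trans_le hw.1)
  have h := intervalIntegral.integral_deriv_smul_comp' (a := r / σ) (b := r)
    (f := fun w : ℝ => s / r ^ 2 * w ^ 2) (f' := fun w => s / r ^ 2 * (2 * w))
    (g := fun c : ℝ => (c : ℂ) * cis (π * (n * s ^ 2 / c + n * r ^ 4 * c)))
    (fun w _ => by simpa using (hasDerivAt_pow 2 w).const_mul (s / r ^ 2)) (by fun_prop) ?_
  · have e0 : s / r ^ 2 * (r / σ) ^ 2 = s / ρ := by rw [hρ]; field_simp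
    have e1 : s / r ^ 2 * r ^ 2 = s := by field_simp
    rw [e0, e1] at h
    rw [phaseIntegral, ← h, ← intervalIntegral.integral_const_mul]
    apply intervalIntegral.integral_congr
    intro w hw
    have hw' := hpw w hw
    simp only [Function.comp_apply, Complex.real_smul]
    have e : π * (n * s ^ 2 / (s / r ^ 2 * w ^ 2) + n * r ^ 4 * (s / r ^ 2 * w ^ 2)) =
        2 * π * (n * r ^ 2 * s) + π * (n * r ^ 2 * s) * (w - w⁻¹) ^ 2 := by
      field_simp; ring
    rw [e, cis_add]
    push_cast
    have : (r : ℂ) ≠ 0 := by exact_mod_cast hr.ne'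
    field_simp
  · have : ∀ c ∈ (fun w : ℝ => s / r ^ 2 * w ^ 2) '' Set.uIcc (r / σ) r, c ≠ 0 := by
      rintro c ⟨w, hw, rfl⟩
      have := hpw w hw
      simp only; positivity
    exact Complex.continuous_ofReal.continuousOn.mul
      (continuous_cis.comp_continuousOn (by fun_prop (disch := assumption)))

/-- Stationary phase for `phaseIntegral`, with `r = (v / n) ^ (1 / 4)`. -/
lemma norm_phaseIntegral_sub_le_aux {s ρ n r : ℝ} (hs : 0 < s) (hn : 1 ≤ n) (hr : 1 ≤ r)
    (hρ1 : 1 ≤ ρ) (hrρ : r ^ 2 ≤ ρ) (hρ : 2 * s * n ≤ ρ) :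
    ‖phaseIntegral s ρ n (n * r ^ 4) - ((s ^ 2 / r ^ 4 : ℝ) : ℂ) * cis (2 * π * (n * r ^ 2 * s)) *
      ((if r = 1 then 1 / 2 else 1) * (fresnelConst / (√(n * r ^ 2 * s) : ℝ)))‖ ≤
      (6 + ‖fresnelConst‖) * s * (1 / (n * r ^ 4) + 1 / (n * r ^ 4 - n)) := by
  set z := n * r ^ 2 * s with hz
  have hz0 : 0 < z := by positivity
  have hσ0 : 0 < √ρ := by positivity
  have hσ1 : 1 ≤ √ρ := by rw [Real.one_le_sqrt]; exact hρ1
  have hσ2 : √ρ ^ 2 = ρ := Real.sq_sqrt (by linarith)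
  have hrσ : r ≤ √ρ := Real.le_sqrt_of_sq_le hrρ
  have hr0 : 0 < r := by linarith
  rw [phaseIntegral_eq hs hr0 hσ0 hσ1 hσ2.symm, ← mul_sub, norm_mul, norm_mul, norm_cis,
    Complex.norm_real, Real.norm_of_nonneg (by positivity), mul_one]
  set w₀ := r / √ρ with hw0
  have h0 : 0 < w₀ := by positivity
  have h01 : w₀ ≤ r := div_le_self hr0.le hσ1
  have hw1 : w₀ ≤ 1 := by rw [hw0, div_le_one hσ0]; exact hrσ
  have hpw : ∀ w ∈ Set.uIcc w₀ r, w ≠ 0 := fun w hw => by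
    rw [Set.uIcc_of_le h01] at hw; exact (h0.trans_le hw.1).ne'
  have hpw2 : ∀ w ∈ Set.uIcc w₀ r, w ^ 2 ≠ 0 := fun w hw => pow_ne_zero 2 (hpw w hw)
  have split : ∫ w in w₀..r, ((2 * w ^ 3 : ℝ) : ℂ) * cis (π * z * (w - w⁻¹) ^ 2) =
      (∫ w in w₀..r, ((2 * w ^ 3 - (1 + (w ^ 2)⁻¹) : ℝ) : ℂ) * cis (π * z * (w - w⁻¹) ^ 2)) +
      ∫ w in w₀..r, ((1 + (w ^ 2)⁻¹ : ℝ) : ℂ) * cis (π * z * (w - w⁻¹) ^ 2) := by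
    rw [← intervalIntegral.integral_add]
    · congr 1; ext w; push_cast; ring
    all_goals
      refine ContinuousOn.intervalIntegrable (ContinuousOn.mul
        (Complex.continuous_ofReal.comp_continuousOn ?_) (continuous_cis.comp_continuousOn ?_))
      all_goals fun_prop (disch := assumption)
  rw [split, integral_substitution_sub_inv h0 h01]
  set E := ∫ w in w₀..r, ((2 * w ^ 3 - (1 + (w ^ 2)⁻¹) : ℝ) : ℂ) * cis (π * z * (w - w⁻¹) ^ 2)
  set I₁ := ∫ p in (0 : ℝ)..(r - r⁻¹), cis (π * z * p ^ 2) with hI1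
  set I₀ := ∫ p in (0 : ℝ)..(w₀⁻¹ - w₀), cis (π * z * p ^ 2)
  have hE : s ^ 2 / r ^ 4 * ‖E‖ ≤ 3 * s * (1 / (n * r ^ 4)) := by
    calc _ ≤ s ^ 2 / r ^ 4 * (3 * r ^ 2 / z) := by
          gcongr; exact norm_integral_amplitude_sub_le hz0 h0 h01 hr
      _ = _ := by simp only [hz]; field_simp
  have h0' : s ^ 2 / r ^ 4 * ‖I₀ - fresnelConst / 2 / (√z : ℝ)‖ ≤
      (3 + ‖fresnelConst‖) * s * (1 / (n * r ^ 4)) := by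
    rcases le_or_gt (r ^ 2) (ρ / 2) with h | h
    · have hw2 : w₀ ^ 2 ≤ 1 / 2 := by
        rw [hw0, div_pow, hσ2, div_le_iff₀ (by linarith)]; linarith
      have hP : 1 / 2 ≤ w₀⁻¹ - w₀ := by
        rw [inv_eq_one_div, le_sub_iff_add_le, le_div_iff₀ h0]
        nlinarith
      have h1 := norm_integral_cis_mul_sq_sub_le hz0 (P := w₀⁻¹ - w₀) (by linarith)
      have h2 : 1 / (z * (w₀⁻¹ - w₀)) ≤ 2 * r ^ 2 / z := by
        rw [div_le_div_iff₀ (by positivity) hz0]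
        have : z * (1 / 2) ≤ z * (w₀⁻¹ - w₀) := by gcongr
        nlinarith [mul_pos hz0 (pow_pos hr0 2), one_le_pow₀ hr (n := 2)]
      calc _ ≤ s ^ 2 / r ^ 4 * (2 * r ^ 2 / z) := by gcongr; exact h1.trans h2
        _ = 2 * s * (1 / (n * r ^ 4)) := by simp only [hz]; field_simp
        _ ≤ _ := by gcongr; linarith [norm_nonneg fresnelConst]
    · have hP : 0 ≤ w₀⁻¹ - w₀ := by
        have : 1 ≤ w₀⁻¹ := (one_le_inv₀ h0).2 hw1
        linarith
      have h1 := norm_integral_cis_mul_sq_sub_le_const hz0 hP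
      have h2 : s * n ≤ √z := by
        apply Real.le_sqrt_of_sq_le
        have : s * n ≤ r ^ 2 := by linarith
        calc (s * n) ^ 2 = s * n * (s * n) := by ring
          _ ≤ s * n * r ^ 2 := by gcongr
          _ = z := by rw [hz]; ring
      calc _ ≤ s ^ 2 / r ^ 4 * ((1 + ‖fresnelConst‖) / √z) := by gcongr
        _ ≤ s ^ 2 / r ^ 4 * ((1 + ‖fresnelConst‖) / (s * n)) := by gcongr
        _ = (1 + ‖fresnelConst‖) * s * (1 / (n * r ^ 4)) := by field_simp
        _ ≤ _ := by gcongr; linarith [norm_nonneg fresnelConst]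
  have hd : n * r ^ 4 - n = n * (r ^ 4 - 1) := by ring
  have hr4 : 0 ≤ r ^ 4 - 1 := by linarith [one_le_pow₀ hr (n := 4)]
  by_cases h1r : r = 1
  · have hI : I₁ = 0 := by rw [hI1, h1r]; simp
    rw [if_pos h1r, hI]
    have e : E + (0 + I₀) - 1 / 2 * (fresnelConst / (√z : ℝ)) =
        E + (I₀ - fresnelConst / 2 / (√z : ℝ)) := by ring
    rw [e]
    calc _ ≤ s ^ 2 / r ^ 4 * (‖E‖ + ‖I₀ - fresnelConst / 2 / (√z : ℝ)‖) := by
          gcongr; exact norm_add_le _ _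
      _ ≤ 3 * s * (1 / (n * r ^ 4)) + (3 + ‖fresnelConst‖) * s * (1 / (n * r ^ 4)) := by
          rw [mul_add]; exact add_le_add hE h0'
      _ = (6 + ‖fresnelConst‖) * s * (1 / (n * r ^ 4)) := by ring
      _ ≤ _ := by
          gcongr
          rw [le_add_iff_nonneg_right, hd]
          positivity
  · have hr1 : 1 < r := lt_of_le_of_ne hr (Ne.symm h1r)
    rw [if_neg h1r, one_mul]
    have e : E + (I₁ + I₀) - fresnelConst / (√z : ℝ) =
        E + (I₁ - fresnelConst / 2 / (√z : ℝ)) + (I₀ - fresnelConst / 2 / (√z : ℝ)) := by ring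
    rw [e]
    have hP : 0 < r - r⁻¹ := by
      have : r⁻¹ < 1 := inv_lt_one_of_one_lt₀ hr1
      linarith
    have hI : s ^ 2 / r ^ 4 * ‖I₁ - fresnelConst / 2 / (√z : ℝ)‖ ≤ 2 * s * (1 / (n * r ^ 4 - n)) := by
      have hr2 : 0 < r ^ 2 - 1 := by nlinarith
      calc _ ≤ s ^ 2 / r ^ 4 * (1 / (z * (r - r⁻¹))) := by
            gcongr; exact norm_integral_cis_mul_sq_sub_le hz0 hP
        _ = s / n * (1 / (r ^ 5 * (r ^ 2 - 1))) := by
            have : r - r⁻¹ = (r ^ 2 - 1) / r := by field_simp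
            rw [this]; simp only [hz]; field_simp
        _ ≤ s / n * (2 / ((r ^ 2 + 1) * (r ^ 2 - 1))) := by
            gcongr ?_ * ?_
            rw [div_le_div_iff₀ (by positivity) (by positivity)]
            have : r ^ 2 + 1 ≤ 2 * r ^ 5 := by
              have := pow_le_pow_right₀ hr (show 2 ≤ 5 by norm_num)
              have := one_le_pow₀ hr (n := 5)
              linarith
            nlinarith
        _ = _ := by
            have : n * r ^ 4 - n = n * ((r ^ 2 + 1) * (r ^ 2 - 1)) := by ring
            rw [this]; field_simp
    have hp : 0 ≤ 1 / (n * r ^ 4 - n) := by rw [hd]; positivity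
    calc _ ≤ s ^ 2 / r ^ 4 * (‖E‖ + ‖I₁ - fresnelConst / 2 / (√z : ℝ)‖ +
            ‖I₀ - fresnelConst / 2 / (√z : ℝ)‖) := by
          gcongr; exact norm_add₃_le
      _ ≤ 3 * s * (1 / (n * r ^ 4)) + 2 * s * (1 / (n * r ^ 4 - n)) +
          (3 + ‖fresnelConst‖) * s * (1 / (n * r ^ 4)) := by
          rw [mul_add, mul_add]; exact add_le_add (add_le_add hE hI) h0'
      _ ≤ _ := by
          have := mul_nonneg (mul_nonneg (add_nonneg zero_le_four (norm_nonneg fresnelConst)) hs.le) hp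
          linarith

/-- First derivative test for `phaseIntegral` without stationary point, `v < n`. -/
lemma norm_phaseIntegral_le_of_lt {s ρ n v : ℝ} (hs : 0 < s) (hn : 0 < n) (hρ : 1 ≤ ρ)
    (hv : v < n) : ‖phaseIntegral s ρ n v‖ ≤ s * (1 / (n - v)) := by
  have hab : s / ρ ≤ s := div_le_self hs.le hρ
  have ha : 0 < s / ρ := by positivity
  have hpi := Real.pi_gt_three
  have hpos : ∀ c ∈ Set.Icc (s / ρ) s, 0 < c := fun c hc => ha.trans_le hc.1
  have hden : ∀ c ∈ Set.Icc (s / ρ) s, 0 < n * s ^ 2 - v * c ^ 2 := fun c hc => by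
    have h1 : c ^ 2 ≤ s ^ 2 := pow_le_pow_left₀ (hpos c hc).le hc.2 2
    have := pow_pos (hpos c hc) 2
    nlinarith
  have key := norm_integral_mul_deriv_cis_le_of_anti hab
    (h := fun c => -(c ^ 3 / (n * s ^ 2 - v * c ^ 2)) / π)
    (h' := fun c => -((3 * c ^ 2 * (n * s ^ 2 - v * c ^ 2) - c ^ 3 * (-(v * (2 * c)))) /
      (n * s ^ 2 - v * c ^ 2) ^ 2) / π)
    (θ := fun c => π * (n * s ^ 2 / c + v * c))
    (θ' := fun c => π * (n * s ^ 2 * (-(c ^ 2)⁻¹) + v))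
    (fun c hc => by
      have d1 : HasDerivAt (fun c : ℝ => n * s ^ 2 - v * c ^ 2) (-(v * (2 * c))) c := by
        simpa using ((hasDerivAt_pow 2 c).const_mul v).const_sub (n * s ^ 2)
      refine ((((hasDerivAt_pow 3 c).div d1 (hden c hc).ne').neg).div_const π).congr_deriv ?_
      norm_num)
    (fun c hc => by
      refine ((((hasDerivAt_inv (hpos c hc).ne').const_mul (n * s ^ 2)).add
        ((hasDerivAt_id c).const_mul v)).const_mul π).congr_deriv ?_
      simp) ?_ ?_ ?_
  · have e : phaseIntegral s ρ n v = ∫ c in (s / ρ)..s,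
        ((-(c ^ 3 / (n * s ^ 2 - v * c ^ 2)) / π * (π * (n * s ^ 2 * (-(c ^ 2)⁻¹) + v)) : ℝ) : ℂ) *
          cis (π * (n * s ^ 2 / c + v * c)) := by
      apply intervalIntegral.integral_congr
      intro c hc
      rw [Set.uIcc_of_le hab] at hc
      have h1 := hpos c hc
      have h2 := hden c hc
      simp only
      congr 2
      rw [show n * s ^ 2 * (-(c ^ 2)⁻¹) + v = -(n * s ^ 2 - v * c ^ 2) / c ^ 2 by
        field_simp; ring]
      generalize n * s ^ 2 - v * c ^ 2 = D at h2
      field_simp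
    rw [e]
    refine key.trans ?_
    have hnn : ∀ c ∈ Set.Icc (s / ρ) s, 0 ≤ c ^ 3 / (n * s ^ 2 - v * c ^ 2) / π := fun c hc => by
      have h1 := hpos c hc
      have h2 := hden c hc
      positivity
    have n0 := hnn _ (Set.left_mem_Icc.2 hab)
    have n1 := hnn _ (Set.right_mem_Icc.2 hab)
    rw [neg_div, neg_div, abs_neg, abs_neg, abs_of_nonneg n0, abs_of_nonneg n1]
    have e1 : s ^ 3 / (n * s ^ 2 - v * s ^ 2) = s * (1 / (n - v)) := by
      have : n - v ≠ 0 := by linarith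
      rw [show n * s ^ 2 - v * s ^ 2 = s ^ 2 * (n - v) by ring]
      field_simp
    have e2 : 0 ≤ s * (1 / (n - v)) := by
      have : 0 < n - v := by linarith
      positivity
    rw [e1]
    have : 2 * (s * (1 / (n - v)) / π) ≤ s * (1 / (n - v)) := by
      rw [← mul_div_assoc, div_le_iff₀ (by positivity)]
      nlinarith
    linarith
  · have h1 : ∀ c ∈ Set.Icc (s / ρ) s, (n * s ^ 2 - v * c ^ 2) ^ 2 ≠ 0 :=
      fun c hc => (pow_pos (hden c hc) 2).ne'
    fun_prop (disch := assumption)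
  · have h1 : ∀ c ∈ Set.Icc (s / ρ) s, c ^ 2 ≠ 0 := fun c hc => (pow_pos (hpos c hc) 2).ne'
    fun_prop (disch := assumption)
  · intro c hc
    have h1 := hpos c hc
    have h2 := hden c hc
    have h3 : 0 ≤ 3 * c ^ 2 * (n * s ^ 2 - v * c ^ 2) - c ^ 3 * (-(v * (2 * c))) := by
      have : 3 * c ^ 2 * (n * s ^ 2 - v * c ^ 2) - c ^ 3 * (-(v * (2 * c))) =
        c ^ 2 * (2 * n * s ^ 2 + (n * s ^ 2 - v * c ^ 2)) := by ring
      rw [this]; positivity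
    have : 0 ≤ (3 * c ^ 2 * (n * s ^ 2 - v * c ^ 2) - c ^ 3 * (-(v * (2 * c)))) /
      (n * s ^ 2 - v * c ^ 2) ^ 2 / π := by positivity
    rw [neg_div]; linarith

/-- First derivative test for `phaseIntegral` without stationary point, `v > ρ² n`. -/
lemma norm_phaseIntegral_le_of_gt {s ρ n v : ℝ} (hs : 0 < s) (hn : 0 < n) (hρ : 1 ≤ ρ)
    (hv : ρ ^ 2 * n < v) : ‖phaseIntegral s ρ n v‖ ≤ 2 * s * (1 / (v - ρ ^ 2 * n)) := by
  have hab : s / ρ ≤ s := div_le_self hs.le hρ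
  have ha : 0 < s / ρ := by positivity
  have hpi := Real.pi_gt_three
  have hv0 : 0 < v := lt_of_le_of_lt (by positivity) hv
  have hpos : ∀ c ∈ Set.Icc (s / ρ) s, 0 < c := fun c hc => ha.trans_le hc.1
  have hden : ∀ c ∈ Set.Icc (s / ρ) s, 0 < v * c ^ 2 - n * s ^ 2 := fun c hc => by
    have h1 : s ^ 2 / ρ ^ 2 ≤ c ^ 2 := by rw [← div_pow]; exact pow_le_pow_left₀ ha.le hc.1 2
    have h2 : n * s ^ 2 < v * (s ^ 2 / ρ ^ 2) := by
      rw [← mul_div_assoc, lt_div_iff₀ (by positivity)]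
      nlinarith [pow_pos hs 2]
    nlinarith
  have dθ : ∀ c ∈ Set.Icc (s / ρ) s, HasDerivAt (fun c => π * (n * s ^ 2 / c + v * c))
      (π * (n * s ^ 2 * (-(c ^ 2)⁻¹) + v)) c := fun c hc => by
    refine ((((hasDerivAt_inv (hpos c hc).ne').const_mul (n * s ^ 2)).add
      ((hasDerivAt_id c).const_mul v)).const_mul π).congr_deriv ?_
    simp
  have hc2 : ∀ c ∈ Set.Icc (s / ρ) s, c ≠ 0 := fun c hc => (hpos c hc).ne'
  have hc3 : ∀ c ∈ Set.Icc (s / ρ) s, c ^ 2 ≠ 0 := fun c hc => (pow_pos (hpos c hc) 2).ne'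
  have hc4 : ∀ c ∈ Set.Icc (s / ρ) s, v * c ^ 2 - n * s ^ 2 ≠ 0 := fun c hc => (hden c hc).ne'
  have hc5 : ∀ c ∈ Set.Icc (s / ρ) s, (v * c ^ 2 - n * s ^ 2) ^ 2 ≠ 0 :=
    fun c hc => (pow_pos (hden c hc) 2).ne'
  have cθ' : ContinuousOn (fun c => π * (n * s ^ 2 * (-(c ^ 2)⁻¹) + v)) (Set.Icc (s / ρ) s) := by
    fun_prop (disch := assumption)
  have k1 := norm_integral_mul_deriv_cis_le_of_mono hab (h := fun c => c / (π * v))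
    (h' := fun _ => 1 / (π * v)) (fun c hc => (hasDerivAt_id c).div_const _) dθ
    (by fun_prop) cθ' (fun _ _ => by positivity)
  have k2 := norm_integral_mul_deriv_cis_le_of_anti hab
    (h := fun c => n * s ^ 2 / (π * v) * (c / (v * c ^ 2 - n * s ^ 2)))
    (h' := fun c => n * s ^ 2 / (π * v) * ((1 * (v * c ^ 2 - n * s ^ 2) - c * (v * (2 * c))) /
      (v * c ^ 2 - n * s ^ 2) ^ 2)) (fun c hc => by
      have d1 : HasDerivAt (fun c : ℝ => v * c ^ 2 - n * s ^ 2) (v * (2 * c)) c := by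
        simpa using ((hasDerivAt_pow 2 c).const_mul v).sub_const (n * s ^ 2)
      exact ((hasDerivAt_id c).div d1 (hden c hc).ne').const_mul _) dθ
    (by fun_prop (disch := assumption)) cθ' (fun c hc => by
      have h1 := hpos c hc
      have h2 := hden c hc
      apply mul_nonpos_of_nonneg_of_nonpos (by positivity)
      apply div_nonpos_of_nonpos_of_nonneg _ (by positivity)
      have : 0 < n * s ^ 2 := by positivity
      nlinarith)
  have e : phaseIntegral s ρ n v =
      (∫ c in (s / ρ)..s, ((c / (π * v) * (π * (n * s ^ 2 * (-(c ^ 2)⁻¹) + v)) : ℝ) : ℂ) *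
        cis (π * (n * s ^ 2 / c + v * c))) +
      ∫ c in (s / ρ)..s, ((n * s ^ 2 / (π * v) * (c / (v * c ^ 2 - n * s ^ 2)) *
        (π * (n * s ^ 2 * (-(c ^ 2)⁻¹) + v)) : ℝ) : ℂ) * cis (π * (n * s ^ 2 / c + v * c)) := by
    rw [← intervalIntegral.integral_add]
    · apply intervalIntegral.integral_congr
      intro c hc
      rw [Set.uIcc_of_le hab] at hc
      have h1 := hpos c hc
      have h2 := hden c hc
      simp only
      rw [← add_mul, ← Complex.ofReal_add]
      congr 2
      rw [show n * s ^ 2 * (-(c ^ 2)⁻¹) + v = (v * c ^ 2 - n * s ^ 2) / c ^ 2 by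
        field_simp; ring]
      obtain ⟨D, hD⟩ : ∃ D, D = v * c ^ 2 - n * s ^ 2 := ⟨_, rfl⟩
      rw [← hD] at h2 ⊢
      field_simp
      linarith
    all_goals
      apply ContinuousOn.intervalIntegrable
      rw [Set.uIcc_of_le hab]
      refine ContinuousOn.mul
        (Complex.continuous_ofReal.comp_continuousOn ?_) (continuous_cis.comp_continuousOn ?_)
      all_goals fun_prop (disch := assumption)
  rw [e]
  refine (norm_add_le _ _).trans ((add_le_add k1 k2).trans ?_)
  have p1 : 0 < n * s ^ 2 / (π * v) * (s / ρ / (v * (s / ρ) ^ 2 - n * s ^ 2)) := by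
    have := hden _ (Set.left_mem_Icc.2 hab)
    positivity
  have p2 : 0 < n * s ^ 2 / (π * v) * (s / (v * s ^ 2 - n * s ^ 2)) := by
    have := hden _ (Set.right_mem_Icc.2 hab)
    positivity
  have p3 : 0 < s / ρ / (π * v) := by positivity
  have p4 : 0 < s / (π * v) := by positivity
  rw [abs_of_pos p1, abs_of_pos p2, abs_of_pos p3, abs_of_pos p4]
  have hX : 0 < v - ρ ^ 2 * n := by linarith
  have b1 : s / (π * v) ≤ s * (1 / (v - ρ ^ 2 * n)) / 3 := by
    rw [← mul_div_assoc, mul_one, div_div]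
    gcongr s / ?_
    have : 0 < ρ ^ 2 * n := by positivity
    nlinarith
  have b2 : n * s ^ 2 / (π * v) * (s / ρ / (v * (s / ρ) ^ 2 - n * s ^ 2)) ≤
      s * (1 / (v - ρ ^ 2 * n)) / 3 := by
    have e : n * s ^ 2 / (π * v) * (s / ρ / (v * (s / ρ) ^ 2 - n * s ^ 2)) =
        (n * ρ / (π * v)) * (s * (1 / (v - ρ ^ 2 * n))) := by
      have : v * (s / ρ) ^ 2 - n * s ^ 2 = s ^ 2 / ρ ^ 2 * (v - ρ ^ 2 * n) := by
        field_simp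
      rw [this]; field_simp
    rw [e, div_eq_mul_inv _ (3 : ℝ), mul_comm]
    gcongr
    rw [div_le_iff₀ (by positivity)]
    have : n * ρ ≤ ρ ^ 2 * n := by
      nlinarith [mul_nonneg (mul_nonneg hn.le (by linarith : (0:ℝ) ≤ ρ)) (sub_nonneg.2 hρ)]
    nlinarith
  have e5 : 0 ≤ s * (1 / (v - ρ ^ 2 * n)) := by positivity
  linarith

/-- The weight of the stationary point of `phaseIntegral s ρ n v`; it is halved when the stationary
point is an endpoint of the interval. -/
noncomputable def stationaryWeight (n v : ℝ) : ℝ := (if v = n then 1 / 2 else 1) / (v * √√(n * v))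

lemma norm_phaseIntegral_sub_le {s ρ n v : ℝ} (hs : 0 < s) (hn : 1 ≤ n) (hv : n ≤ v)
    (hρ1 : 1 ≤ ρ) (hvρ : v ≤ ρ ^ 2 * n) (hρ : 2 * s * n ≤ ρ) :
    ‖phaseIntegral s ρ n v - ((s * √s * (n * stationaryWeight n v) : ℝ) : ℂ) *
      (fresnelConst * cis (2 * π * s * √(n * v)))‖ ≤
      (6 + ‖fresnelConst‖) * s * (1 / v + 1 / (v - n)) := by
  have hn0 : 0 < n := by linarith
  have hv0 : 0 < v := by linarith
  set r := √√(v / n) with hr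
  have h1 : 1 ≤ v / n := (one_le_div hn0).2 hv
  have hr1 : 1 ≤ r := by
    rw [hr, Real.one_le_sqrt, Real.one_le_sqrt]; exact h1
  have hr0 : 0 < r := by linarith
  have hr2 : r ^ 2 = √(v / n) := Real.sq_sqrt (Real.sqrt_nonneg _)
  have hr4 : r ^ 4 = v / n := by
    rw [show r ^ 4 = (r ^ 2) ^ 2 by ring, hr2, Real.sq_sqrt (by positivity)]
  have hnr4 : n * r ^ 4 = v := by rw [hr4]; field_simp
  have hnr2 : n * r ^ 2 = √(n * v) := by
    symm
    rw [Real.sqrt_eq_iff_mul_self_eq (by positivity) (by positivity), ← hnr4]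
    ring
  have key := norm_phaseIntegral_sub_le_aux (ρ := ρ) hs hn hr1 hρ1 (by
    rw [hr2, Real.sqrt_le_left (by linarith), div_le_iff₀ hn0]; exact hvρ) hρ
  rw [hnr4, hnr2] at key
  have hif : (r = 1) ↔ (v = n) := by
    constructor
    · intro h; rw [← hnr4, h]; ring
    · intro h; rw [hr, h, div_self hn0.ne']; simp
  have e : ((s ^ 2 / r ^ 4 : ℝ) : ℂ) * cis (2 * π * (√(n * v) * s)) *
      ((if r = 1 then 1 / 2 else 1) * (fresnelConst / (√(√(n * v) * s) : ℝ))) =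
      ((s * √s * (n * stationaryWeight n v) : ℝ) : ℂ) *
      (fresnelConst * cis (2 * π * s * √(n * v))) := by
    have e1 : s * √s * (n * stationaryWeight n v) =
        (s ^ 2 / r ^ 4) * (if r = 1 then 1 / 2 else 1) / √(√(n * v) * s) := by
      have h2 : 0 < √√(n * v) := by positivity
      have h3 : 0 < √s := by positivity
      have h4 : √s ^ 2 = s := Real.sq_sqrt hs.le
      simp only [stationaryWeight, hif]
      rw [hr4, Real.sqrt_mul (Real.sqrt_nonneg _)]
      generalize (if v = n then (1 / 2 : ℝ) else 1) = ω
      field_simp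
      rw [h4]
    have e2 : (((if r = 1 then 1 / 2 else 1 : ℝ)) : ℂ) = if r = 1 then 1 / 2 else 1 := by
      split_ifs <;> simp
    rw [e1]
    push_cast
    rw [e2, show 2 * π * (√(n * v) * s) = 2 * π * s * √(n * v) by ring]
    ring
  rwa [e] at key

/-- The partial sums of (minus) the Fourier series of the sawtooth function. -/
noncomputable def sawSum (K : ℕ) (u : ℝ) : ℝ :=
  ∑ k ∈ Finset.range K, sin (2 * π * (k + 1) * u) / (π * (k + 1))

/-- The remainder of the Fourier series of the sawtooth function. -/
noncomputable def sawRem (K : ℕ) (u : ℝ) : ℝ := Int.fract u - 1 / 2 + sawSum K u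

lemma continuous_sawSum (K : ℕ) : Continuous (sawSum K) := by
  unfold sawSum
  fun_prop

lemma sawSum_add_one (K : ℕ) (u : ℝ) : sawSum K (u + 1) = sawSum K u := by
  unfold sawSum
  refine Finset.sum_congr rfl fun k _ => ?_
  rw [show 2 * π * ((k : ℝ) + 1) * (u + 1) = 2 * π * (k + 1) * u + (k + 1 : ℕ) * (2 * π) by
    push_cast; ring, Real.sin_add_nat_mul_two_pi]

lemma periodic_sawRem (K : ℕ) : Function.Periodic (sawRem K) 1 := fun u => by
  simp [sawRem, sawSum_add_one, Int.fract_add_one]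

lemma measurable_sawRem (K : ℕ) : Measurable (sawRem K) :=
  (measurable_fract.sub_const _).add (continuous_sawSum K).measurable

lemma sum_range_inv_le (K : ℕ) : ∑ k ∈ Finset.range K, 1 / ((k : ℝ) + 1) ≤ 1 + log K := by
  have := harmonic_le_one_add_log K
  simp only [harmonic, Rat.cast_sum, Rat.cast_inv] at this
  simpa [one_div] using this

lemma abs_sawRem_le (K : ℕ) (u : ℝ) : |sawRem K u| ≤ 2 + log K := by
  have h1 : |Int.fract u - 1 / 2| ≤ 1 := by
    rw [abs_le]; constructor <;> linarith [Int.fract_nonneg u, Int.fract_lt_one u]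
  have h2 : |sawSum K u| ≤ 1 + log K := by
    refine (Finset.abs_sum_le_sum_abs _ _).trans (le_trans ?_ (sum_range_inv_le K))
    refine Finset.sum_le_sum fun k _ => ?_
    have : (0:ℝ) ≤ k := k.cast_nonneg
    rw [abs_div, abs_of_pos (by positivity : 0 < π * ((k:ℝ) + 1))]
    refine div_le_div₀ zero_le_one (Real.abs_sin_le_one _) (by positivity) ?_
    nlinarith [Real.pi_gt_three]
  exact (abs_add_le _ _).trans (by linarith)

lemma integral_sub_half_mul_sin (j : ℕ) :
    ∫ u in (0:ℝ)..1, (u - 1 / 2) * sin (2 * π * (j + 1) * u) = -(1 / (2 * π * (j + 1))) := by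
  set a := 2 * π * ((j : ℝ) + 1) with ha
  have ha0 : a ≠ 0 := by positivity
  have hd : ∀ u ∈ Set.uIcc (0:ℝ) 1, HasDerivAt
      (fun u => -((u - 1 / 2) * cos (a * u) / a) + sin (a * u) / a ^ 2)
      ((u - 1 / 2) * sin (a * u)) u := fun u _ => by
    have h1 : HasDerivAt (fun u : ℝ => a * u) a u := by simpa using (hasDerivAt_id u).const_mul a
    refine (((((hasDerivAt_id u).sub_const _).mul h1.cos).div_const a).neg.add
      (h1.sin.div_const _)).congr_deriv ?_
    simp only [id]
    field_simp
    ring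
  rw [intervalIntegral.integral_eq_sub_of_hasDerivAt hd
    (Continuous.intervalIntegrable (by fun_prop) _ _)]
  have hs : sin a = 0 := by
    rw [ha, show 2 * π * ((j : ℝ) + 1) = ((2 * (j + 1) : ℕ) : ℝ) * π by push_cast; ring]
    exact Real.sin_nat_mul_pi _
  have hc : cos a = 1 := by
    rw [ha, show 2 * π * ((j : ℝ) + 1) = ((j + 1 : ℕ) : ℝ) * (2 * π) by push_cast; ring]
    exact Real.cos_nat_mul_two_pi _
  simp only [mul_one, mul_zero, hs, hc, sin_zero, cos_zero]
  field_simp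
  ring

lemma integral_sin_mul_sin {j k : ℕ} (h : j ≠ k) :
    ∫ u in (0:ℝ)..1, sin (2 * π * (j + 1) * u) * sin (2 * π * (k + 1) * u) = 0 := by
  set a := 2 * π * ((j : ℝ) + 1) with ha
  set b := 2 * π * ((k : ℝ) + 1) with hb
  have hab : a - b ≠ 0 := by
    rw [ha, hb, ← mul_sub]
    refine mul_ne_zero (by positivity) ?_
    rw [add_sub_add_right_eq_sub, sub_ne_zero]
    exact_mod_cast h
  have hab' : a + b ≠ 0 := by positivity
  have hd : ∀ u ∈ Set.uIcc (0:ℝ) 1, HasDerivAt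
      (fun u => sin ((a - b) * u) / (2 * (a - b)) - sin ((a + b) * u) / (2 * (a + b)))
      (sin (a * u) * sin (b * u)) u := fun u _ => by
    have h1 : ∀ c : ℝ, HasDerivAt (fun u : ℝ => c * u) c u := fun c => by
      simpa using (hasDerivAt_id u).const_mul c
    refine (((h1 _).sin.div_const _).sub ((h1 _).sin.div_const _)).congr_deriv ?_
    rw [mul_div_mul_right _ _ hab, mul_div_mul_right _ _ hab', sub_mul, add_mul, cos_sub, cos_add]
    ring
  rw [intervalIntegral.integral_eq_sub_of_hasDerivAt hd
    (Continuous.intervalIntegrable (by fun_prop) _ _)]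
  have h1 : sin (a - b) = 0 := by
    rw [ha, hb, show 2 * π * ((j : ℝ) + 1) - 2 * π * ((k : ℝ) + 1) =
      ((2 * (j - k) : ℤ) : ℝ) * π by push_cast; ring]
    exact Real.sin_int_mul_pi _
  have h2 : sin (a + b) = 0 := by
    rw [ha, hb, show 2 * π * ((j : ℝ) + 1) + 2 * π * ((k : ℝ) + 1) =
      ((2 * (j + k + 2) : ℕ) : ℝ) * π by push_cast; ring]
    exact Real.sin_nat_mul_pi _
  simp [h1, h2]

lemma integral_sin_mul_self (j : ℕ) :
    ∫ u in (0:ℝ)..1, sin (2 * π * (j + 1) * u) * sin (2 * π * (j + 1) * u) = 1 / 2 := by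
  set a := 2 * π * ((j : ℝ) + 1) with ha
  have ha0 : a ≠ 0 := by positivity
  have hd : ∀ u ∈ Set.uIcc (0:ℝ) 1, HasDerivAt
      (fun u => u / 2 - sin (a * u) * cos (a * u) / (2 * a))
      (sin (a * u) * sin (a * u)) u := fun u _ => by
    have h1 : HasDerivAt (fun u : ℝ => a * u) a u := by simpa using (hasDerivAt_id u).const_mul a
    refine (((hasDerivAt_id u).div_const 2).sub ((h1.sin.mul h1.cos).div_const _)).congr_deriv ?_
    field_simp
    nlinarith [sin_sq_add_cos_sq (a * u)]
  rw [intervalIntegral.integral_eq_sub_of_hasDerivAt hd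
    (Continuous.intervalIntegrable (by fun_prop) _ _)]
  have hs : sin a = 0 := by
    rw [ha, show 2 * π * ((j : ℝ) + 1) = ((2 * (j + 1) : ℕ) : ℝ) * π by push_cast; ring]
    exact Real.sin_nat_mul_pi _
  simp [hs]

lemma integral_sub_half_add_sawSum_sq (K : ℕ) :
    ∫ u in (0:ℝ)..1, (u - 1 / 2 + sawSum K u) ^ 2 =
      1 / 12 - 1 / (2 * π ^ 2) * ∑ k ∈ Finset.range K, 1 / ((k : ℝ) + 1) ^ 2 := by
  induction K with
  | zero =>
    simp only [sawSum, Finset.range_zero, Finset.sum_empty, add_zero, mul_zero, sub_zero]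
    have hd : ∀ u ∈ Set.uIcc (0:ℝ) 1, HasDerivAt (fun u => (u - 1 / 2) ^ 3 / 3)
        ((u - 1 / 2) ^ 2) u := fun u _ => by
      refine ((((hasDerivAt_id u).sub_const _).pow 3).div_const 3).congr_deriv ?_
      simp only [id]
      norm_num
    rw [intervalIntegral.integral_eq_sub_of_hasDerivAt hd
      (Continuous.intervalIntegrable (by fun_prop) _ _)]
    norm_num
  | succ K ih =>
    have hc := continuous_sawSum K
    set f : ℝ → ℝ := fun u => sin (2 * π * (K + 1) * u) with hf
    have hfc : Continuous f := by fun_prop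
    have hcross : ∫ u in (0:ℝ)..1, (u - 1 / 2 + sawSum K u) * f u = -(1 / (2 * π * (K + 1))) := by
      have h0 : ∀ u, (u - 1 / 2 + sawSum K u) * f u = (u - 1 / 2) * f u +
          ∑ k ∈ Finset.range K, 1 / (π * (k + 1)) * (sin (2 * π * (k + 1) * u) * f u) := fun u => by
        rw [add_mul, sawSum, Finset.sum_mul]
        congr 1
        exact Finset.sum_congr rfl fun k _ => by ring
      simp_rw [h0]
      rw [intervalIntegral.integral_add (Continuous.intervalIntegrable (by fun_prop) _ _)
        (Continuous.intervalIntegrable (by fun_prop) _ _), integral_sub_half_mul_sin,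
        intervalIntegral.integral_finsetSum
          fun k _ => Continuous.intervalIntegrable (by fun_prop) _ _]
      rw [Finset.sum_eq_zero, add_zero]
      intro k hk
      rw [intervalIntegral.integral_const_mul, integral_sin_mul_sin (Finset.mem_range.1 hk).ne,
        mul_zero]
    have h0 : ∀ u, (u - 1 / 2 + sawSum (K + 1) u) ^ 2 = (u - 1 / 2 + sawSum K u) ^ 2 +
        (2 / (π * (K + 1)) * ((u - 1 / 2 + sawSum K u) * f u) +
        1 / (π * (K + 1)) ^ 2 * (f u * f u)) := fun u => by
      rw [sawSum, Finset.sum_range_succ, ← sawSum, hf]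
      field_simp
      ring
    simp_rw [h0]
    rw [intervalIntegral.integral_add (Continuous.intervalIntegrable (by fun_prop) _ _)
      (Continuous.intervalIntegrable (by fun_prop) _ _),
      intervalIntegral.integral_add (Continuous.intervalIntegrable (by fun_prop) _ _)
      (Continuous.intervalIntegrable (by fun_prop) _ _), intervalIntegral.integral_const_mul,
      intervalIntegral.integral_const_mul, hcross, ih, integral_sin_mul_self,
      Finset.sum_range_succ]
    field_simp
    ring

lemma sum_range_inv_sq_add_inv_ge {K : ℕ} (hK : 1 ≤ K) :
    π ^ 2 / 6 ≤ ∑ k ∈ Finset.range K, 1 / ((k : ℝ) + 1) ^ 2 + 1 / K := by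
  have hlim : Filter.Tendsto (fun N : ℕ => ∑ k ∈ Finset.range N, 1 / ((k : ℝ) + 1) ^ 2)
      Filter.atTop (nhds (π ^ 2 / 6)) := by
    have := (hasSum_nat_add_iff' 1).2 hasSum_zeta_two
    simpa using this.tendsto_sum_nat
  refine le_of_tendsto hlim (Filter.eventually_atTop.2 ⟨K, fun N hN => ?_⟩)
  have : ∑ k ∈ Finset.range N, 1 / ((k : ℝ) + 1) ^ 2 + 1 / (N : ℝ) ≤
      ∑ k ∈ Finset.range K, 1 / ((k : ℝ) + 1) ^ 2 + 1 / (K : ℝ) := by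
    induction N, hN using Nat.le_induction with
    | base => exact le_rfl
    | succ N hN ih =>
      refine le_trans ?_ ih
      rw [Finset.sum_range_succ]
      have hN0 : (1:ℝ) ≤ N := by exact_mod_cast hK.trans hN
      have : 1 / ((N : ℝ) + 1) ^ 2 + 1 / (N + 1) ≤ 1 / N := by
        rw [div_add_div _ _ (by positivity) (by positivity),
          div_le_div_iff₀ (by positivity) (by positivity)]
        nlinarith
      push_cast
      linarith
  have h2 : (0:ℝ) ≤ 1 / N := by positivity
  linarith

lemma integral_sawRem_sq_le {K : ℕ} (hK : 1 ≤ K) :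
    ∫ u in (0:ℝ)..1, sawRem K u ^ 2 ≤ 1 / K := by
  have h1 : ∫ u in (0:ℝ)..1, sawRem K u ^ 2 = ∫ u in (0:ℝ)..1, (u - 1 / 2 + sawSum K u) ^ 2 := by
    apply intervalIntegral.integral_congr_ae
    have : ∀ᵐ u : ℝ, u ≠ 1 := by simp [ae_iff]
    filter_upwards [this] with u hu hu'
    rw [Set.uIoc_of_le zero_le_one] at hu'
    rw [sawRem, Int.fract_eq_self.2 ⟨hu'.1.le, lt_of_le_of_ne hu'.2 hu⟩]
  rw [h1, integral_sub_half_add_sawSum_sq]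
  have h2 := sum_range_inv_sq_add_inv_ge hK
  have h3 : (1:ℝ) / 12 = 1 / (2 * π ^ 2) * (π ^ 2 / 6) := by field_simp; norm_num
  rw [h3, ← mul_sub]
  have h4 : (0:ℝ) ≤ 1 / K := by positivity
  calc 1 / (2 * π ^ 2) * (π ^ 2 / 6 - ∑ k ∈ Finset.range K, 1 / ((k : ℝ) + 1) ^ 2)
      ≤ 1 / (2 * π ^ 2) * (1 / (K : ℝ)) := by gcongr; linarith
    _ ≤ 1 * (1 / (K : ℝ)) := by
      gcongr
      rw [div_le_one (by positivity)]
      nlinarith [Real.pi_gt_three]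
    _ = _ := one_mul _

lemma intervalIntegrable_sawRem_sq (K : ℕ) (a b : ℝ) :
    IntervalIntegrable (fun u => sawRem K u ^ 2) volume a b := by
  refine (intervalIntegrable_const (c := (2 + log K) ^ 2)).mono_fun
    ((measurable_sawRem K).pow_const 2).aestronglyMeasurable (Filter.Eventually.of_forall fun u => ?_)
  simp only [Real.norm_eq_abs, abs_pow]
  exact pow_le_pow_left₀ (abs_nonneg _) ((abs_sawRem_le K u).trans (le_abs_self _)) 2

lemma intervalIntegrable_sawRem (K : ℕ) (a b : ℝ) :
    IntervalIntegrable (sawRem K) volume a b := by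
  refine (intervalIntegrable_const (c := (2 + log K))).mono_fun
    (measurable_sawRem K).aestronglyMeasurable (Filter.Eventually.of_forall fun u => ?_)
  exact (abs_sawRem_le K u).trans (le_abs_self _)

lemma integral_sawRem_sq_le_of_le {K : ℕ} (hK : 1 ≤ K) {a b : ℝ} (hab : a ≤ b) :
    ∫ u in a..b, sawRem K u ^ 2 ≤ (b - a + 1) * (1 / K) := by
  have hper : Function.Periodic (fun u => sawRem K u ^ 2) 1 := fun u => by
    simp only [periodic_sawRem K u]
  have h0 : ∀ u, 0 ≤ sawRem K u ^ 2 := fun u => sq_nonneg _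
  have h1 : ∫ u in a..b, sawRem K u ^ 2 ≤ ∫ u in a..(a + ⌈b - a⌉₊ • (1:ℝ)), sawRem K u ^ 2 := by
    apply intervalIntegral.integral_mono_interval le_rfl hab _
      (Filter.Eventually.of_forall h0) (intervalIntegrable_sawRem_sq K _ _)
    have := Nat.le_ceil (b - a)
    simp only [nsmul_eq_mul, mul_one]; linarith
  have h2 : ∫ u in a..(a + ⌈b - a⌉₊ • (1:ℝ)), sawRem K u ^ 2 =
      ⌈b - a⌉₊ * ∫ u in (0:ℝ)..1, sawRem K u ^ 2 := by
    have := hper.intervalIntegral_add_zsmul_eq ⌈b - a⌉₊ a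
    rw [natCast_zsmul, hper.intervalIntegral_add_eq a 0, zero_add] at this
    rw [this (intervalIntegrable_sawRem_sq K), natCast_zsmul, nsmul_eq_mul]
  rw [h2] at h1
  refine h1.trans ?_
  have h3 := (Nat.ceil_lt_add_one (sub_nonneg.2 hab)).le
  have h4 := integral_sawRem_sq_le hK
  have h5 : 0 ≤ ∫ u in (0:ℝ)..1, sawRem K u ^ 2 :=
    intervalIntegral.integral_nonneg zero_le_one fun u _ => h0 u
  gcongr

lemma integral_abs_sawRem_le {M : ℕ} (hM : 1 ≤ M) {a b : ℝ} (hab : a ≤ b) :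
    ∫ u in a..b, |sawRem (M ^ 2) u| ≤ (b - a + 1) / M := by
  have hM0 : (1:ℝ) ≤ M := by exact_mod_cast hM
  have h1 : ∫ u in a..b, |sawRem (M ^ 2) u| ≤
      ∫ u in a..b, (1 / (2 * M) + M / 2 * sawRem (M ^ 2) u ^ 2) := by
    apply intervalIntegral.integral_mono_on hab (intervalIntegrable_sawRem _ _ _).abs
      (intervalIntegrable_const.add ((intervalIntegrable_sawRem_sq _ _ _).const_mul _))
    intro u _
    have h : 0 ≤ M / 2 * (|sawRem (M ^ 2) u| - 1 / M) ^ 2 := by positivity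
    have e : M / 2 * (|sawRem (M ^ 2) u| - 1 / M) ^ 2 =
      M / 2 * sawRem (M ^ 2) u ^ 2 - |sawRem (M ^ 2) u| + 1 / (2 * M) := by
      rw [sub_sq, sq_abs]; field_simp
    linarith
  refine h1.trans ?_
  rw [intervalIntegral.integral_add intervalIntegrable_const
    ((intervalIntegrable_sawRem_sq _ _ _).const_mul _), intervalIntegral.integral_const,
    intervalIntegral.integral_const_mul]
  have h2 := integral_sawRem_sq_le_of_le (K := M ^ 2) (Nat.one_le_pow _ _ hM) hab
  push_cast at h2
  calc (b - a) • (1 / (2 * (M:ℝ))) + M / 2 * ∫ u in a..b, sawRem (M ^ 2) u ^ 2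
      ≤ (b - a + 1) * (1 / (2 * (M:ℝ))) + M / 2 * ((b - a + 1) * (1 / (M:ℝ) ^ 2)) := by
        rw [smul_eq_mul]; gcongr; linarith
    _ = _ := by field_simp; ring

lemma hasDerivAt_sawSum (K : ℕ) (u : ℝ) :
    HasDerivAt (sawSum K) (∑ k ∈ Finset.range K, 2 * cos (2 * π * (k + 1) * u)) u := by
  unfold sawSum
  refine HasDerivAt.fun_sum fun k _ => ?_
  have h1 : HasDerivAt (fun u : ℝ => 2 * π * (k + 1) * u) (2 * π * (k + 1)) u := by
    simpa using (hasDerivAt_id u).const_mul (2 * π * ((k : ℝ) + 1))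
  refine (h1.sin.div_const _).congr_deriv ?_
  field_simp

/-- The truncated Poisson summation formula. -/
lemma norm_sum_sub_integral_dirichlet_le {M : ℕ} (hM : 1 ≤ M) {a b B : ℝ} (ha : 0 ≤ a)
    (hab : a ≤ b) {F F' : ℝ → ℂ} (hF : ∀ c ∈ Set.Icc a b, HasDerivAt F (F' c) c)
    (hF' : ContinuousOn F' (Set.Icc a b)) (hB : ∀ c ∈ Set.Icc a b, ‖F' c‖ ≤ B) :
    ‖∑ k ∈ Finset.Ioc ⌊a⌋₊ ⌊b⌋₊, F k - ∫ c in a..b, F c *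
      ((1 + ∑ k ∈ Finset.range (M ^ 2), 2 * cos (2 * π * (k + 1) * c) : ℝ) : ℂ)‖ ≤
      (‖F a‖ + ‖F b‖) * (2 + log (M ^ 2 : ℕ)) + B * ((b - a + 1) / M) := by
  set K := M ^ 2 with hK
  have hud : Set.uIcc a b = Set.Icc a b := Set.uIcc_of_le hab
  have hfloor : ∀ t : ℝ, 0 ≤ t → (∑ k ∈ Finset.Icc 0 ⌊t⌋₊, (1:ℂ)) =
      ((t + 1 / 2 + sawSum K t : ℝ) : ℂ) - (sawRem K t : ℂ) := fun t ht => by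
    rw [sawRem, Finset.sum_const, Nat.card_Icc, ← Complex.ofReal_sub]
    have : ((⌊t⌋₊ : ℕ) : ℝ) = t - Int.fract t := by
      rw [natCast_floor_eq_intCast_floor ht, Int.self_sub_fract]
    have h2 : t + 1 / 2 + sawSum K t - (Int.fract t - 1 / 2 + sawSum K t) = ((⌊t⌋₊ + 1 : ℕ) : ℝ) := by
      push_cast; rw [this]; ring
    rw [h2]; simp
  have hInt : IntegrableOn (deriv F) (Set.Icc a b) :=
    (hF'.congr fun c hc => (hF c hc).deriv).integrableOn_Icc
  have habel := sum_mul_eq_sub_sub_integral_mul (f := F) (fun _ => (1:ℂ)) ha hab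
    (fun t ht => (hF t ht).differentiableAt) hInt
  simp only [mul_one] at habel
  rw [hfloor a ha, hfloor b (ha.trans hab), ← intervalIntegral.integral_of_le hab] at habel
  set g : ℝ → ℂ := fun t => ((t + 1 / 2 + sawSum K t : ℝ) : ℂ) with hg
  set g' : ℝ → ℂ := fun t =>
    ((1 + ∑ k ∈ Finset.range K, 2 * cos (2 * π * (k + 1) * t) : ℝ) : ℂ) with hg'
  have hgd : ∀ c, HasDerivAt g (g' c) c := fun c =>
    (((hasDerivAt_id c).add_const _).add (hasDerivAt_sawSum K c)).ofReal_comp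
  have hgc' : Continuous g' := by fun_prop
  have hgc : Continuous g := continuous_iff_continuousAt.2 fun c => (hgd c).continuousAt
  have hFi : IntervalIntegrable F' volume a b :=
    ContinuousOn.intervalIntegrable (by rwa [hud])
  have hsi : IntervalIntegrable (fun t => (sawRem K t : ℂ)) volume a b :=
    ⟨(intervalIntegrable_sawRem K a b).1.ofReal, (intervalIntegrable_sawRem K a b).2.ofReal⟩
  have hpsi : IntervalIntegrable (fun t => F' t * (sawRem K t : ℂ)) volume a b :=
    hsi.continuousOn_mul (by rwa [hud])
  have e1 : ∫ t in a..b, deriv F t * ∑ k ∈ Finset.Icc 0 ⌊t⌋₊, (1:ℂ) =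
      (∫ t in a..b, F' t * g t) - ∫ t in a..b, F' t * (sawRem K t : ℂ) := by
    rw [← intervalIntegral.integral_sub (hFi.mul_continuousOn hgc.continuousOn) hpsi]
    apply intervalIntegral.integral_congr
    intro t ht
    rw [hud] at ht
    simp only
    rw [hfloor t (ha.trans ht.1), (hF t ht).deriv]
    ring
  have e2 : ∫ t in a..b, F' t * g t = F b * g b - F a * g a - ∫ t in a..b, F t * g' t := by
    have := intervalIntegral.integral_mul_deriv_eq_deriv_mul (u := F) (v := g) (u' := F')
      (v' := g') (by rwa [hud]) (fun x _ => hgd x) hFi (hgc'.intervalIntegrable _ _)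
    rw [this]; ring
  rw [e1, e2] at habel
  have e3 : ∑ k ∈ Finset.Ioc ⌊a⌋₊ ⌊b⌋₊, F k - ∫ c in a..b, F c * g' c =
      F a * (sawRem K a : ℂ) - F b * (sawRem K b : ℂ) + ∫ t in a..b, F' t * (sawRem K t : ℂ) := by
    rw [habel]; ring
  rw [e3]
  have hB0 : 0 ≤ B := (norm_nonneg _).trans (hB a (Set.left_mem_Icc.2 hab))
  have b1 : ∀ x, ‖F x * (sawRem K x : ℂ)‖ ≤ ‖F x‖ * (2 + log (K : ℕ)) := fun x => by
    rw [norm_mul, Complex.norm_real]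
    gcongr
    exact abs_sawRem_le K x
  have b2 : ‖∫ t in a..b, F' t * (sawRem K t : ℂ)‖ ≤ B * ((b - a + 1) / M) := by
    have h1 : ‖∫ t in a..b, F' t * (sawRem K t : ℂ)‖ ≤ ∫ t in a..b, B * |sawRem K t| := by
      refine intervalIntegral.norm_integral_le_of_norm_le hab
        (Filter.Eventually.of_forall fun t ht => ?_) ((intervalIntegrable_sawRem K a b).abs.const_mul _)
      rw [norm_mul, Complex.norm_real, Real.norm_eq_abs]
      gcongr
      exact hB t (Set.Ioc_subset_Icc_self ht)
    rw [intervalIntegral.integral_const_mul] at h1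
    exact h1.trans (by gcongr; exact integral_abs_sawRem_le hM hab)
  calc _ ≤ ‖F a * (sawRem K a : ℂ)‖ + ‖F b * (sawRem K b : ℂ)‖ + _ :=
        (norm_add_le _ _).trans (add_le_add (norm_sub_le _ _) b2)
    _ ≤ _ := by linarith [b1 a, b1 b]

lemma sum_Icc_neg_eq {E : Type*} [AddCommMonoid E] (f : ℤ → E) (K : ℕ) :
    ∑ k ∈ Finset.Icc (-(K : ℤ)) K, f k =
      f 0 + ∑ k ∈ Finset.range K, (f (k + 1) + f (-(k + 1))) := by
  induction K with
  | zero => simp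
  | succ K ih =>
    have h : Finset.Icc (-((K + 1 : ℕ) : ℤ)) ((K + 1 : ℕ) : ℤ) =
        insert ((K : ℤ) + 1) (insert (-((K : ℤ) + 1)) (Finset.Icc (-(K : ℤ)) K)) := by
      ext x
      simp only [Finset.mem_Icc, Finset.mem_insert]
      push_cast
      omega
    rw [h, Finset.sum_insert, Finset.sum_insert, ih, Finset.sum_range_succ]
    · abel
    · simp
    · simp only [Finset.mem_Icc, Finset.mem_insert]; omega

lemma norm_sum_sub_sum_phaseIntegral_le {M n : ℕ} (hM : 1 ≤ M) {s ρ : ℝ} (hs : 0 < s)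
    (hρ : 1 ≤ ρ) (hsρ : s < ρ) :
    ‖∑ c ∈ Finset.Icc 1 ⌊s⌋₊, (c : ℂ) * cis (π * (n * s ^ 2 / c - n * c)) -
      ∑ k ∈ Finset.Icc (-((M ^ 2 : ℕ) : ℤ)) (M ^ 2 : ℕ), phaseIntegral s ρ n (2 * k - n)‖ ≤
      2 * s * (2 + log (M ^ 2 : ℕ)) + (1 + π * n * (s * ρ + s)) * ((s + 1) / M) := by
  have hab : s / ρ ≤ s := div_le_self hs.le hρ
  have ha : 0 < s / ρ := by positivity
  have hpos : ∀ c ∈ Set.Icc (s / ρ) s, 0 < c := fun c hc => ha.trans_le hc.1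
  have hne : ∀ c ∈ Set.Icc (s / ρ) s, c ≠ 0 := fun c hc => (hpos c hc).ne'
  have hne2 : ∀ c ∈ Set.Icc (s / ρ) s, c ^ 2 ≠ 0 := fun c hc => pow_ne_zero 2 (hne c hc)
  set θ : ℝ → ℝ := fun c => π * (n * s ^ 2 / c - n * c) with hθ
  set θ' : ℝ → ℝ := fun c => π * (-(n * s ^ 2) / c ^ 2 - n) with hθ'
  have hθd : ∀ c ∈ Set.Icc (s / ρ) s, HasDerivAt θ (θ' c) c := fun c hc => by
    have h1 : HasDerivAt (fun c : ℝ => n * s ^ 2 / c) (-(n * s ^ 2) / c ^ 2) c := by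
      exact ((hasDerivAt_const c ((n:ℝ) * s ^ 2)).fun_div (hasDerivAt_id c) (hne c hc)).congr_deriv
        (by simp)
    have h2 : HasDerivAt (fun c : ℝ => (n:ℝ) * c) n c := by
      simpa using (hasDerivAt_id c).const_mul (n:ℝ)
    exact (h1.sub h2).const_mul π
  set F : ℝ → ℂ := fun c => (c : ℂ) * cis (θ c) with hF
  set F' : ℝ → ℂ := fun c => cis (θ c) + c * (cis (θ c) * (θ' c * Complex.I)) with hF'
  have hFd : ∀ c ∈ Set.Icc (s / ρ) s, HasDerivAt F (F' c) c := fun c hc => by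
    refine ((hasDerivAt_id c).ofReal_comp.mul (hθd c hc).cis).congr_deriv ?_
    simp [hF']
    try ring
  have hθc : ContinuousOn θ (Set.Icc (s / ρ) s) := by
    rw [hθ]; fun_prop (disch := assumption)
  have hθc' : ContinuousOn θ' (Set.Icc (s / ρ) s) := by
    rw [hθ']; fun_prop (disch := assumption)
  have hFc : ContinuousOn F (Set.Icc (s / ρ) s) :=
    fun c hc => (hFd c hc).continuousAt.continuousWithinAt
  have hcis : ContinuousOn (fun c => cis (θ c)) (Set.Icc (s / ρ) s) :=
    continuous_cis.comp_continuousOn hθc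
  have hFc' : ContinuousOn F' (Set.Icc (s / ρ) s) :=
    hcis.add (Complex.continuous_ofReal.continuousOn.mul (hcis.mul
      ((Complex.continuous_ofReal.comp_continuousOn hθc').mul continuousOn_const)))
  have hB : ∀ c ∈ Set.Icc (s / ρ) s, ‖F' c‖ ≤ 1 + π * n * (s * ρ + s) := fun c hc => by
    have h0 := hpos c hc
    refine (norm_add_le _ _).trans ?_
    rw [norm_cis, norm_mul, norm_mul, norm_mul, norm_cis, Complex.norm_I, Complex.norm_real,
      Complex.norm_real, Real.norm_of_nonneg h0.le, Real.norm_eq_abs]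
    have e : θ' c = -(π * (n * s ^ 2 / c ^ 2 + n)) := by rw [hθ']; ring
    rw [e, abs_neg, abs_of_nonneg (by positivity)]
    have e2 : c * (1 * (π * (n * s ^ 2 / c ^ 2 + n) * 1)) = π * n * (s * (s / c) + c) := by
      field_simp
    rw [e2]
    gcongr
    · rw [div_le_iff₀ h0]
      have := hc.1
      rw [div_le_iff₀ (by linarith)] at this
      linarith
    · exact hc.2
  have key := norm_sum_sub_integral_dirichlet_le hM ha.le hab hFd hFc' hB
  have hfl : ⌊s / ρ⌋₊ = 0 := by
    rw [Nat.floor_eq_zero, div_lt_one (by linarith)]; exact hsρ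
  have hIoc : Finset.Ioc 0 ⌊s⌋₊ = Finset.Icc 1 ⌊s⌋₊ := by ext; simp [Nat.succ_le_iff]
  have hInt : ∀ v : ℝ, IntervalIntegrable
      (fun c : ℝ => (c : ℂ) * cis (π * (n * s ^ 2 / c + v * c))) volume (s / ρ) s := fun v => by
    apply ContinuousOn.intervalIntegrable
    rw [Set.uIcc_of_le hab]
    refine ContinuousOn.mul Complex.continuous_ofReal.continuousOn
      (continuous_cis.comp_continuousOn ?_)
    fun_prop (disch := assumption)
  have e : ∫ c in (s / ρ)..s, F c *
      ((1 + ∑ k ∈ Finset.range (M ^ 2), 2 * cos (2 * π * (k + 1) * c) : ℝ) : ℂ) =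
      ∑ k ∈ Finset.Icc (-((M ^ 2 : ℕ) : ℤ)) (M ^ 2 : ℕ), phaseIntegral s ρ n (2 * k - n) := by
    simp only [phaseIntegral]
    rw [← intervalIntegral.integral_finsetSum fun _ _ => hInt _]
    apply intervalIntegral.integral_congr
    intro c _
    simp only
    rw [sum_Icc_neg_eq]
    push_cast
    rw [mul_add, Finset.mul_sum]
    congr 1
    · simp [hF, hθ, sub_eq_add_neg]
    · refine Finset.sum_congr rfl fun k _ => ?_
      have h2 : (2 * Complex.cos (2 * π * (k + 1) * c) : ℂ) =
          cis (2 * π * (k + 1) * c) + cis (-(2 * π * (k + 1) * c)) := by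
        rw [Complex.cos, cis, cis]
        push_cast
        ring_nf
      rw [h2, hF]
      simp only
      rw [mul_assoc, mul_add, ← cis_add, ← cis_add, mul_add]
      congr 3 <;> (rw [hθ]; ring)
  rw [e, hfl, hIoc] at key
  refine key.trans ?_
  rw [hF]
  simp only [norm_mul, norm_cis, mul_one, Complex.norm_real]
  rw [Real.norm_of_nonneg ha.le, Real.norm_of_nonneg hs.le]
  have hlog : 0 ≤ log (M ^ 2 : ℕ) := Real.log_natCast_nonneg _
  have h3 : s - s / ρ + 1 ≤ s + 1 := by linarith
  have h4 : s / ρ + s ≤ 2 * s := by linarith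
  gcongr

lemma sum_inv_abs_le {S : Finset ℤ} {B : ℕ} (j : ℤ)
    (hS : ∀ k ∈ S, |2 * k - j| ≤ B) :
    ∑ k ∈ S, 1 / |(2 * k - j : ℝ)| ≤ 2 * (1 + log B) := by
  have h1 : ∑ k ∈ S, 1 / |(2 * k - j : ℝ)| = ∑ x ∈ S.image (fun k => 2 * k - j), 1 / |(x : ℝ)| := by
    rw [Finset.sum_image (by intro a _ b _ h; simp only at h; omega)]
    exact Finset.sum_congr rfl fun k _ => by push_cast; rfl
  rw [h1]
  have h2 : S.image (fun k => 2 * k - j) ⊆ Finset.Icc (-(B : ℤ)) B := by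
    intro x hx
    obtain ⟨k, hk, rfl⟩ := Finset.mem_image.1 hx
    exact Finset.mem_Icc.2 (abs_le.1 (hS k hk))
  refine (Finset.sum_le_sum_of_subset_of_nonneg h2 fun _ _ _ => by positivity).trans ?_
  rw [sum_Icc_neg_eq (fun x : ℤ => 1 / |(x : ℝ)|)]
  have h3 : ∀ k : ℕ, (1 / |(((k : ℤ) + 1 : ℤ) : ℝ)| + 1 / |((-((k : ℤ) + 1) : ℤ) : ℝ)|) =
      2 * (1 / ((k : ℝ) + 1)) := fun k => by
    push_cast
    rw [abs_neg, abs_of_pos (by positivity)]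
    ring
  simp only [h3, ← Finset.mul_sum]
  have := sum_range_inv_le B
  simp
  simpa using this

/-- The second components of the stationary pairs with given first component `n`. -/
def stationarySet (L n : ℕ) : Finset ℕ :=
  (Finset.Icc n (4 * L ^ 4 * n)).filter fun v => v % 2 = n % 2

lemma norm_sum_sub_stationary_le {L n : ℕ} (hL : 2 ≤ L) (hn : 1 ≤ n) (hnL : n ≤ L) {s : ℝ}
    (hs : 0 < s) (hsL : s ≤ L) :
    ‖∑ c ∈ Finset.Icc 1 ⌊s⌋₊, (c : ℂ) * cis (π * (n * s ^ 2 / c - n * c)) -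
      ∑ v ∈ stationarySet L n, ((s * √s * (n * stationaryWeight n v) : ℝ) : ℂ) *
      (fresnelConst * cis (2 * π * s * √(n * v)))‖ ≤
      (29 + 60 * (6 + ‖fresnelConst‖)) * (s + 1) * (1 + log L) := by
  have hL2 : (2:ℝ) ≤ L := by exact_mod_cast hL
  have hL0 : (0:ℝ) < L := by linarith
  have hn1 : (1:ℝ) ≤ n := by exact_mod_cast hn
  have hnL' : (n:ℝ) ≤ L := by exact_mod_cast hnL
  have hlogL : 0 ≤ log L := Real.log_natCast_nonneg _
  set ρ : ℝ := 2 * (L:ℝ) ^ 2 with hρ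
  have hρ1 : 1 ≤ ρ := by nlinarith
  have hsρ : s < ρ := by nlinarith
  have hsn : 2 * s * n ≤ ρ := by
    rw [hρ, sq, mul_assoc]; gcongr
  have hρ2 : ρ ^ 2 = 4 * (L:ℝ) ^ 4 := by rw [hρ]; ring
  have hp := norm_sum_sub_sum_phaseIntegral_le (M := L ^ 4) (n := n)
    (Nat.one_le_pow _ _ (by omega)) hs hρ1 hsρ
  set K : ℕ := (L ^ 4) ^ 2 with hK
  set κ := fresnelConst
  set E : ℕ → ℂ := fun v => ((s * √s * (n * stationaryWeight n v) : ℝ) : ℂ) *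
    (κ * cis (2 * π * s * √(n * v))) with hE
  have hL3 : 5 * L ^ 5 ≤ 2 * L ^ 8 := by
    have : 5 ≤ 2 * L ^ 3 := by
      have := Nat.pow_le_pow_left hL 3; omega
    calc 5 * L ^ 5 ≤ (2 * L ^ 3) * L ^ 5 := by gcongr
      _ = _ := by ring
  have hnv : n + 4 * L ^ 4 * n ≤ 5 * L ^ 5 := by
    calc n + 4 * L ^ 4 * n ≤ L ^ 4 * L + 4 * L ^ 4 * L := by
          gcongr
          calc n ≤ 1 * L := by omega
            _ ≤ L ^ 4 * L := by gcongr; exact Nat.one_le_pow _ _ (by omega)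
      _ = _ := by ring
  have hK8 : K = L ^ 8 := by rw [hK]; ring
  have hsum : ∑ v ∈ stationarySet L n, E v =
      ∑ k ∈ Finset.Icc (-(K : ℤ)) K, if (n : ℤ) ≤ 2 * k - n ∧ 2 * k - n ≤ 4 * L ^ 4 * n then
        E (2 * k - n).toNat else 0 := by
    rw [← Finset.sum_filter]
    refine Finset.sum_bij' (fun v _ => ((v : ℤ) + n) / 2) (fun k _ => (2 * k - n).toNat) ?_ ?_ ?_ ?_ ?_
    · intro v hv
      simp only [stationarySet, Finset.mem_filter, Finset.mem_Icc] at hv ⊢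
      zify at hv hnv hL3 hK8
      omega
    · intro k hk
      simp only [stationarySet, Finset.mem_filter, Finset.mem_Icc] at hk ⊢
      zify at hnv hL3 hK8 ⊢
      refine ⟨⟨?_, ?_⟩, ?_⟩ <;> omega
    · intro v hv
      simp only [stationarySet, Finset.mem_filter, Finset.mem_Icc] at hv
      omega
    · intro k hk
      simp only [Finset.mem_filter, Finset.mem_Icc] at hk
      omega
    · intro v hv
      simp only [stationarySet, Finset.mem_filter, Finset.mem_Icc] at hv
      congr 1
      omega
  have hterm : ∀ k ∈ Finset.Icc (-(K : ℤ)) K, ‖phaseIntegral s ρ n (2 * k - n) -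
      (if (n : ℤ) ≤ 2 * k - n ∧ 2 * k - n ≤ 4 * L ^ 4 * n then E (2 * k - n).toNat else 0)‖ ≤
      (6 + ‖κ‖) * s * (1 / |(2 * k - (n : ℤ) : ℝ)| + 1 / |(2 * k - (2 * n : ℤ) : ℝ)| +
        1 / |(2 * k - (n + 4 * L ^ 4 * n : ℤ) : ℝ)|) := by
    intro k _
    have hC : 2 ≤ 6 + ‖κ‖ := by linarith [norm_nonneg κ]
    have hC' : 0 ≤ (6 + ‖κ‖) * s := by positivity
    push_cast
    have i1 : 0 ≤ 1 / |(2 * k - n : ℝ)| := by positivity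
    have i2 : 0 ≤ 1 / |(2 * k - 2 * n : ℝ)| := by positivity
    have i3 : 0 ≤ 1 / |(2 * k - (n + 4 * L ^ 4 * n) : ℝ)| := by positivity
    by_cases h1 : (n : ℤ) ≤ 2 * k - n
    · have h1' : (n : ℝ) ≤ 2 * k - n := by exact_mod_cast h1
      by_cases h2 : 2 * k - n ≤ (4 * L ^ 4 * n : ℤ)
      · have h2' : (2 * k - n : ℝ) ≤ 4 * L ^ 4 * n := by exact_mod_cast h2
        rw [if_pos ⟨h1, h2⟩, hE]
        have hc : (((2 * k - n : ℤ).toNat : ℕ) : ℝ) = 2 * k - n := by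
          have : (((2 * k - n : ℤ).toNat : ℕ) : ℤ) = 2 * k - n := Int.toNat_of_nonneg (by omega)
          exact_mod_cast this
        simp only [hc]
        refine (norm_phaseIntegral_sub_le hs hn1 h1' hρ1 (by rw [hρ2]; exact h2') hsn).trans ?_
        apply mul_le_mul_of_nonneg_left _ hC'
        rw [abs_of_pos (by linarith : (0:ℝ) < 2 * k - n),
          abs_of_nonneg (by linarith : (0:ℝ) ≤ 2 * k - 2 * n),
          show (2 * k - n - n : ℝ) = 2 * k - 2 * n by ring]
        linarith
      · have h2' : (4 * L ^ 4 * n : ℝ) < 2 * k - n := by exact_mod_cast not_le.1 h2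
        rw [if_neg (fun h => h2 h.2), sub_zero]
        refine (norm_phaseIntegral_le_of_gt hs (by linarith) hρ1 (by rw [hρ2]; exact h2')).trans ?_
        rw [hρ2]
        rw [abs_of_pos (by linarith : (0:ℝ) < 2 * k - (n + 4 * L ^ 4 * n)),
          show (2 * k - (n + 4 * L ^ 4 * n) : ℝ) = 2 * k - n - 4 * L ^ 4 * n by ring] at i3 ⊢
        calc 2 * s * (1 / (2 * k - n - 4 * L ^ 4 * n : ℝ)) ≤
              (6 + ‖κ‖) * s * (1 / (2 * k - n - 4 * L ^ 4 * n : ℝ)) := by gcongr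
          _ ≤ _ := by gcongr; linarith
    · have h1' : (2 * k - n : ℝ) < n := by exact_mod_cast not_le.1 h1
      rw [if_neg (fun h => h1 h.1), sub_zero]
      refine (norm_phaseIntegral_le_of_lt hs (by linarith) hρ1 h1').trans ?_
      rw [abs_of_neg (by linarith : (2 * k - 2 * n : ℝ) < 0),
        show (-(2 * k - 2 * n) : ℝ) = n - (2 * k - n) by ring] at i2 ⊢
      calc s * (1 / (n - (2 * k - n) : ℝ)) = 1 * s * (1 / (n - (2 * k - n) : ℝ)) := by ring
        _ ≤ (6 + ‖κ‖) * s * (1 / (n - (2 * k - n) : ℝ)) := by gcongr; linarith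
        _ ≤ _ := by gcongr; linarith
  have hB : ∀ j : ℤ, 0 ≤ j → j ≤ 5 * L ^ 5 → ∑ k ∈ Finset.Icc (-(K : ℤ)) K,
      1 / |(2 * k - j : ℝ)| ≤ 20 * (1 + log L) := fun j hj0 hj => by
    have h := sum_inv_abs_le (S := Finset.Icc (-(K : ℤ)) K) (B := L ^ 10) j (fun k hk => by
      rw [Finset.mem_Icc] at hk
      have h4 : 4 * L ^ 8 ≤ L ^ 10 := by
        calc 4 * L ^ 8 ≤ (L ^ 2) * L ^ 8 := by gcongr; nlinarith
          _ = _ := by ring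
      zify at hL3 h4 hK8
      rw [abs_le]
      push_cast
      constructor <;> omega)
    push_cast [Real.log_pow] at h
    refine h.trans ?_
    linarith
  have hdiff : ‖∑ k ∈ Finset.Icc (-(K : ℤ)) K, phaseIntegral s ρ n (2 * k - n) -
      ∑ v ∈ stationarySet L n, E v‖ ≤ (6 + ‖κ‖) * s * (60 * (1 + log L)) := by
    rw [hsum, ← Finset.sum_sub_distrib]
    refine (norm_sum_le_of_le _ hterm).trans ?_
    rw [← Finset.mul_sum, Finset.sum_add_distrib, Finset.sum_add_distrib]
    zify at hnv hL3
    have hnn : (0:ℤ) ≤ 4 * L ^ 4 * n := by positivity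
    have t1 := hB n (by positivity) (by linarith)
    have t2 := hB (2 * n) (by positivity) (by
      have : (n : ℤ) ≤ 4 * L ^ 4 * n := by
        have h1 : (1:ℤ) ≤ L ^ 4 := by exact_mod_cast Nat.one_le_pow _ _ (by omega)
        nlinarith
      linarith)
    have t3 := hB (n + 4 * L ^ 4 * n) (by positivity) (by linarith)
    apply mul_le_mul_of_nonneg_left _ (by positivity)
    linarith
  have hlogK : log (K : ℕ) = 8 * log L := by rw [hK8]; push_cast; rw [Real.log_pow]; norm_num
  have hM : (1 + π * n * (s * ρ + s)) * ((s + 1) / (L ^ 4 : ℕ)) ≤ 13 * (s + 1) := by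
    push_cast
    rw [mul_div_assoc', div_le_iff₀ (by positivity)]
    have hp4 := Real.pi_le_four
    have a1 : s * ρ + s ≤ 2 * (L:ℝ) ^ 3 + L := by rw [hρ]; nlinarith [sq_nonneg (L:ℝ)]
    have a2 : π * n * (s * ρ + s) ≤ 4 * L * (2 * (L:ℝ) ^ 3 + L) := by gcongr
    have a3 : 1 + 4 * L * (2 * (L:ℝ) ^ 3 + L) ≤ 13 * (L:ℝ) ^ 4 := by
      have : 4 ≤ (L:ℝ) ^ 2 := by nlinarith
      nlinarith
    nlinarith
  rw [hlogK] at hp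
  calc _ ≤ _ + _ := norm_sub_le_norm_sub_add_norm_sub _ (∑ k ∈ Finset.Icc (-(K : ℤ)) K,
        phaseIntegral s ρ n (2 * k - n)) _
    _ ≤ (2 * s * (2 + 8 * log L) + 13 * (s + 1)) + (6 + ‖κ‖) * s * (60 * (1 + log L)) :=
        add_le_add (hp.trans (by linarith)) hdiff
    _ ≤ _ := by
      have := norm_nonneg κ
      have h1 : 0 ≤ s * log L := by positivity
      nlinarith [mul_nonneg this hlogL, mul_nonneg (norm_nonneg κ) h1]

lemma sum_range_add_one_eq {E : Type*} [AddCommMonoid E] (f : ℕ → E) (N : ℕ) :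
    ∑ k ∈ Finset.range N, f (k + 1) = ∑ n ∈ Finset.Icc 1 N, f n := by
  induction N with
  | zero => simp
  | succ N ih => rw [Finset.sum_range_succ, ih, Finset.sum_Icc_succ_top (by omega)]

lemma sum_Icc_inv_le (N : ℕ) : ∑ n ∈ Finset.Icc 1 N, 1 / (n : ℝ) ≤ 1 + log N := by
  rw [← sum_range_add_one_eq (fun n : ℕ => 1 / (n : ℝ))]
  simpa using sum_range_inv_le N

/-- The sum over `c ≤ s` of the truncated sawtooth Fourier series. -/
noncomputable def truncSum (L : ℕ) (s : ℝ) : ℝ :=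
  -∑ c ∈ Finset.Icc 1 ⌊s⌋₊, (c : ℝ) * sawSum L ((s ^ 2 / c - c + 1) / 2)

/-- The coefficient of the frequency `√m` restricted to stationary pairs of level `L`. -/
noncomputable def levelCoeff (L m : ℕ) : ℝ :=
  ∑ p ∈ m.divisorsAntidiagonal,
    if (p.1 ≤ L ∧ p.2 ≤ 4 * L ^ 4 * p.1) ∧ p.1 ≤ p.2 ∧ p.2 % 2 = p.1 % 2 then
      (-1) ^ p.1 * stationaryWeight p.1 p.2 else 0

/-- The trigonometric polynomial approximating the remainder term, up to scaling. -/
noncomputable def trigPoly (N : ℕ) (b : ℕ → ℝ) (s : ℝ) : ℝ :=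
  ∑ m ∈ Finset.Icc 1 N, b m * (fresnelConst * cis (2 * π * s * √m)).im

lemma sum_stationary_eq {L : ℕ} (g : ℕ → ℝ) :
    ∑ n ∈ Finset.Icc 1 L, ∑ v ∈ stationarySet L n,
      ((-1) ^ n * stationaryWeight n v) * g (n * v) =
      ∑ m ∈ Finset.Icc 1 (4 * L ^ 6), levelCoeff L m * g m := by
  simp only [levelCoeff, Finset.sum_mul, ite_mul, zero_mul]
  simp only [← Finset.sum_filter]
  rw [Finset.sum_sigma', Finset.sum_sigma']
  refine Finset.sum_bij' (fun p _ => ⟨p.1 * p.2, (p.1, p.2)⟩) (fun q _ => ⟨q.2.1, q.2.2⟩) ?_ ?_ ?_ ?_ ?_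
  · rintro ⟨n, v⟩ h
    simp only [stationarySet, Finset.mem_sigma, Finset.mem_Icc, Finset.mem_filter,
      Nat.mem_divisorsAntidiagonal, ne_eq, mul_eq_zero, true_and] at h ⊢
    have hv : 1 ≤ v := h.1.1.trans h.2.1.1
    refine ⟨⟨Nat.one_le_iff_ne_zero.2 (Nat.mul_ne_zero (by omega) (by omega)), ?_⟩, by omega,
      ⟨h.1.2, h.2.1.2⟩, h.2.1.1, h.2.2⟩
    calc n * v ≤ L * (4 * L ^ 4 * L) := by
          gcongr
          · exact h.1.2
          · exact h.2.1.2.trans (by gcongr; exact h.1.2)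
      _ = _ := by ring
  · rintro ⟨m, n, v⟩ h
    simp only [stationarySet, Finset.mem_sigma, Finset.mem_Icc, Finset.mem_filter,
      Nat.mem_divisorsAntidiagonal] at h ⊢
    refine ⟨⟨?_, h.2.2.1.1⟩, ⟨h.2.2.2.1, h.2.2.1.2⟩, h.2.2.2.2⟩
    rcases Nat.eq_zero_or_pos n with h0 | h0
    · subst h0; omega
    · exact h0
  · rintro ⟨n, v⟩ _; rfl
  · rintro ⟨m, n, v⟩ h
    simp only [Finset.mem_sigma, Finset.mem_filter, Nat.mem_divisorsAntidiagonal] at h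
    obtain ⟨-, ⟨rfl, -⟩, -⟩ := h
    rfl
  · rintro ⟨n, v⟩ _
    rfl

lemma truncSum_eq {L : ℕ} (s : ℝ) :
    truncSum L s = -∑ n ∈ Finset.Icc 1 L, (-1) ^ n / (π * n) *
      (∑ c ∈ Finset.Icc 1 ⌊s⌋₊, (c : ℂ) * cis (π * (n * s ^ 2 / c - n * c))).im := by
  simp only [truncSum, sawSum]
  congr 1
  simp only [Finset.mul_sum, Complex.im_sum]
  rw [Finset.sum_comm]
  rw [← sum_range_add_one_eq]
  refine Finset.sum_congr rfl fun k _ => Finset.sum_congr rfl fun c _ => ?_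
  rw [show (c : ℂ) = ((c : ℝ) : ℂ) by simp, Complex.im_ofReal_mul, cis_im]
  have e : 2 * π * ((k : ℝ) + 1) * ((s ^ 2 / c - c + 1) / 2) =
      π * (((k + 1 : ℕ) : ℝ) * s ^ 2 / c - ((k + 1 : ℕ) : ℝ) * c) + (k + 1 : ℕ) * π := by
    push_cast; ring
  rw [e, Real.sin_add_nat_mul_pi]
  push_cast
  ring

lemma abs_truncSum_sub_le {L : ℕ} (hL : 2 ≤ L) {s : ℝ} (hs : 0 < s) (hsL : s ≤ L) :
    |truncSum L s - (-(s * √s / π) * trigPoly (4 * L ^ 6) (levelCoeff L) s)| ≤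
      (29 + 60 * (6 + ‖fresnelConst‖)) * (s + 1) * (1 + log L) ^ 2 := by
  have e : -(s * √s / π) * trigPoly (4 * L ^ 6) (levelCoeff L) s =
      -∑ n ∈ Finset.Icc 1 L, (-1) ^ n / (π * n) *
      (∑ v ∈ stationarySet L n, ((s * √s * (n * stationaryWeight n v) : ℝ) : ℂ) *
      (fresnelConst * cis (2 * π * s * √(n * v)))).im := by
    rw [trigPoly, ← sum_stationary_eq (fun m => (fresnelConst * cis (2 * π * s * √m)).im), neg_mul,
      Finset.mul_sum]
    congr 1
    refine Finset.sum_congr rfl fun n hn => ?_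
    rw [Finset.mul_sum, Complex.im_sum, Finset.mul_sum]
    refine Finset.sum_congr rfl fun v hv => ?_
    have hn0 : (n : ℝ) ≠ 0 := by
      have := (Finset.mem_Icc.1 hn).1
      positivity
    rw [Complex.im_ofReal_mul]
    push_cast
    field_simp
  rw [e, truncSum_eq, ← neg_sub, neg_sub_neg, neg_sub, ← Finset.sum_sub_distrib]
  set C := (29 + 60 * (6 + ‖fresnelConst‖)) * (s + 1) * (1 + log L) with hC
  have hlogL : 0 ≤ log L := Real.log_natCast_nonneg _
  have hC0 : 0 ≤ C := by positivity
  have hterm : ∀ n ∈ Finset.Icc 1 L, |(-1) ^ n / (π * n) *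
      (∑ v ∈ stationarySet L n, ((s * √s * (n * stationaryWeight n v) : ℝ) : ℂ) *
      (fresnelConst * cis (2 * π * s * √(n * v)))).im - (-1) ^ n / (π * n) *
      (∑ c ∈ Finset.Icc 1 ⌊s⌋₊, (c : ℂ) * cis (π * (n * s ^ 2 / c - n * c))).im| ≤
      1 / n * C := fun n hn => by
    obtain ⟨h1, h2⟩ := Finset.mem_Icc.1 hn
    have hn0 : (0 : ℝ) < n := by positivity
    rw [← mul_sub, abs_mul, abs_div, abs_pow, abs_neg, abs_one, one_pow,
      abs_of_pos (by positivity : 0 < π * n), abs_sub_comm, ← Complex.sub_im]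
    have h3 := (Complex.abs_im_le_norm _).trans (norm_sum_sub_stationary_le hL h1 h2 hs hsL)
    gcongr
    nlinarith [Real.pi_gt_three]
  refine (Finset.abs_sum_le_sum_abs _ _).trans ((Finset.sum_le_sum hterm).trans ?_)
  rw [← Finset.sum_mul]
  calc _ ≤ (1 + log L) * C := by gcongr; exact sum_Icc_inv_le L
    _ = _ := by rw [hC]; ring

/-- The weighted sawtooth sum describing the remainder in the count of type II eigenvalues. -/
noncomputable def sawtoothSum (s : ℝ) : ℝ :=
  ∑ c ∈ Finset.Icc 1 ⌊s⌋₊, (c : ℝ) * (Int.fract ((s ^ 2 / c - c + 1) / 2) - 1 / 2)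

/-- A majorant of the squared truncation error on `[1, T]`. -/
noncomputable def truncMajorant (L : ℕ) (T t : ℝ) : ℝ :=
  T * ∑ c ∈ Finset.Icc 1 ⌊√T⌋₊, (c : ℝ) * sawRem L (1 / (4 * π * c) * t + (1 - c) / 2) ^ 2

lemma sum_Icc_le_sq (N : ℕ) : ∑ c ∈ Finset.Icc 1 N, (c : ℝ) ≤ (N : ℝ) ^ 2 := by
  calc ∑ c ∈ Finset.Icc 1 N, (c : ℝ) ≤ ∑ c ∈ Finset.Icc 1 N, (N : ℝ) :=
        Finset.sum_le_sum fun c hc => by exact_mod_cast (Finset.mem_Icc.1 hc).2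
    _ = (N : ℝ) ^ 2 := by rw [Finset.sum_const, Nat.card_Icc, nsmul_eq_mul]; simp [sq]

lemma sq_sawtoothSum_sub_truncSum_le (L : ℕ) {T t : ℝ} (ht : 0 ≤ t) (htT : t ≤ T) :
    (sawtoothSum √(t / (2 * π)) - truncSum L √(t / (2 * π))) ^ 2 ≤ truncMajorant L T t := by
  set s := √(t / (2 * π)) with hs
  have hs2 : s ^ 2 = t / (2 * π) := Real.sq_sqrt (by positivity)
  have hsT : s ≤ √T := by
    apply Real.sqrt_le_sqrt
    rw [div_le_iff₀ (by positivity)]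
    nlinarith [Real.pi_gt_three]
  have e : sawtoothSum s - truncSum L s = ∑ c ∈ Finset.Icc 1 ⌊s⌋₊,
      √c * (√c * sawRem L (1 / (4 * π * c) * t + (1 - c) / 2)) := by
    rw [sawtoothSum, truncSum, sub_neg_eq_add, ← Finset.sum_add_distrib]
    refine Finset.sum_congr rfl fun c hc => ?_
    have hc0 : (c:ℝ) ≠ 0 := by have := (Finset.mem_Icc.1 hc).1; positivity
    have hu : (s ^ 2 / c - c + 1) / 2 = 1 / (4 * π * c) * t + (1 - c) / 2 := by
      rw [hs2]; field_simp; ring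
    rw [← mul_assoc, Real.mul_self_sqrt (by positivity), hu, sawRem]
    ring
  rw [e]
  refine (Finset.sum_mul_sq_le_sq_mul_sq _ _ _).trans ?_
  simp only [mul_pow, Real.sq_sqrt (Nat.cast_nonneg _)]
  rw [truncMajorant]
  have hfl : ⌊s⌋₊ ≤ ⌊√T⌋₊ := Nat.floor_le_floor hsT
  refine mul_le_mul ?_ ?_ (by positivity) (ht.trans htT)
  · refine (sum_Icc_le_sq _).trans ?_
    have h1 : (⌊s⌋₊ : ℝ) ≤ √T := (Nat.floor_le (Real.sqrt_nonneg _)).trans hsT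
    calc (⌊s⌋₊ : ℝ) ^ 2 ≤ √T ^ 2 := by gcongr
      _ = T := Real.sq_sqrt (ht.trans htT)
  · exact Finset.sum_le_sum_of_subset_of_nonneg (Finset.Icc_subset_Icc_right hfl)
      fun _ _ _ => by positivity

lemma intervalIntegrable_sawRem_sq_comp (L : ℕ) (d e a b : ℝ) :
    IntervalIntegrable (fun t => sawRem L (d * t + e) ^ 2) volume a b := by
  refine (intervalIntegrable_const (c := (2 + log L) ^ 2)).mono_fun
    (((measurable_sawRem L).comp (by fun_prop)).pow_const 2).aestronglyMeasurable
    (Filter.Eventually.of_forall fun u => ?_)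
  simp only [Real.norm_eq_abs, abs_pow]
  exact pow_le_pow_left₀ (abs_nonneg _) ((abs_sawRem_le L _).trans (le_abs_self _)) 2

lemma intervalIntegrable_truncMajorant (L : ℕ) (T a b : ℝ) :
    IntervalIntegrable (truncMajorant L T) volume a b := by
  unfold truncMajorant
  apply IntervalIntegrable.const_mul
  have := IntervalIntegrable.sum (μ := volume) (a := a) (b := b) (Finset.Icc 1 ⌊√T⌋₊)
    (f := fun c t => (c : ℝ) * sawRem L (1 / (4 * π * c) * t + (1 - c) / 2) ^ 2)
    fun c _ => (intervalIntegrable_sawRem_sq_comp L _ _ a b).const_mul _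
  refine this.congr (fun t _ => ?_)
  simp

lemma integral_truncMajorant_le {L : ℕ} {T : ℝ} (hT : 1 ≤ T) (hL : T ≤ L) :
    ∫ t in (1:ℝ)..T, truncMajorant L T t ≤ 14 * T ^ 2 := by
  have hL0 : (0:ℝ) < L := by linarith
  have hL1 : 1 ≤ L := by exact_mod_cast hL0
  unfold truncMajorant
  rw [intervalIntegral.integral_const_mul, intervalIntegral.integral_finsetSum fun c _ =>
    (intervalIntegrable_sawRem_sq_comp L _ _ _ _).const_mul _]
  have hfl : (⌊√T⌋₊ : ℝ) ≤ √T := Nat.floor_le (Real.sqrt_nonneg _)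
  have hsq : √T ^ 2 = T := Real.sq_sqrt (by linarith)
  have hsT : √T ≤ T := by
    rw [Real.sqrt_le_left (by linarith)]; nlinarith
  have hterm : ∀ c ∈ Finset.Icc 1 ⌊√T⌋₊, ∫ t in (1:ℝ)..T,
      (c : ℝ) * sawRem L (1 / (4 * π * c) * t + (1 - c) / 2) ^ 2 ≤ c * 14 := fun c hc => by
    obtain ⟨h1, h2⟩ := Finset.mem_Icc.1 hc
    have hc0 : (0:ℝ) < c := by positivity
    have hcT : (c:ℝ) ≤ T := by
      have : (c:ℝ) ≤ ⌊√T⌋₊ := by exact_mod_cast h2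
      linarith
    rw [intervalIntegral.integral_const_mul]
    gcongr
    have hd : 1 / (4 * π * c) ≠ 0 := by positivity
    rw [intervalIntegral.integral_comp_mul_add (fun u => sawRem L u ^ 2) hd, smul_eq_mul]
    have h := integral_sawRem_sq_le_of_le hL1
      (a := 1 / (4 * π * c) * 1 + (1 - c) / 2) (b := 1 / (4 * π * c) * T + (1 - c) / 2) (by gcongr)
    calc _ ≤ (1 / (4 * π * c))⁻¹ * ((1 / (4 * π * c) * T + (1 - c) / 2 -
          (1 / (4 * π * c) * 1 + (1 - c) / 2) + 1) * (1 / L)) := by gcongr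
      _ = (T - 1 + 4 * π * c) / L := by field_simp; ring
      _ ≤ 14 := by
        rw [div_le_iff₀ hL0]
        have : π * c ≤ 3.15 * T := by
          gcongr
          linarith [Real.pi_lt_d2]
        linarith
  calc _ ≤ T * ∑ c ∈ Finset.Icc 1 ⌊√T⌋₊, (c : ℝ) * 14 := by gcongr; exact hterm _ ‹_›
    _ ≤ T * (T * 14) := by
      rw [← Finset.sum_mul]
      gcongr
      refine (sum_Icc_le_sq _).trans ?_
      calc (⌊√T⌋₊ : ℝ) ^ 2 ≤ √T ^ 2 := by gcongr
        _ = T := hsq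
    _ = _ := by ring

lemma sum_Icc_sq (M : ℕ) :
    ∑ c ∈ Finset.Icc 1 M, (c : ℝ) ^ 2 = M * (M + 1) * (2 * M + 1) / 6 := by
  induction M with
  | zero => simp
  | succ M ih => rw [Finset.sum_Icc_succ_top (by omega), ih]; push_cast; ring

lemma NH_eq_sum {s : ℝ} (hs : 0 ≤ s) :
    NH (2 * π * s ^ 2) = ∑ c ∈ Finset.Icc 1 ⌊s⌋₊, 2 * (c : ℝ) * ⌊(s ^ 2 / c - c + 1) / 2⌋₊ := by
  have hcond : ∀ p q : ℕ, (2 * π * (p + 1 : ℝ) * ((p + 1 : ℝ) + 2 * (q : ℝ) + 1) ≤ 2 * π * s ^ 2) ↔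
      q < ⌊(s ^ 2 / (p + 1 : ℝ) - (p + 1 : ℝ) + 1) / 2⌋₊ := fun p q => by
    rw [← Nat.succ_le_iff, Nat.succ_eq_add_one, Nat.le_floor_iff' (by omega), mul_assoc,
      mul_le_mul_iff_right₀ (by positivity), le_div_iff₀ (by norm_num)]
    push_cast
    have hp : (0:ℝ) < p + 1 := by positivity
    rw [show ((q : ℝ) + 1) * 2 ≤ s ^ 2 / (p + 1 : ℝ) - (p + 1 : ℝ) + 1 ↔
      (p + 1 : ℝ) + 2 * q + 1 ≤ s ^ 2 / (p + 1 : ℝ) by constructor <;> intro h <;> linarith,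
      le_div_iff₀ hp, mul_comm]
  have hfl : ∀ p : ℕ, ⌊s⌋₊ ≤ p → ⌊(s ^ 2 / (p + 1 : ℝ) - (p + 1 : ℝ) + 1) / 2⌋₊ = 0 := fun p hp => by
    have hp' : s < p + 1 := by
      have := Nat.lt_floor_add_one s
      have : (⌊s⌋₊ : ℝ) ≤ p := by exact_mod_cast hp
      linarith
    rw [Nat.floor_eq_zero]
    have : s ^ 2 / (p + 1 : ℝ) ≤ p + 1 := by
      rw [div_le_iff₀ (by positivity)]; nlinarith
    linarith
  have hfl2 : ∀ p : ℕ, ⌊(s ^ 2 / (p + 1 : ℝ) - (p + 1 : ℝ) + 1) / 2⌋₊ ≤ ⌊s ^ 2⌋₊ := fun p => by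
    apply Nat.floor_le_floor
    have hp : (0:ℝ) ≤ p := by positivity
    have : s ^ 2 / (p + 1 : ℝ) ≤ s ^ 2 := div_le_self (by positivity) (by linarith)
    nlinarith
  unfold NH
  rw [tsum_eq_sum (s := Finset.range ⌊s⌋₊ ×ˢ Finset.range ⌊s ^ 2⌋₊)]
  · rw [Finset.sum_product, ← sum_range_add_one_eq]
    refine Finset.sum_congr rfl fun p _ => ?_
    simp only [hcond]
    rw [← Finset.sum_filter]
    have hS : (Finset.range ⌊s ^ 2⌋₊).filter
        (fun q => q < ⌊(s ^ 2 / (p + 1 : ℝ) - (p + 1 : ℝ) + 1) / 2⌋₊) =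
        Finset.range ⌊(s ^ 2 / (p + 1 : ℝ) - (p + 1 : ℝ) + 1) / 2⌋₊ := by
      ext q
      simp only [Finset.mem_filter, Finset.mem_range]
      have := hfl2 p
      omega
    rw [hS, Finset.sum_const, Finset.card_range, nsmul_eq_mul]
    push_cast
    ring
  · rintro ⟨p, q⟩ h
    simp only [Finset.mem_product, Finset.mem_range, not_and_or, not_lt] at h
    rw [if_neg]
    rw [hcond, not_lt]
    rcases h with h | h
    · rw [hfl p h]; omega
    · exact (hfl2 p).trans h

lemma abs_NH_sub_le {s : ℝ} (hs : 0 ≤ s) :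
    |NH (2 * π * s ^ 2) - (2 / 3 * s ^ 3 - s ^ 2 / 2) + 2 * sawtoothSum s| ≤ 2 * (s + 1) := by
  have e : NH (2 * π * s ^ 2) + 2 * sawtoothSum s =
      ∑ c ∈ Finset.Icc 1 ⌊s⌋₊, (s ^ 2 - (c : ℝ) ^ 2) := by
    rw [NH_eq_sum hs, sawtoothSum, Finset.mul_sum, ← Finset.sum_add_distrib]
    refine Finset.sum_congr rfl fun c hc => ?_
    obtain ⟨h1, h2⟩ := Finset.mem_Icc.1 hc
    have hc0 : (0:ℝ) < c := by positivity
    have hcs : (c:ℝ) ≤ s := (Nat.le_floor_iff hs).1 h2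
    have hu : 0 ≤ (s ^ 2 / c - c + 1) / 2 := by
      have : (c:ℝ) ≤ s ^ 2 / c := by rw [le_div_iff₀ hc0]; nlinarith
      linarith
    rw [natCast_floor_eq_intCast_floor hu, ← Int.self_sub_floor]
    field_simp
    ring
  rw [Finset.sum_sub_distrib, sum_Icc_sq, Finset.sum_const, Nat.card_Icc, nsmul_eq_mul] at e
  have h1 := Nat.floor_le hs
  have h2 := Nat.lt_floor_add_one s
  simp only [Nat.add_sub_cancel] at e
  generalize (⌊s⌋₊ : ℝ) = M at *
  obtain ⟨f, rfl⟩ : ∃ f, M = s - f := ⟨s - M, by ring⟩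
  have hf0 : 0 ≤ f := by linarith
  have hf1 : f ≤ 1 := by linarith
  have e2 : NH (2 * π * s ^ 2) - (2 / 3 * s ^ 3 - s ^ 2 / 2) + 2 * sawtoothSum s =
      s * (f - f ^ 2 - 1 / 6) + (f ^ 3 / 3 - f ^ 2 / 2 + f / 6) := by
    linear_combination e
  rw [e2]
  have g1 : |f - f ^ 2 - 1 / 6| ≤ 1 := by rw [abs_le]; constructor <;> nlinarith
  have g2 : |f ^ 3 / 3 - f ^ 2 / 2 + f / 6| ≤ 1 := by
    have : f ^ 2 ≤ 1 := by nlinarith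
    have h3 : f ^ 3 ≤ 1 := pow_le_one₀ hf0 hf1
    have h3' : 0 ≤ f ^ 3 := by positivity
    rw [abs_le]; constructor <;> nlinarith
  refine (abs_add_le _ _).trans ?_
  rw [abs_mul, abs_of_nonneg hs]
  nlinarith

lemma finite_lattice_ball (r : ℝ) :
    {q : ℤ × ℤ | (q.1 : ℝ) ^ 2 + (q.2 : ℝ) ^ 2 ≤ r ^ 2}.Finite := by
  refine ((Set.finite_Icc (-⌈|r|⌉) ⌈|r|⌉).prod (Set.finite_Icc (-⌈|r|⌉) ⌈|r|⌉)).subset ?_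
  have h : ∀ x y : ℤ, (x : ℝ) ^ 2 + (y : ℝ) ^ 2 ≤ r ^ 2 → x ∈ Set.Icc (-⌈|r|⌉) ⌈|r|⌉ :=
    fun x y hxy => by
      have h1 : |(x : ℝ)| ≤ |r| := sq_le_sq.1 (by nlinarith [sq_nonneg (y : ℝ)])
      have h2 : ((|x| : ℤ) : ℝ) ≤ ⌈|r|⌉ := by push_cast; exact h1.trans (Int.le_ceil _)
      exact abs_le.1 (by exact_mod_cast h2)
  rintro ⟨x, y⟩ hxy
  exact ⟨h x y hxy, h y x (by simpa [add_comm] using hxy)⟩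

/-- The lattice point at the lower left corner of the unit cell containing `z`. -/
noncomputable def latticeFloor (z : ℂ) : ℤ × ℤ := (⌊z.re⌋, ⌊z.im⌋)

lemma measurable_latticeFloor : Measurable latticeFloor :=
  (Int.measurable_floor.comp Complex.measurable_re).prodMk
    (Int.measurable_floor.comp Complex.measurable_im)

lemma volume_latticeFloor_preimage_singleton (q : ℤ × ℤ) :
    volume (latticeFloor ⁻¹' {q}) = 1 := by
  have h : latticeFloor ⁻¹' {q} = Complex.measurableEquivRealProd ⁻¹'
      (Set.Ico (q.1 : ℝ) (q.1 + 1) ×ˢ Set.Ico (q.2 : ℝ) (q.2 + 1)) := by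
    ext z
    simp [latticeFloor, Prod.ext_iff, Int.floor_eq_iff, Complex.measurableEquivRealProd_apply]
  rw [h, Complex.volume_preserving_equiv_real_prod.measure_preimage
    (measurableSet_Ico.prod measurableSet_Ico).nullMeasurableSet, Measure.volume_eq_prod,
    Measure.prod_prod]
  simp

lemma abs_ncard_lattice_ball_sub_le {r : ℝ} (hr : 0 ≤ r) :
    |(Set.ncard {q : ℤ × ℤ | (q.1 : ℝ) ^ 2 + (q.2 : ℝ) ^ 2 ≤ r ^ 2} : ℝ) - π * r ^ 2| ≤
      4 * π * (r + 1) := by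
  set S := (finite_lattice_ball r).toFinset with hS
  have hmem : ∀ q : ℤ × ℤ, q ∈ S ↔ (q.1 : ℝ) ^ 2 + (q.2 : ℝ) ^ 2 ≤ r ^ 2 := fun q => by simp [hS]
  rw [Set.ncard_eq_toFinset_card _ (finite_lattice_ball r), ← hS]
  have hvol : volume (latticeFloor ⁻¹' (S : Set (ℤ × ℤ))) = (S.card : ENNReal) := by
    rw [← sum_measure_preimage_singleton S
      (fun q _ => measurable_latticeFloor (measurableSet_singleton q))]
    simp [volume_latticeFloor_preimage_singleton]
  have hdist : ∀ z : ℂ, ‖z - ((latticeFloor z).1 + (latticeFloor z).2 * Complex.I)‖ ≤ 2 := fun z => by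
    refine (Complex.norm_le_abs_re_add_abs_im _).trans ?_
    simp only [latticeFloor, Complex.sub_re, Complex.sub_im, Complex.add_re, Complex.add_im,
      Complex.mul_re, Complex.mul_im, Complex.intCast_re, Complex.intCast_im, Complex.I_re,
      Complex.I_im, mul_zero, mul_one, sub_zero, add_zero, zero_add, Int.self_sub_floor]
    rw [abs_of_nonneg (Int.fract_nonneg _), abs_of_nonneg (Int.fract_nonneg _)]
    linarith [Int.fract_lt_one z.re, Int.fract_lt_one z.im]
  have hnorm : ∀ q : ℤ × ℤ, q ∈ S ↔ ‖(q.1 + q.2 * Complex.I : ℂ)‖ ≤ r := fun q => by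
    rw [hmem, ← sq_le_sq₀ (norm_nonneg _) hr, ← Complex.normSq_eq_norm_sq, Complex.normSq_apply]
    simp [sq]
  have hup : latticeFloor ⁻¹' (S : Set (ℤ × ℤ)) ⊆ Metric.closedBall 0 (r + 2) := fun z hz => by
    have h1 := (hnorm _).1 hz
    rw [mem_closedBall_zero_iff]
    have := norm_le_norm_sub_add z ((latticeFloor z).1 + (latticeFloor z).2 * Complex.I)
    linarith [hdist z]
  have hpi := Real.pi_pos
  have up : (S.card : ℝ) ≤ π * (r + 2) ^ 2 := by
    have h := measure_mono (μ := volume) hup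
    rw [hvol, Complex.volume_closedBall] at h
    have h2 := ENNReal.toReal_mono (by finiteness) h
    simp only [ENNReal.toReal_natCast, ENNReal.toReal_mul, ENNReal.toReal_pow,
      ENNReal.toReal_ofReal (by linarith : 0 ≤ r + 2)] at h2
    simpa [mul_comm] using h2
  rw [abs_le]
  constructor
  · rcases lt_or_ge r 2 with h2 | h2
    · have : (0:ℝ) ≤ S.card := by positivity
      nlinarith [mul_nonneg hpi.le hr]
    · have hlow : Metric.closedBall 0 (r - 2) ⊆ latticeFloor ⁻¹' (S : Set (ℤ × ℤ)) := fun z hz => by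
        rw [mem_closedBall_zero_iff] at hz
        refine (hnorm _).2 ?_
        have := norm_le_norm_sub_add ((latticeFloor z).1 + (latticeFloor z).2 * Complex.I) z
        rw [norm_sub_rev] at this
        linarith [hdist z]
      have h := measure_mono (μ := volume) hlow
      rw [hvol, Complex.volume_closedBall] at h
      have h3 := ENNReal.toReal_mono (by finiteness) h
      simp only [ENNReal.toReal_natCast, ENNReal.toReal_mul, ENNReal.toReal_pow,
        ENNReal.toReal_ofReal (by linarith : 0 ≤ r - 2)] at h3
      have h4 : (r - 2) ^ 2 * π ≤ S.card := by simpa using h3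
      nlinarith
  · nlinarith

lemma finite_NT (t : ℝ) :
    {q : ℤ × ℤ | 4 * π ^ 2 * ((q.1 : ℝ) ^ 2 + (q.2 : ℝ) ^ 2) ≤ t}.Finite := by
  refine (finite_lattice_ball (√|t|)).subset fun q hq => ?_
  rw [Set.mem_ofPred_eq] at hq ⊢
  rw [Real.sq_sqrt (abs_nonneg _)]
  have h1 : 1 ≤ 4 * π ^ 2 := by nlinarith [Real.pi_gt_three]
  have h2 : 0 ≤ (q.1 : ℝ) ^ 2 + (q.2 : ℝ) ^ 2 := by positivity
  have := le_abs_self t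
  nlinarith

lemma abs_NT_sub_le {s : ℝ} (hs : 0 ≤ s) :
    |NT (2 * π * s ^ 2) - s ^ 2 / 2| ≤ 16 * (s + 1) := by
  have h1 : 1 ≤ √(2 * π) := by rw [Real.one_le_sqrt]; nlinarith [Real.pi_gt_three]
  set r := s / √(2 * π) with hr
  have hr0 : 0 ≤ r := by positivity
  have hrs : r ≤ s := div_le_self hs h1
  have hr2 : r ^ 2 = s ^ 2 / (2 * π) := by rw [hr, div_pow, Real.sq_sqrt (by positivity)]
  have h := abs_ncard_lattice_ball_sub_le hr0
  have e : {q : ℤ × ℤ | 4 * π ^ 2 * ((q.1 : ℝ) ^ 2 + (q.2 : ℝ) ^ 2) ≤ 2 * π * s ^ 2} =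
      {q : ℤ × ℤ | (q.1 : ℝ) ^ 2 + (q.2 : ℝ) ^ 2 ≤ r ^ 2} := by
    ext q
    rw [Set.mem_ofPred_eq, Set.mem_ofPred_eq, hr2, le_div_iff₀ (by positivity),
      show 4 * π ^ 2 * ((q.1 : ℝ) ^ 2 + (q.2 : ℝ) ^ 2) =
        2 * π * (((q.1 : ℝ) ^ 2 + (q.2 : ℝ) ^ 2) * (2 * π)) by ring,
      mul_le_mul_iff_right₀ (by positivity)]
  have e2 : π * r ^ 2 = s ^ 2 / 2 := by rw [hr2]; field_simp
  rw [e2] at h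
  rw [NT, e]
  refine h.trans ?_
  nlinarith [Real.pi_le_four]

lemma abs_R_add_le {s : ℝ} (hs : 0 ≤ s) :
    |R (2 * π * s ^ 2) + 2 * sawtoothSum s| ≤ 18 * (s + 1) := by
  have h1 := abs_NT_sub_le hs
  have h2 := abs_NH_sub_le hs
  have e : Real.sqrt (2 * π) / (6 * π ^ 2) * (2 * π * s ^ 2) ^ ((3 : ℝ) / 2) = 2 / 3 * s ^ 3 := by
    rw [show ((3 : ℝ) / 2) = (1 / 2 : ℝ) * (3 : ℕ) by norm_num, Real.rpow_mul (by positivity),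
      Real.rpow_natCast, ← Real.sqrt_eq_rpow,
      show √(2 * π * s ^ 2) = √(2 * π) * s by
        rw [Real.sqrt_mul (by positivity : (0 : ℝ) ≤ 2 * π), Real.sqrt_sq hs]]
    have : √(2 * π) ^ 4 = (2 * π) ^ 2 := by
      rw [show √(2 * π) ^ 4 = (√(2 * π) ^ 2) ^ 2 by ring, Real.sq_sqrt (by positivity)]
    field_simp
    rw [this]
    ring
  have e2 : R (2 * π * s ^ 2) + 2 * sawtoothSum s = (NT (2 * π * s ^ 2) - s ^ 2 / 2) +
      (NH (2 * π * s ^ 2) - (2 / 3 * s ^ 3 - s ^ 2 / 2) + 2 * sawtoothSum s) := by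
    rw [R, e]; ring
  rw [e2]
  exact (abs_add_le _ _).trans (by linarith)

lemma add_one_le_mul_rpow {ε : ℝ} (hε : 0 < ε) {p : ℕ} (hp : 2 ≤ p) (a : ℕ) :
    (a + 1 : ℝ) ≤ (1 + 1 / (ε * log 2)) * ((p : ℝ) ^ a) ^ ε := by
  have hl : 0 < log 2 := Real.log_pos (by norm_num)
  have h1 : (1 : ℝ) + a * (ε * log 2) ≤ ((p : ℝ) ^ a) ^ ε := by
    calc (1 : ℝ) + a * (ε * log 2) ≤ rexp (a * (ε * log 2)) := by
          linarith [Real.add_one_le_exp ((a : ℝ) * (ε * log 2))]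
      _ = ((2 : ℝ) ^ a) ^ ε := by
          rw [Real.rpow_def_of_pos (by positivity), Real.log_pow]; ring_nf
      _ ≤ _ := by
          gcongr
          exact_mod_cast hp
  refine le_trans ?_ (mul_le_mul_of_nonneg_left h1 (by positivity))
  have : (1 + 1 / (ε * log 2)) * (1 + a * (ε * log 2)) =
      a + 1 + (1 / (ε * log 2) + a * (ε * log 2)) := by
    field_simp
    ring
  rw [this]
  have : 0 ≤ 1 / (ε * log 2) + a * (ε * log 2) := by positivity
  linarith

lemma add_one_le_rpow {ε : ℝ} (hε : 0 < ε) {p : ℕ} (hp : (2 : ℝ) ^ (1 / ε) ≤ p) (a : ℕ) :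
    (a + 1 : ℝ) ≤ ((p : ℝ) ^ a) ^ ε := by
  have h2 : (2 : ℝ) ≤ (p : ℝ) ^ ε := by
    calc (2 : ℝ) = ((2 : ℝ) ^ (1 / ε)) ^ ε := by
          rw [← Real.rpow_mul (by norm_num), one_div_mul_cancel hε.ne', Real.rpow_one]
      _ ≤ _ := by gcongr
  calc (a + 1 : ℝ) ≤ (2 : ℝ) ^ a := by
        have := one_add_mul_le_pow (a := (1 : ℝ)) (by norm_num) a
        norm_num at this
        linarith
    _ ≤ ((p : ℝ) ^ ε) ^ a := by gcongr
    _ = _ := by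
        rw [← Real.rpow_natCast, ← Real.rpow_mul (by positivity), mul_comm,
          Real.rpow_mul (by positivity), Real.rpow_natCast]

lemma exists_card_divisors_le {ε : ℝ} (hε : 0 < ε) :
    ∃ C : ℝ, 1 ≤ C ∧ ∀ m : ℕ, m ≠ 0 → (m.divisors.card : ℝ) ≤ C * (m : ℝ) ^ ε := by
  have hl : 0 < log 2 := Real.log_pos (by norm_num)
  set K : ℝ := 1 + 1 / (ε * log 2) with hK
  have hK1 : 1 ≤ K := by rw [hK]; have : 0 ≤ 1 / (ε * log 2) := by positivity
                         linarith
  set P : ℕ := ⌈(2 : ℝ) ^ (1 / ε)⌉₊ with hP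
  refine ⟨K ^ P, one_le_pow₀ hK1, fun m hm => ?_⟩
  have hm' : (m : ℝ) ^ ε = ∏ p ∈ m.primeFactors, ((p : ℝ) ^ (m.factorization p)) ^ ε := by
    rw [Real.finsetProd_rpow _ _ (fun p _ => by positivity)]
    congr 1
    have := Nat.prod_factorization_pow_eq_self hm
    conv_lhs => rw [← this]
    rw [Finsupp.prod, Nat.support_factorization]
    push_cast
    rfl
  rw [Nat.card_divisors hm, hm']
  push_cast
  calc ∏ p ∈ m.primeFactors, ((m.factorization p : ℝ) + 1) ≤
        ∏ p ∈ m.primeFactors, (if p < P then K else 1) * ((p : ℝ) ^ (m.factorization p)) ^ ε := by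
        refine Finset.prod_le_prod (fun p _ => by positivity) fun p hp => ?_
        have hp2 := (Nat.prime_of_mem_primeFactors hp).two_le
        split_ifs with h
        · exact add_one_le_mul_rpow hε hp2 _
        · rw [one_mul]
          exact add_one_le_rpow hε (Nat.ceil_le.1 (not_lt.1 h)) _
    _ = (∏ p ∈ m.primeFactors, (if p < P then K else 1)) *
          ∏ p ∈ m.primeFactors, ((p : ℝ) ^ (m.factorization p)) ^ ε := Finset.prod_mul_distrib
    _ ≤ _ := by
        refine mul_le_mul_of_nonneg_right ?_ (Finset.prod_nonneg fun p _ => by positivity)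
        rw [← Finset.prod_filter, Finset.prod_const]
        refine pow_le_pow_right₀ hK1 ?_
        calc _ ≤ (Finset.range P).card := Finset.card_le_card fun p hp => by
              simpa using (Finset.mem_filter.1 hp).2
          _ = P := Finset.card_range P

lemma norm_integral_cube_sqrt_mul_cis_le {T μ : ℝ} (hT : 1 ≤ T) (hμ : μ ≠ 0) :
    ‖∫ t in (1 : ℝ)..T, ((√(t / (2 * π)) ^ 3 : ℝ) : ℂ) * cis (2 * π * √(t / (2 * π)) * μ)‖ ≤
      T ^ 2 / |μ| := by
  have hpos : ∀ t ∈ Set.Icc (1 : ℝ) T, 0 < √(t / (2 * π)) := fun t ht =>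
    Real.sqrt_pos.2 (div_pos (by linarith [ht.1]) (by positivity))
  have hh : ∀ t ∈ Set.Icc (1 : ℝ) T,
      HasDerivAt (fun t : ℝ => t ^ 2 / (2 * π ^ 2 * μ)) (t / (π ^ 2 * μ)) t := fun t _ =>
    ((hasDerivAt_pow 2 t).div_const _).congr_deriv (by field_simp; norm_num)
  have hθ : ∀ t ∈ Set.Icc (1 : ℝ) T, HasDerivAt (fun t : ℝ => 2 * π * √(t / (2 * π)) * μ)
      (μ / (2 * √(t / (2 * π)))) t := fun t ht =>
    ((((hasDerivAt_id t).div_const (2 * π)).sqrt (by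
      have := (hpos t ht).ne'
      intro h
      exact this (by rw [show t / (2 * π) = 0 from h, Real.sqrt_zero]))).const_mul
        (2 * π) |>.mul_const μ).congr_deriv (by
          have := (hpos t ht).ne'
          simp only [id]
          field_simp)
  have hh' : ContinuousOn (fun t : ℝ => t / (π ^ 2 * μ)) (Set.Icc 1 T) := by fun_prop
  have hne : ∀ t ∈ Set.Icc (1 : ℝ) T, 2 * √(t / (2 * π)) ≠ 0 := fun t ht => by
    have := hpos t ht; positivity
  have hθ' : ContinuousOn (fun t : ℝ => μ / (2 * √(t / (2 * π)))) (Set.Icc 1 T) := by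
    fun_prop (disch := assumption)
  have e : ∫ t in (1 : ℝ)..T, ((√(t / (2 * π)) ^ 3 : ℝ) : ℂ) * cis (2 * π * √(t / (2 * π)) * μ) =
      ∫ t in (1 : ℝ)..T, ((t ^ 2 / (2 * π ^ 2 * μ) * (μ / (2 * √(t / (2 * π)))) : ℝ) : ℂ) *
        cis (2 * π * √(t / (2 * π)) * μ) := by
    refine intervalIntegral.integral_congr fun t ht => ?_
    rw [Set.uIcc_of_le hT] at ht
    have h0 := hpos t ht
    have h1 : √(t / (2 * π)) ^ 2 = t / (2 * π) := Real.sq_sqrt (by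
      have := ht.1; positivity)
    congr 2
    have h2 : t = 2 * π * √(t / (2 * π)) ^ 2 := by rw [h1]; field_simp
    set s := √(t / (2 * π))
    rw [h2]
    field_simp
  rw [e]
  have hT2 : 1 / (2 * π ^ 2) * (1 + 1) ≤ 1 := by
    rw [div_mul_eq_mul_div, div_le_one (by positivity)]
    nlinarith [Real.pi_gt_three]
  have key : |T ^ 2 / (2 * π ^ 2 * μ)| = (1 / (2 * π ^ 2)) * (T ^ 2 / |μ|) := by
    rw [abs_div, abs_mul, abs_of_nonneg (by positivity : 0 ≤ T ^ 2),
      abs_of_nonneg (by positivity : 0 ≤ 2 * π ^ 2)]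
    field_simp
  have hA : 0 ≤ T ^ 2 / |μ| := by positivity
  have fin : 2 * |T ^ 2 / (2 * π ^ 2 * μ)| ≤ T ^ 2 / |μ| := by
    rw [key]; nlinarith
  rcases lt_or_gt_of_ne hμ with h | h
  · have hn : ∀ t ∈ Set.Icc (1 : ℝ) T, t / (π ^ 2 * μ) ≤ 0 := fun t ht =>
      div_nonpos_of_nonneg_of_nonpos (by linarith [ht.1])
        (mul_nonpos_of_nonneg_of_nonpos (by positivity) h.le)
    refine (norm_integral_mul_deriv_cis_le_of_anti hT hh hθ hh' hθ' hn).trans (le_trans ?_ fin)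
    have hd : ∀ x : ℝ, x ^ 2 / (2 * π ^ 2 * μ) ≤ 0 := fun x =>
      div_nonpos_of_nonneg_of_nonpos (by positivity)
        (mul_nonpos_of_nonneg_of_nonpos (by positivity) h.le)
    rw [abs_of_nonpos (hd 1), abs_of_nonpos (hd T)]
    linarith
  · have hn : ∀ t ∈ Set.Icc (1 : ℝ) T, 0 ≤ t / (π ^ 2 * μ) := fun t ht => by
      have := ht.1; positivity
    refine (norm_integral_mul_deriv_cis_le_of_mono hT hh hθ hh' hθ' hn).trans (le_trans ?_ fin)
    have hd : ∀ x : ℝ, 0 ≤ x ^ 2 / (2 * π ^ 2 * μ) := fun x => by positivity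
    rw [abs_of_nonneg (hd 1), abs_of_nonneg (hd T)]
    linarith

lemma integral_cube_sqrt {T : ℝ} (hT : 1 ≤ T) :
    ∫ t in (1 : ℝ)..T, √(t / (2 * π)) ^ 3 =
      2 / 5 * (1 / √(2 * π)) ^ 3 * (T ^ ((5 : ℝ) / 2) - 1) := by
  have e : ∫ t in (1 : ℝ)..T, √(t / (2 * π)) ^ 3 =
      ∫ t in (1 : ℝ)..T, (1 / √(2 * π)) ^ 3 * t ^ ((3 : ℝ) / 2) := by
    refine intervalIntegral.integral_congr fun t ht => ?_
    rw [Set.uIcc_of_le hT] at ht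
    have h0 : 0 ≤ t := by linarith [ht.1]
    rw [Real.sqrt_div h0, show ((3 : ℝ) / 2) = (1 / 2 : ℝ) * (3 : ℕ) by norm_num,
      Real.rpow_mul h0, Real.rpow_natCast, ← Real.sqrt_eq_rpow]
    ring
  rw [e, intervalIntegral.integral_const_mul, integral_rpow (Or.inl (by norm_num)),
    show (3 : ℝ) / 2 + 1 = 5 / 2 by norm_num, Real.one_rpow]
  ring

lemma im_mul_cis_mul_im_mul_cis (κ : ℂ) (a b : ℝ) :
    (κ * cis a).im * (κ * cis b).im =
      (1 / 2) * (((‖κ‖ ^ 2 : ℝ) : ℂ) * cis (a - b)).re - (1 / 2) * (κ ^ 2 * cis (a + b)).re := by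
  rw [Complex.re_ofReal_mul, cis_re, Complex.sq_norm, Complex.normSq_apply]
  simp only [Complex.mul_im, Complex.mul_re, cis_re, cis_im, pow_two, Real.cos_sub, Real.cos_add,
    Real.sin_add]
  ring

lemma abs_integral_pair_sub_le {T : ℝ} (hT : 1 ≤ T) (κ : ℂ) {m n : ℕ} (hm : 1 ≤ m) (hn : 1 ≤ n) :
    |(∫ t in (1 : ℝ)..T, √(t / (2 * π)) ^ 3 * ((κ * cis (2 * π * √(t / (2 * π)) * √m)).im *
        (κ * cis (2 * π * √(t / (2 * π)) * √n)).im)) -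
      (if m = n then ‖κ‖ ^ 2 / 2 * ∫ t in (1 : ℝ)..T, √(t / (2 * π)) ^ 3 else 0)| ≤
      ‖κ‖ ^ 2 * T ^ 2 * ((if m = n then 1 else 0) + 1 / |√m - √n|) := by
  have hcs : ∀ μ : ℝ, Continuous fun t : ℝ =>
      ((√(t / (2 * π)) ^ 3 : ℝ) : ℂ) * cis (2 * π * √(t / (2 * π)) * μ) := fun μ => by
    have := continuous_cis
    fun_prop
  have hre : ∀ (w : ℂ) (μ : ℝ), (∫ t in (1 : ℝ)..T, √(t / (2 * π)) ^ 3 *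
      (w * cis (2 * π * √(t / (2 * π)) * μ)).re) = (w * ∫ t in (1 : ℝ)..T,
        ((√(t / (2 * π)) ^ 3 : ℝ) : ℂ) * cis (2 * π * √(t / (2 * π)) * μ)).re := by
    intro w μ
    rw [← intervalIntegral.integral_const_mul]
    have h2 := Complex.reCLM.intervalIntegral_comp_comm
      (((hcs μ).const_mul w).intervalIntegrable (μ := volume) 1 T)
    simp only [Complex.reCLM_apply] at h2
    rw [← h2]
    refine intervalIntegral.integral_congr fun t _ => ?_
    rw [show w * (((√(t / (2 * π)) ^ 3 : ℝ) : ℂ) * cis (2 * π * √(t / (2 * π)) * μ)) =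
      ((√(t / (2 * π)) ^ 3 : ℝ) : ℂ) * (w * cis (2 * π * √(t / (2 * π)) * μ)) by ring,
      Complex.re_ofReal_mul]
  have hcw : ∀ (w : ℂ) (μ : ℝ), Continuous fun t : ℝ => √(t / (2 * π)) ^ 3 *
      (w * cis (2 * π * √(t / (2 * π)) * μ)).re := fun w μ => by
    have := continuous_cis
    have h : Continuous fun t : ℝ => w * cis (2 * π * √(t / (2 * π)) * μ) := by fun_prop
    have := Complex.continuous_re.comp h
    simp only [Function.comp_def] at this
    fun_prop
  have e : (∫ t in (1 : ℝ)..T, √(t / (2 * π)) ^ 3 * ((κ * cis (2 * π * √(t / (2 * π)) * √m)).im *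
        (κ * cis (2 * π * √(t / (2 * π)) * √n)).im)) =
      (1 / 2) * (((‖κ‖ ^ 2 : ℝ) : ℂ) * ∫ t in (1 : ℝ)..T,
        ((√(t / (2 * π)) ^ 3 : ℝ) : ℂ) * cis (2 * π * √(t / (2 * π)) * (√m - √n))).re -
      (1 / 2) * (κ ^ 2 * ∫ t in (1 : ℝ)..T,
        ((√(t / (2 * π)) ^ 3 : ℝ) : ℂ) * cis (2 * π * √(t / (2 * π)) * (√m + √n))).re := by
    rw [← hre, ← hre, ← intervalIntegral.integral_const_mul, ← intervalIntegral.integral_const_mul,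
      ← intervalIntegral.integral_sub (((hcw _ _).const_mul _).intervalIntegrable _ _)
        (((hcw _ _).const_mul _).intervalIntegrable _ _)]
    refine intervalIntegral.integral_congr fun t _ => ?_
    rw [im_mul_cis_mul_im_mul_cis, mul_sub, mul_add]
    ring_nf
  have hsm : 1 ≤ √(m : ℝ) := Real.one_le_sqrt.2 (by exact_mod_cast hm)
  have hsn : 1 ≤ √(n : ℝ) := Real.one_le_sqrt.2 (by exact_mod_cast hn)
  have hK : 0 ≤ ‖κ‖ ^ 2 * T ^ 2 := by positivity
  have hplus : ‖(1 / 2) * (κ ^ 2 * ∫ t in (1 : ℝ)..T,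
        ((√(t / (2 * π)) ^ 3 : ℝ) : ℂ) * cis (2 * π * √(t / (2 * π)) * (√m + √n))).re‖ ≤
      ‖κ‖ ^ 2 * T ^ 2 * (1 / 2 * (1 / (√m + √n))) := by
    rw [norm_mul, Real.norm_of_nonneg (by norm_num : (0 : ℝ) ≤ 1 / 2)]
    calc _ ≤ 1 / 2 * (‖κ‖ ^ 2 * (T ^ 2 / |√m + √n|)) := by
          refine mul_le_mul_of_nonneg_left ?_ (by norm_num)
          refine (Complex.abs_re_le_norm _).trans ?_
          rw [norm_mul, norm_pow]
          gcongr
          exact norm_integral_cube_sqrt_mul_cis_le hT (by positivity)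
      _ = _ := by rw [abs_of_nonneg (by positivity)]; ring
  rw [Real.norm_eq_abs] at hplus
  rw [e]
  by_cases h : m = n
  · subst h
    simp only [if_true, sub_self, mul_zero, cis_zero, mul_one, abs_zero, div_zero, add_zero]
    rw [show (((‖κ‖ ^ 2 : ℝ) : ℂ) * ∫ t in (1 : ℝ)..T, ((√(t / (2 * π)) ^ 3 : ℝ) : ℂ)).re =
      ‖κ‖ ^ 2 * ∫ t in (1 : ℝ)..T, √(t / (2 * π)) ^ 3 by
        rw [Complex.re_ofReal_mul, intervalIntegral.integral_ofReal, Complex.ofReal_re]]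
    rw [show ∀ x y : ℝ, 1 / 2 * (‖κ‖ ^ 2 * x) - y - ‖κ‖ ^ 2 / 2 * x = -y by intros; ring, abs_neg]
    refine hplus.trans ?_
    have : 1 / 2 * (1 / (√(m : ℝ) + √m)) ≤ 1 := by
      have : 1 / (√(m : ℝ) + √m) ≤ 1 / 1 := one_div_le_one_div_of_le one_pos (by linarith)
      linarith
    nlinarith
  · simp only [h, if_false, sub_zero, zero_add]
    have hne : √(m : ℝ) - √n ≠ 0 := by
      intro h0
      apply h
      have := (Real.sqrt_inj (Nat.cast_nonneg m) (Nat.cast_nonneg n)).1 (sub_eq_zero.1 h0)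
      exact_mod_cast this
    have hminus : ‖(1 / 2) * (((‖κ‖ ^ 2 : ℝ) : ℂ) * ∫ t in (1 : ℝ)..T,
        ((√(t / (2 * π)) ^ 3 : ℝ) : ℂ) * cis (2 * π * √(t / (2 * π)) * (√m - √n))).re‖ ≤
        ‖κ‖ ^ 2 * T ^ 2 * (1 / 2 * (1 / |√m - √n|)) := by
      rw [norm_mul, Real.norm_of_nonneg (by norm_num : (0 : ℝ) ≤ 1 / 2)]
      calc _ ≤ 1 / 2 * (‖κ‖ ^ 2 * (T ^ 2 / |√m - √n|)) := by
            refine mul_le_mul_of_nonneg_left ?_ (by norm_num)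
            refine (Complex.abs_re_le_norm _).trans ?_
            rw [norm_mul, Complex.norm_real, Real.norm_of_nonneg (by positivity)]
            gcongr
            exact norm_integral_cube_sqrt_mul_cis_le hT hne
        _ = _ := by ring
    rw [Real.norm_eq_abs] at hminus
    have hlt : 1 / (√(m : ℝ) + √n) ≤ 1 / |√(m : ℝ) - √n| := by
      refine one_div_le_one_div_of_le (abs_pos.2 hne) (abs_le.2 ⟨by linarith, by linarith⟩)
    refine (abs_sub _ _).trans ?_
    nlinarith [mul_le_mul_of_nonneg_left hlt hK]

lemma sum_Icc_inv_abs_sub_le {N : ℕ} (hN : 1 ≤ N) {m : ℕ} (hm : m ∈ Finset.Icc 1 N) :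
    ∑ n ∈ Finset.Icc 1 N, 1 / |(m : ℝ) - n| ≤ 8 * (1 + log N) := by
  rw [Finset.mem_Icc] at hm
  have h := sum_inv_abs_le (S := (Finset.Icc 1 N).image (fun n : ℕ => (n : ℤ))) (B := 2 * N)
    (2 * (m : ℤ)) (by
      intro k hk
      obtain ⟨n, hn, rfl⟩ := Finset.mem_image.1 hk
      rw [Finset.mem_Icc] at hn
      rw [abs_le]
      push_cast
      constructor <;> omega)
  rw [Finset.sum_image (by intro a _ b _ h; simpa using h)] at h
  have e : ∑ n ∈ Finset.Icc 1 N, 1 / |(m : ℝ) - n| =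
      2 * ∑ n ∈ Finset.Icc 1 N, 1 / |(2 * ((n : ℤ) : ℝ) - ((2 * (m : ℤ) : ℤ) : ℝ))| := by
    rw [Finset.mul_sum]
    refine Finset.sum_congr rfl fun n _ => ?_
    push_cast
    rw [← mul_sub, abs_mul, abs_sub_comm (n : ℝ), abs_two]
    rcases eq_or_ne |(m : ℝ) - n| 0 with h0 | h0
    · simp [h0]
    · field_simp
  rw [e]
  have hl : 0 ≤ log N := Real.log_natCast_nonneg N
  have h2 : log ((2 * N : ℕ) : ℝ) ≤ 1 + log N := by
    push_cast
    rw [Real.log_mul (by norm_num) (by positivity)]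
    linarith [Real.log_two_lt_d9]
  linarith

lemma inv_abs_sqrt_sub_eq (m n : ℕ) :
    1 / |√(m : ℝ) - √n| = (√m + √n) / |(m : ℝ) - n| := by
  have e : (m : ℝ) - n = (√m - √n) * (√m + √n) := by
    ring_nf
    rw [Real.sq_sqrt (by positivity), Real.sq_sqrt (by positivity)]
  rcases eq_or_ne (√(m : ℝ) + √n) 0 with h | h
  · have h1 : √(m : ℝ) = 0 := by linarith [Real.sqrt_nonneg (m : ℝ), Real.sqrt_nonneg (n : ℝ)]
    have h2 : √(n : ℝ) = 0 := by linarith [Real.sqrt_nonneg (m : ℝ), Real.sqrt_nonneg (n : ℝ)]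
    simp [h1, h2]
  · rw [e, abs_mul, abs_of_nonneg (by positivity : 0 ≤ √(m : ℝ) + √n)]
    rcases eq_or_ne |√(m : ℝ) - √n| 0 with h0 | h0
    · simp [h0]
    · field_simp

lemma weight_mul_sqrt_add_sqrt_le {x y : ℝ} (hx : 0 < x) (hy : 0 < y) :
    x ^ (-(3 / 4) : ℝ) * y ^ (-(3 / 4) : ℝ) * (√x + √y) ≤ 1 / x + 1 / y := by
  set u := x ^ (-(1 / 4) : ℝ) with hu
  set v := y ^ (-(1 / 4) : ℝ) with hv
  have hu0 : 0 < u := by positivity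
  have hv0 : 0 < v := by positivity
  have e1 : ∀ z : ℝ, 0 < z → z ^ (-(3 / 4) : ℝ) = (z ^ (-(1 / 4) : ℝ)) ^ 3 := fun z hz => by
    rw [← Real.rpow_mul_natCast hz.le]; norm_num
  have e2 : ∀ z : ℝ, 0 < z → 1 / z = (z ^ (-(1 / 4) : ℝ)) ^ 4 := fun z hz => by
    rw [← Real.rpow_mul_natCast hz.le, one_div, ← Real.rpow_neg_one]; norm_num
  have e3 : ∀ z : ℝ, 0 < z → z ^ (-(3 / 4) : ℝ) * √z = z ^ (-(1 / 4) : ℝ) := fun z hz => by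
    rw [Real.sqrt_eq_rpow, ← Real.rpow_add hz]; norm_num
  have : x ^ (-(3 / 4) : ℝ) * y ^ (-(3 / 4) : ℝ) * (√x + √y) = u * v ^ 3 + u ^ 3 * v := by
    linear_combination y ^ (-(3 / 4) : ℝ) * e3 x hx + x ^ (-(3 / 4) : ℝ) * e3 y hy +
      u * e1 y hy + v * e1 x hx
  rw [this, e2 x hx, e2 y hy, ← hu, ← hv]
  nlinarith [mul_nonneg (sq_nonneg (u - v)) (by positivity : 0 ≤ u ^ 2 + u * v + v ^ 2)]

lemma abs_integral_trigPoly_sq_sub_le {N : ℕ} (hN : 1 ≤ N) {T B : ℝ} (hT : 1 ≤ T) {b : ℕ → ℝ}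
    (hb : ∀ m ∈ Finset.Icc 1 N, |b m| ≤ B * (m : ℝ) ^ (-(3 / 4) : ℝ)) :
    |(∫ t in (1 : ℝ)..T, √(t / (2 * π)) ^ 3 * trigPoly N b √(t / (2 * π)) ^ 2) -
      ‖fresnelConst‖ ^ 2 / 2 * (∫ t in (1 : ℝ)..T, √(t / (2 * π)) ^ 3) *
        ∑ m ∈ Finset.Icc 1 N, b m ^ 2| ≤
      17 * ‖fresnelConst‖ ^ 2 * B ^ 2 * T ^ 2 * (1 + log N) ^ 2 := by
  set κ := fresnelConst
  set I := ∫ t in (1 : ℝ)..T, √(t / (2 * π)) ^ 3 with hI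
  set F : ℕ → ℕ → ℝ → ℝ := fun m n t => √(t / (2 * π)) ^ 3 *
    ((κ * cis (2 * π * √(t / (2 * π)) * √m)).im * (κ * cis (2 * π * √(t / (2 * π)) * √n)).im) with hF
  have hFc : ∀ m n, Continuous (F m n) := fun m n => by
    have hc : ∀ m : ℕ, Continuous fun t : ℝ => (κ * cis (2 * π * √(t / (2 * π)) * √m)).im := fun m => by
      have := continuous_cis
      have h : Continuous fun t : ℝ => κ * cis (2 * π * √(t / (2 * π)) * √m) := by fun_prop
      exact Complex.continuous_im.comp h
    have h1 := hc m
    have h2 := hc n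
    fun_prop
  have e1 : (∫ t in (1 : ℝ)..T, √(t / (2 * π)) ^ 3 * trigPoly N b √(t / (2 * π)) ^ 2) =
      ∑ m ∈ Finset.Icc 1 N, ∑ n ∈ Finset.Icc 1 N, b m * b n * ∫ t in (1 : ℝ)..T, F m n t := by
    simp_rw [← intervalIntegral.integral_const_mul]
    have : ∀ m n, IntervalIntegrable (fun t => b m * b n * F m n t) volume 1 T := fun m n =>
      ((hFc m n).const_mul _).intervalIntegrable _ _
    rw [Finset.sum_congr rfl fun m _ => (intervalIntegral.integral_finsetSum fun n _ => this m n).symm]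
    rw [← intervalIntegral.integral_finsetSum fun m _ => (by
      have := IntervalIntegrable.sum (Finset.Icc 1 N) (fun n _ => this m n)
      simpa only [Finset.sum_fn] using this)]
    refine intervalIntegral.integral_congr fun t _ => ?_
    simp only [trigPoly]
    rw [pow_two, Finset.sum_mul_sum, Finset.mul_sum]
    refine Finset.sum_congr rfl fun m _ => ?_
    rw [Finset.mul_sum]
    exact Finset.sum_congr rfl fun n _ => by simp only [hF]; ring
  have e3 : ‖κ‖ ^ 2 / 2 * I * ∑ m ∈ Finset.Icc 1 N, b m ^ 2 =
      ∑ m ∈ Finset.Icc 1 N, ∑ n ∈ Finset.Icc 1 N,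
        b m * b n * (if m = n then ‖κ‖ ^ 2 / 2 * I else 0) := by
    rw [Finset.mul_sum]
    refine Finset.sum_congr rfl fun m hm => ?_
    simp only [mul_ite, mul_zero]
    rw [Finset.sum_ite_eq, if_pos hm]
    ring
  rw [e1, e3, ← Finset.sum_sub_distrib]
  simp_rw [← Finset.sum_sub_distrib, ← mul_sub]
  have hl : 0 ≤ log N := Real.log_natCast_nonneg N
  have hpos : ∀ m ∈ Finset.Icc 1 N, (1 : ℝ) ≤ m := fun m hm => by
    exact_mod_cast (Finset.mem_Icc.1 hm).1
  have hKT : 0 ≤ ‖κ‖ ^ 2 * T ^ 2 := by positivity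
  have term : ∀ m ∈ Finset.Icc 1 N, ∀ n ∈ Finset.Icc 1 N,
      |b m * b n * ((∫ t in (1 : ℝ)..T, F m n t) - if m = n then ‖κ‖ ^ 2 / 2 * I else 0)| ≤
      B ^ 2 * (‖κ‖ ^ 2 * T ^ 2) * ((if m = n then 1 / (m : ℝ) else 0) +
        (1 / (m : ℝ) * (1 / |(m : ℝ) - n|) + 1 / (n : ℝ) * (1 / |(n : ℝ) - m|))) := by
    intro m hm n hn
    have hm1 := hpos m hm
    have hn1 := hpos n hn
    rw [abs_mul, abs_mul]
    have h1 := abs_integral_pair_sub_le hT κ (Finset.mem_Icc.1 hm).1 (Finset.mem_Icc.1 hn).1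
    calc _ ≤ (B * (m : ℝ) ^ (-(3 / 4) : ℝ)) * (B * (n : ℝ) ^ (-(3 / 4) : ℝ)) *
          (‖κ‖ ^ 2 * T ^ 2 * ((if m = n then 1 else 0) + 1 / |√m - √n|)) := by
          refine mul_le_mul (mul_le_mul (hb m hm) (hb n hn) (abs_nonneg _)
            ((abs_nonneg _).trans (hb m hm))) h1 (abs_nonneg _)
            (mul_nonneg ((abs_nonneg _).trans (hb m hm)) ((abs_nonneg _).trans (hb n hn)))
      _ = B ^ 2 * (‖κ‖ ^ 2 * T ^ 2) * (((m : ℝ) ^ (-(3 / 4) : ℝ) * (n : ℝ) ^ (-(3 / 4) : ℝ)) *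
          (if m = n then 1 else 0) + ((m : ℝ) ^ (-(3 / 4) : ℝ) * (n : ℝ) ^ (-(3 / 4) : ℝ) *
            (√m + √n)) / |(m : ℝ) - n|) := by
          rw [inv_abs_sqrt_sub_eq]; ring
      _ ≤ _ := by
          refine mul_le_mul_of_nonneg_left (add_le_add ?_ ?_) (by positivity)
          · by_cases h : m = n
            · subst h
              simp only [if_true, mul_one]
              rw [← Real.rpow_add (by linarith), one_div, ← Real.rpow_neg_one]
              exact Real.rpow_le_rpow_of_exponent_le hm1 (by norm_num)
            · simp [h]
          · rw [abs_sub_comm (n : ℝ), ← add_mul, mul_one_div]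
            gcongr
            exact weight_mul_sqrt_add_sqrt_le (by linarith) (by linarith)
  have hS := sum_Icc_inv_le N
  have hS0 : 0 ≤ ∑ m ∈ Finset.Icc 1 N, 1 / (m : ℝ) := Finset.sum_nonneg fun m _ => by positivity
  have hD : ∑ m ∈ Finset.Icc 1 N, ∑ n ∈ Finset.Icc 1 N, 1 / (m : ℝ) * (1 / |(m : ℝ) - n|) ≤
      8 * (1 + log N) ^ 2 := by
    calc _ ≤ ∑ m ∈ Finset.Icc 1 N, 1 / (m : ℝ) * (8 * (1 + log N)) := by
          refine Finset.sum_le_sum fun m hm => ?_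
          rw [← Finset.mul_sum]
          exact mul_le_mul_of_nonneg_left (sum_Icc_inv_abs_sub_le hN hm) (by positivity)
      _ = (∑ m ∈ Finset.Icc 1 N, 1 / (m : ℝ)) * (8 * (1 + log N)) := by rw [Finset.sum_mul]
      _ ≤ (1 + log N) * (8 * (1 + log N)) := by gcongr
      _ = _ := by ring
  calc _ ≤ ∑ m ∈ Finset.Icc 1 N, ∑ n ∈ Finset.Icc 1 N,
        B ^ 2 * (‖κ‖ ^ 2 * T ^ 2) * ((if m = n then 1 / (m : ℝ) else 0) +
        (1 / (m : ℝ) * (1 / |(m : ℝ) - n|) + 1 / (n : ℝ) * (1 / |(n : ℝ) - m|))) :=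
        (Finset.abs_sum_le_sum_abs _ _).trans (Finset.sum_le_sum fun m hm =>
          (Finset.abs_sum_le_sum_abs _ _).trans (Finset.sum_le_sum fun n hn => term m hm n hn))
    _ = B ^ 2 * (‖κ‖ ^ 2 * T ^ 2) * (∑ m ∈ Finset.Icc 1 N, 1 / (m : ℝ) +
        (∑ m ∈ Finset.Icc 1 N, ∑ n ∈ Finset.Icc 1 N, 1 / (m : ℝ) * (1 / |(m : ℝ) - n|) +
        ∑ m ∈ Finset.Icc 1 N, ∑ n ∈ Finset.Icc 1 N, 1 / (m : ℝ) * (1 / |(m : ℝ) - n|))) := by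
        simp_rw [← Finset.mul_sum, Finset.sum_add_distrib]
        congr 2
        · refine Finset.sum_congr rfl fun m hm => ?_
          rw [Finset.sum_ite_eq, if_pos hm]
        · simp_rw [Finset.mul_sum]
          congr 1
          rw [Finset.sum_comm]
    _ ≤ B ^ 2 * (‖κ‖ ^ 2 * T ^ 2) * (17 * (1 + log N) ^ 2) := by
        refine mul_le_mul_of_nonneg_left ?_ (by positivity)
        nlinarith
    _ = _ := by ring

lemma abs_stationaryWeight_le {n v m : ℕ} (hm : n * v = m) (hm0 : m ≠ 0) (hnv : n ≤ v) :
    |(-1) ^ n * stationaryWeight n v| ≤ (m : ℝ) ^ (-(3 / 4) : ℝ) := by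
  have hmpos : (0 : ℝ) < m := by exact_mod_cast Nat.pos_of_ne_zero hm0
  have hmr : (n : ℝ) * v = m := by exact_mod_cast hm
  have hv : √(m : ℝ) ≤ v := by
    rw [Real.sqrt_le_left (by positivity), ← hmr, pow_two]
    gcongr
  have hs : 0 < √(m : ℝ) := Real.sqrt_pos.2 hmpos
  rw [abs_mul, abs_pow, abs_neg, abs_one, one_pow, one_mul, stationaryWeight, hmr,
    abs_div, abs_of_nonneg (by positivity : 0 ≤ (v : ℝ) * √√(m : ℝ))]
  have h1 : |(if (v : ℝ) = n then 1 / 2 else 1 : ℝ)| ≤ 1 := by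
    split_ifs <;> norm_num [abs_le]
  calc _ ≤ 1 / (√(m : ℝ) * √√(m : ℝ)) := by gcongr
    _ = _ := by
      rw [Real.sqrt_eq_rpow, Real.sqrt_eq_rpow, ← Real.rpow_mul hmpos.le, ← Real.rpow_add hmpos,
        one_div, ← Real.rpow_neg hmpos.le]
      norm_num

/-- The limiting coefficient of the frequency `√m`. -/
noncomputable def fullCoeff (m : ℕ) : ℝ :=
  ∑ p ∈ m.divisorsAntidiagonal,
    if p.1 ≤ p.2 ∧ p.2 % 2 = p.1 % 2 then (-1) ^ p.1 * stationaryWeight p.1 p.2 else 0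

lemma abs_sum_stationaryWeight_le {m : ℕ} (hm : m ≠ 0) (P : ℕ × ℕ → Prop) [DecidablePred P]
    (hP : ∀ p, P p → p.1 ≤ p.2) :
    |∑ p ∈ m.divisorsAntidiagonal, if P p then (-1) ^ p.1 * stationaryWeight p.1 p.2 else 0| ≤
      m.divisors.card * (m : ℝ) ^ (-(3 / 4) : ℝ) := by
  have hc : m.divisorsAntidiagonal.card = m.divisors.card := by
    rw [← Nat.map_div_right_divisors, Finset.card_map]
  calc _ ≤ ∑ p ∈ m.divisorsAntidiagonal, (m : ℝ) ^ (-(3 / 4) : ℝ) := by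
        refine (Finset.abs_sum_le_sum_abs _ _).trans (Finset.sum_le_sum fun p hp => ?_)
        split_ifs with h
        · exact abs_stationaryWeight_le (Nat.mem_divisorsAntidiagonal.1 hp).1 hm (hP p h)
        · rw [abs_zero]; positivity
    _ = _ := by rw [Finset.sum_const, hc, nsmul_eq_mul]

lemma abs_levelCoeff_le (L : ℕ) {m : ℕ} (hm : m ≠ 0) :
    |levelCoeff L m| ≤ m.divisors.card * (m : ℝ) ^ (-(3 / 4) : ℝ) := by
  unfold levelCoeff
  convert abs_sum_stationaryWeight_le hm
    (fun p => (p.1 ≤ L ∧ p.2 ≤ 4 * L ^ 4 * p.1) ∧ p.1 ≤ p.2 ∧ p.2 % 2 = p.1 % 2)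
    fun _ h => h.2.1

lemma abs_fullCoeff_le {m : ℕ} (hm : m ≠ 0) :
    |fullCoeff m| ≤ m.divisors.card * (m : ℝ) ^ (-(3 / 4) : ℝ) := by
  unfold fullCoeff
  convert abs_sum_stationaryWeight_le hm (fun p => p.1 ≤ p.2 ∧ p.2 % 2 = p.1 % 2) fun _ h => h.1

lemma levelCoeff_eq_fullCoeff {L m : ℕ} (hm : m ≤ L) : levelCoeff L m = fullCoeff m := by
  refine Finset.sum_congr rfl fun p hp => ?_
  obtain ⟨h1, h0⟩ := Nat.mem_divisorsAntidiagonal.1 hp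
  have hp1 : 1 ≤ p.1 := Nat.one_le_iff_ne_zero.2 fun h => h0 (by rw [← h1, h, zero_mul])
  have hp2 : 1 ≤ p.2 := Nat.one_le_iff_ne_zero.2 fun h => h0 (by rw [← h1, h, mul_zero])
  have h2 : p.1 ≤ L := (Nat.le_of_dvd (by omega) ⟨p.2, h1.symm⟩).trans hm
  have h3 : p.2 ≤ L := (Nat.le_of_dvd (by omega) ⟨p.1, by rw [mul_comm, h1]⟩).trans hm
  have h4 : p.2 ≤ 4 * L ^ 4 * p.1 := by
    calc p.2 ≤ L := h3
      _ ≤ L ^ 4 := Nat.le_self_pow (by norm_num) L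
      _ ≤ 4 * L ^ 4 := by omega
      _ ≤ _ := Nat.le_mul_of_pos_right _ hp1
  simp [h2, h4]

lemma fullCoeff_zero : fullCoeff 0 = 0 := by simp [fullCoeff]

lemma fullCoeff_one : fullCoeff 1 = -(1 / 2) := by
  simp [fullCoeff, stationaryWeight]

lemma sq_le_of_abs_le_card {b C ε : ℝ} {m : ℕ} (hm : m ≠ 0)
    (hC : (m.divisors.card : ℝ) ≤ C * (m : ℝ) ^ ε)
    (hb : |b| ≤ m.divisors.card * (m : ℝ) ^ (-(3 / 4) : ℝ)) :
    b ^ 2 ≤ C ^ 2 * (m : ℝ) ^ (2 * ε - 3 / 2) := by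
  have hmpos : (0 : ℝ) < m := by exact_mod_cast Nat.pos_of_ne_zero hm
  have h : |b| ≤ C * (m : ℝ) ^ (ε - 3 / 4) := by
    refine hb.trans ((mul_le_mul_of_nonneg_right hC (by positivity)).trans_eq ?_)
    rw [mul_assoc, ← Real.rpow_add hmpos]
    ring_nf
  calc b ^ 2 = |b| ^ 2 := (sq_abs b).symm
    _ ≤ (C * (m : ℝ) ^ (ε - 3 / 4)) ^ 2 := pow_le_pow_left₀ (abs_nonneg b) h 2
    _ = _ := by
      rw [mul_pow, ← Real.rpow_mul_natCast hmpos.le]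
      ring_nf

lemma summable_fullCoeff_sq : Summable fun m => fullCoeff m ^ 2 := by
  obtain ⟨C, hC1, hC⟩ := exists_card_divisors_le (ε := 1 / 8) (by norm_num)
  refine Summable.of_nonneg_of_le (fun m => sq_nonneg _) (fun m => ?_)
    ((Real.summable_nat_rpow.2 (by norm_num : (2 * (1 / 8) - 3 / 2 : ℝ) < -1)).mul_left (C ^ 2))
  rcases eq_or_ne m 0 with rfl | hm
  · rw [fullCoeff_zero, zero_pow two_ne_zero]; positivity
  · exact sq_le_of_abs_le_card hm (hC m hm) (abs_fullCoeff_le hm)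

lemma tsum_fullCoeff_sq_pos : 0 < ∑' m, fullCoeff m ^ 2 :=
  summable_fullCoeff_sq.tsum_pos (fun m => sq_nonneg _) 1 (by rw [fullCoeff_one]; norm_num)

lemma exists_abs_sum_levelCoeff_sq_sub_le {ε : ℝ} (hε : 0 < ε) (hε6 : ε ≤ 1 / 6) :
    ∃ C : ℝ, 0 ≤ C ∧ ∀ L : ℕ, 1 ≤ L →
      |∑ m ∈ Finset.Icc 1 (4 * L ^ 6), levelCoeff L m ^ 2 - ∑' m, fullCoeff m ^ 2| ≤
        C * (L : ℝ) ^ (3 * ε - 1 / 2) := by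
  obtain ⟨C, hC1, hC⟩ := exists_card_divisors_le hε
  have hs : Summable fun m : ℕ => (m : ℝ) ^ (-1 - ε) := Real.summable_nat_rpow.2 (by linarith)
  refine ⟨C ^ 2 * ∑' m : ℕ, (m : ℝ) ^ (-1 - ε), mul_nonneg (by positivity)
    (tsum_nonneg fun m => by positivity), fun L hL => ?_⟩
  set S := Finset.Icc 1 (4 * L ^ 6) with hS
  set g : ℕ → ℝ := fun m => if m ∈ S then levelCoeff L m ^ 2 else 0 with hg
  have hgs : HasSum g (∑ m ∈ S, levelCoeff L m ^ 2) := by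
    have h : HasSum g (∑ m ∈ S, g m) := hasSum_sum_of_ne_finset_zero fun m hm => by
      simp only [hg, if_neg hm]
    have e : ∑ m ∈ S, g m = ∑ m ∈ S, levelCoeff L m ^ 2 :=
      Finset.sum_congr rfl fun m hm => by simp only [hg, if_pos hm]
    rwa [e] at h
  have hd := hgs.sub summable_fullCoeff_sq.hasSum
  have hbound := (hs.hasSum.mul_left (C ^ 2 * (L : ℝ) ^ (3 * ε - 1 / 2)))
  have hLpos : (0 : ℝ) < L := by exact_mod_cast hL
  have key : ∀ m, ‖g m - fullCoeff m ^ 2‖ ≤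
      C ^ 2 * (L : ℝ) ^ (3 * ε - 1 / 2) * (m : ℝ) ^ (-1 - ε) := by
    intro m
    rw [Real.norm_eq_abs]
    have hnn : 0 ≤ C ^ 2 * (L : ℝ) ^ (3 * ε - 1 / 2) * (m : ℝ) ^ (-1 - ε) := by positivity
    rcases eq_or_ne m 0 with rfl | hm
    · have : (0 : ℕ) ∉ S := by simp [hS]
      simp only [hg, if_neg this, fullCoeff_zero]
      norm_num at hnn ⊢
      exact hnn
    have hm1 : 1 ≤ m := Nat.one_le_iff_ne_zero.2 hm
    have hmpos : (0 : ℝ) < m := by exact_mod_cast hm1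
    rcases le_or_gt m L with h | h
    · have : m ∈ S := Finset.mem_Icc.2 ⟨hm1, h.trans (by
        calc L ≤ L ^ 6 := Nat.le_self_pow (by norm_num) L
          _ ≤ _ := by omega)⟩
      simp only [hg, if_pos this, levelCoeff_eq_fullCoeff h, sub_self, abs_zero]
      exact hnn
    · have hb : C ^ 2 * (m : ℝ) ^ (2 * ε - 3 / 2) ≤
          C ^ 2 * (L : ℝ) ^ (3 * ε - 1 / 2) * (m : ℝ) ^ (-1 - ε) := by
        rw [mul_assoc]
        refine mul_le_mul_of_nonneg_left ?_ (by positivity)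
        rw [show 2 * ε - 3 / 2 = (3 * ε - 1 / 2) + (-1 - ε) by ring, Real.rpow_add hmpos]
        refine mul_le_mul_of_nonneg_right ?_ (by positivity)
        exact Real.rpow_le_rpow_of_nonpos hLpos (by exact_mod_cast h.le) (by linarith)
      have h1 : g m ≤ C ^ 2 * (m : ℝ) ^ (2 * ε - 3 / 2) := by
        simp only [hg]
        split_ifs
        · exact sq_le_of_abs_le_card hm (hC m hm) (abs_levelCoeff_le L hm)
        · positivity
      have h0 : 0 ≤ g m := by
        simp only [hg]
        split_ifs <;> positivity
      have h2 := sq_le_of_abs_le_card hm (hC m hm) (abs_fullCoeff_le hm)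
      rw [abs_le]
      constructor <;> nlinarith [sq_nonneg (fullCoeff m)]
  have := tsum_of_norm_bounded hbound key
  rw [hd.tsum_eq, Real.norm_eq_abs] at this
  refine this.trans_eq (by ring)

lemma NT_mono : Monotone NT := fun a b hab => by
  unfold NT
  exact_mod_cast Set.ncard_le_ncard (fun q (hq : _ ≤ a) => hq.trans hab) (finite_NT b)

lemma two_pi_mul_sq_sqrt {t : ℝ} (ht : 0 ≤ t) : 2 * π * √(t / (2 * π)) ^ 2 = t := by
  rw [Real.sq_sqrt (by positivity)]
  field_simp

lemma NH_monotoneOn : MonotoneOn NH (Set.Ici 0) := fun a (ha : 0 ≤ a) b (hb : 0 ≤ b) hab => by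
  have h : √(a / (2 * π)) ≤ √(b / (2 * π)) := by gcongr
  rw [← two_pi_mul_sq_sqrt ha, ← two_pi_mul_sq_sqrt hb, NH_eq_sum (by positivity),
    NH_eq_sum (by positivity)]
  calc _ ≤ ∑ c ∈ Finset.Icc 1 ⌊√(a / (2 * π))⌋₊,
        2 * (c : ℝ) * ⌊(√(b / (2 * π)) ^ 2 / c - c + 1) / 2⌋₊ := by gcongr
    _ ≤ _ := Finset.sum_le_sum_of_subset_of_nonneg
        (Finset.Icc_subset_Icc_right (Nat.floor_le_floor h)) fun _ _ _ => by positivity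

lemma NH_nonneg (t : ℝ) : 0 ≤ NH t := tsum_nonneg fun p => by split_ifs <;> positivity

lemma monotoneOn_NT_add_NH {T : ℝ} (hT : 1 ≤ T) :
    MonotoneOn (fun t => NT t + NH t) (Set.uIcc 1 T) := fun a ha b hb hab => by
  rw [Set.uIcc_of_le hT] at ha hb
  exact add_le_add (NT_mono hab) (NH_monotoneOn (by have := ha.1; simp; linarith)
    (by have := hb.1; simp; linarith) hab)

lemma intervalIntegrable_R {T : ℝ} (hT : 1 ≤ T) : IntervalIntegrable R volume 1 T := by
  have h : Continuous fun t : ℝ => (Real.sqrt (2 * π) / (6 * π ^ 2)) * t ^ ((3 : ℝ) / 2) := by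
    have := Real.continuous_rpow_const (q := (3 : ℝ) / 2) (by norm_num)
    fun_prop
  exact (monotoneOn_NT_add_NH hT).intervalIntegrable.sub (h.intervalIntegrable _ _)

lemma intervalIntegrable_R_sq {T : ℝ} (hT : 1 ≤ T) :
    IntervalIntegrable (fun t => R t ^ 2) volume 1 T := by
  have h : Continuous fun t : ℝ => (Real.sqrt (2 * π) / (6 * π ^ 2)) * t ^ ((3 : ℝ) / 2) := by
    have := Real.continuous_rpow_const (q := (3 : ℝ) / 2) (by norm_num)
    fun_prop
  have hM := monotoneOn_NT_add_NH hT
  have hM2 : MonotoneOn (fun t => (NT t + NH t) ^ 2) (Set.uIcc 1 T) := fun a ha b hb hab =>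
    pow_le_pow_left₀ (add_nonneg (by unfold NT; positivity) (NH_nonneg a)) (hM ha hb hab) 2
  have e : (fun t => R t ^ 2) = fun t => (NT t + NH t) ^ 2 -
      (NT t + NH t) * (2 * ((Real.sqrt (2 * π) / (6 * π ^ 2)) * t ^ ((3 : ℝ) / 2))) +
      ((Real.sqrt (2 * π) / (6 * π ^ 2)) * t ^ ((3 : ℝ) / 2)) ^ 2 := by
    funext t
    rw [R]; ring
  rw [e]
  exact (hM2.intervalIntegrable.sub
    (hM.intervalIntegrable.mul_continuousOn (h.const_mul 2).continuousOn)).add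
    ((h.pow 2).intervalIntegrable _ _)

/-- The trigonometric model of the Weyl remainder at level `L`. -/
noncomputable def remainderModel (L : ℕ) (t : ℝ) : ℝ :=
  2 / π * (√(t / (2 * π)) * √√(t / (2 * π))) *
    trigPoly (4 * L ^ 6) (levelCoeff L) √(t / (2 * π))

lemma continuous_trigPoly (N : ℕ) (b : ℕ → ℝ) : Continuous (trigPoly N b) := by
  unfold trigPoly
  refine continuous_finsetSum _ fun m _ => continuous_const.mul (Complex.continuous_im.comp ?_)
  have := continuous_cis
  fun_prop

lemma continuous_remainderModel (L : ℕ) : Continuous (remainderModel L) := by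
  unfold remainderModel
  have := continuous_trigPoly (4 * L ^ 6) (levelCoeff L)
  fun_prop

lemma remainderModel_sq (L : ℕ) (t : ℝ) : remainderModel L t ^ 2 =
    4 / π ^ 2 * (√(t / (2 * π)) ^ 3 * trigPoly (4 * L ^ 6) (levelCoeff L) √(t / (2 * π)) ^ 2) := by
  rw [remainderModel, mul_pow, mul_pow, mul_pow, Real.sq_sqrt (Real.sqrt_nonneg _)]
  ring

lemma exists_sq_R_sub_remainderModel_le : ∃ K : ℝ, 0 ≤ K ∧ ∀ L : ℕ, 2 ≤ L → ∀ T : ℝ, T ≤ L →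
    ∀ t ∈ Set.Icc 1 T, (R t - remainderModel L t) ^ 2 ≤
      12 * truncMajorant L T t + K * T * (1 + log L) ^ 4 := by
  set K₀ : ℝ := 29 + 60 * (6 + ‖fresnelConst‖) with hK₀
  refine ⟨4 * (972 + 12 * K₀ ^ 2), by positivity, fun L hL T hTL t ht => ?_⟩
  have ht1 := ht.1
  have htT := ht.2
  set s := √(t / (2 * π)) with hs
  have hspos : 0 < s := Real.sqrt_pos.2 (by positivity)
  have hs2 : s ^ 2 ≤ T := by
    rw [hs, Real.sq_sqrt (by positivity)]
    exact (div_le_self (by linarith) (by nlinarith [Real.pi_gt_three])).trans htT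
  have hsL : s ≤ L := by nlinarith
  have hl : 1 ≤ 1 + log (L : ℝ) := by linarith [Real.log_natCast_nonneg L]
  set ℓ := 1 + log (L : ℝ)
  have h1 := abs_R_add_le hspos.le
  rw [two_pi_mul_sq_sqrt (by linarith : 0 ≤ t)] at h1
  have h2 := sq_sawtoothSum_sub_truncSum_le L (by linarith : 0 ≤ t) htT
  have h3 := abs_truncSum_sub_le hL hspos hsL
  rw [← hK₀] at h3
  have e : R t - remainderModel L t = (R t + 2 * sawtoothSum s) +
      (-2 * (sawtoothSum s - truncSum L s)) +
      (-2 * (truncSum L s - (-(s * √s / π) * trigPoly (4 * L ^ 6) (levelCoeff L) s))) := by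
    rw [remainderModel]
    ring
  rw [e]
  set x := R t + 2 * sawtoothSum s
  set y := sawtoothSum s - truncSum L s
  set z := truncSum L s - (-(s * √s / π) * trigPoly (4 * L ^ 6) (levelCoeff L) s)
  have hx : x ^ 2 ≤ (18 * (s + 1)) ^ 2 := sq_le_sq' (abs_le.1 h1).1 (abs_le.1 h1).2
  have hz : z ^ 2 ≤ (K₀ * (s + 1) * ℓ ^ 2) ^ 2 := sq_le_sq' (abs_le.1 h3).1 (abs_le.1 h3).2
  have hs1 : (s + 1) ^ 2 ≤ 4 * T := by nlinarith [sq_nonneg (s - 1)]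
  have hl4 : 1 ≤ ℓ ^ 4 := one_le_pow₀ hl
  have h5 : (18 * (s + 1)) ^ 2 ≤ 324 * (4 * T) * ℓ ^ 4 := by
    have : 0 ≤ 324 * (4 * T) := by linarith
    nlinarith
  have h6 : (K₀ * (s + 1) * ℓ ^ 2) ^ 2 ≤ K₀ ^ 2 * (4 * T) * ℓ ^ 4 := by
    calc _ = K₀ ^ 2 * (s + 1) ^ 2 * ℓ ^ 4 := by ring
      _ ≤ _ := by gcongr
  nlinarith [sq_nonneg (x + 2 * y), sq_nonneg (x + 2 * z), sq_nonneg (2 * y - 2 * z)]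

lemma intervalIntegrable_sq_sub {T : ℝ} (hT : 1 ≤ T) (L : ℕ) :
    IntervalIntegrable (fun t => (R t - remainderModel L t) ^ 2) volume 1 T := by
  have hc := continuous_remainderModel L
  have e : (fun t => (R t - remainderModel L t) ^ 2) =
      fun t => R t ^ 2 - R t * (2 * remainderModel L t) + remainderModel L t ^ 2 := by
    funext t; ring
  rw [e]
  exact ((intervalIntegrable_R_sq hT).sub
    ((intervalIntegrable_R hT).mul_continuousOn (hc.const_mul 2).continuousOn)).add
    ((hc.pow 2).intervalIntegrable _ _)

lemma exists_integral_sq_R_sub_remainderModel_le : ∃ K : ℝ, 0 ≤ K ∧ ∀ L : ℕ, 2 ≤ L → ∀ T : ℝ,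
    1 ≤ T → T ≤ L → ∫ t in (1 : ℝ)..T, (R t - remainderModel L t) ^ 2 ≤
      K * T ^ 2 * (1 + log L) ^ 4 := by
  obtain ⟨K, hK0, hK⟩ := exists_sq_R_sub_remainderModel_le
  refine ⟨168 + K, by positivity, fun L hL T hT hTL => ?_⟩
  have hl : 1 ≤ 1 + log (L : ℝ) := by linarith [Real.log_natCast_nonneg L]
  have hl4 : 1 ≤ (1 + log (L : ℝ)) ^ 4 := one_le_pow₀ hl
  have hm := (intervalIntegrable_truncMajorant L T 1 T).const_mul 12
  calc _ ≤ ∫ t in (1 : ℝ)..T, (12 * truncMajorant L T t + K * T * (1 + log L) ^ 4) :=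
        intervalIntegral.integral_mono_on hT (intervalIntegrable_sq_sub hT L)
          (hm.add intervalIntegrable_const) (hK L hL T hTL)
    _ = 12 * (∫ t in (1 : ℝ)..T, truncMajorant L T t) + (T - 1) * (K * T * (1 + log L) ^ 4) := by
        rw [intervalIntegral.integral_add hm intervalIntegrable_const,
          intervalIntegral.integral_const_mul, intervalIntegral.integral_const, smul_eq_mul]
    _ ≤ 12 * (14 * T ^ 2) * (1 + log L) ^ 4 + T * (K * T * (1 + log L) ^ 4) := by
        refine add_le_add ?_ ?_
        · have := integral_truncMajorant_le hT hTL
          nlinarith [sq_nonneg T]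
        · refine mul_le_mul_of_nonneg_right (by linarith) (by positivity)
    _ = _ := by ring

lemma abs_integral_sq_sub_le {f g : ℝ → ℝ} {a b η : ℝ} (hab : a ≤ b) (hη : 0 < η)
    (hf : IntervalIntegrable (fun t => f t ^ 2) volume a b)
    (hg : IntervalIntegrable (fun t => g t ^ 2) volume a b)
    (hd : IntervalIntegrable (fun t => (f t - g t) ^ 2) volume a b) :
    |(∫ t in a..b, f t ^ 2) - ∫ t in a..b, g t ^ 2| ≤
      η * (∫ t in a..b, g t ^ 2) + (1 + η⁻¹) * ∫ t in a..b, (f t - g t) ^ 2 := by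
  rw [← intervalIntegral.integral_sub hf hg, ← intervalIntegral.integral_const_mul,
    ← intervalIntegral.integral_const_mul,
    ← intervalIntegral.integral_add (hg.const_mul _) (hd.const_mul _)]
  refine (intervalIntegral.abs_integral_le_integral_abs hab).trans
    (intervalIntegral.integral_mono_on hab (hf.sub hg).abs
      ((hg.const_mul _).add (hd.const_mul _)) fun t _ => ?_)
  set p := g t
  set d := f t - p with hd'
  have e : f t ^ 2 - p ^ 2 = 2 * (p * d) + d ^ 2 := by rw [hd']; ring
  have h1 : 2 * |p * d| ≤ η * p ^ 2 + η⁻¹ * d ^ 2 := by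
    have h := mul_nonneg (inv_nonneg.2 hη.le) (sq_nonneg (η * |p| - |d|))
    rw [abs_mul]
    have e2 : η⁻¹ * (η * |p| - |d|) ^ 2 = η * |p| ^ 2 - 2 * (|p| * |d|) + η⁻¹ * |d| ^ 2 := by
      field_simp
      ring
    rw [e2, sq_abs, sq_abs] at h
    linarith
  rw [e]
  refine (abs_add_le _ _).trans ?_
  rw [abs_mul, abs_two, abs_of_nonneg (sq_nonneg d)]
  linarith

/-- The constant in the second moment asymptotics. -/
noncomputable def momentConst : ℝ :=
  4 / π ^ 2 * (‖fresnelConst‖ ^ 2 / 2 * (2 / 5 * (1 / √(2 * π)) ^ 3) * ∑' m, fullCoeff m ^ 2)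

lemma momentConst_pos : 0 < momentConst := by
  have h1 : fresnelConst ≠ 0 := fun h => by
    have := fresnelConst_im_pos
    rw [h, Complex.zero_im] at this
    exact lt_irrefl _ this
  have h2 := norm_pos_iff.2 h1
  have h3 := tsum_fullCoeff_sq_pos
  unfold momentConst
  positivity

lemma one_add_log_le {ε T : ℝ} (hε : 0 < ε) (hT : 1 ≤ T) {L : ℕ} (hL : 1 ≤ L)
    (hLT : (L : ℝ) ≤ 2 * T) : 1 + log L ≤ (2 + 1 / ε) * T ^ ε := by
  have h1 : log L ≤ log (2 * T) := Real.log_le_log (by exact_mod_cast hL) hLT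
  rw [Real.log_mul (by norm_num) (by positivity)] at h1
  have h2 : log T ≤ T ^ ε / ε := Real.log_le_rpow_div (by linarith) hε
  have h3 : 1 ≤ T ^ ε := Real.one_le_rpow hT hε.le
  have h4 := Real.log_two_lt_d9
  have e : (2 + 1 / ε) * T ^ ε = 2 * T ^ ε + T ^ ε / ε := by ring
  rw [e]
  linarith

lemma exists_abs_integral_trigPoly_sq_sub_le {ε : ℝ} (hε : 0 < ε) :
    ∃ C : ℝ, 0 ≤ C ∧ ∀ (T : ℝ) (L : ℕ), 1 ≤ T → 1 ≤ L → (L : ℝ) ≤ 2 * T →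
      |(∫ t in (1 : ℝ)..T, √(t / (2 * π)) ^ 3 *
          trigPoly (4 * L ^ 6) (levelCoeff L) √(t / (2 * π)) ^ 2) -
        ‖fresnelConst‖ ^ 2 / 2 * (∫ t in (1 : ℝ)..T, √(t / (2 * π)) ^ 3) *
          ∑ m ∈ Finset.Icc 1 (4 * L ^ 6), levelCoeff L m ^ 2| ≤ C * T ^ (2 + 14 * ε) := by
  obtain ⟨D, hD1, hD⟩ := exists_card_divisors_le hε
  refine ⟨17 * ‖fresnelConst‖ ^ 2 * (D * 256 ^ ε) ^ 2 * (6 * (2 + 1 / ε)) ^ 2, by positivity,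
    fun T L hT hL hLT => ?_⟩
  set N := 4 * L ^ 6 with hN
  have hTpos : 0 < T := by linarith
  have hLpos : (0 : ℝ) < L := by exact_mod_cast hL
  have hN1 : 1 ≤ N := by have := Nat.one_le_pow 6 L hL; omega
  have hNT : (N : ℝ) ≤ 256 * T ^ 6 := by
    rw [hN]
    push_cast
    calc 4 * (L : ℝ) ^ 6 ≤ 4 * (2 * T) ^ 6 := by gcongr
      _ = _ := by ring
  have hb : ∀ m ∈ Finset.Icc 1 N, |levelCoeff L m| ≤
      (D * 256 ^ ε * T ^ (6 * ε)) * (m : ℝ) ^ (-(3 / 4) : ℝ) := fun m hm => by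
    rw [Finset.mem_Icc] at hm
    have hm0 : m ≠ 0 := by omega
    refine (abs_levelCoeff_le L hm0).trans (mul_le_mul_of_nonneg_right ?_ (by positivity))
    calc (m.divisors.card : ℝ) ≤ D * (m : ℝ) ^ ε := hD m hm0
      _ ≤ D * (256 * T ^ 6) ^ ε := by
          gcongr
          exact (Nat.cast_le.2 hm.2).trans hNT
      _ = _ := by
          rw [Real.mul_rpow (by norm_num) (by positivity), ← Real.rpow_natCast_mul hTpos.le]
          push_cast
          ring
  refine (abs_integral_trigPoly_sq_sub_le hN1 hT hb).trans ?_
  have hl : 1 + log (L : ℝ) ≤ (2 + 1 / ε) * T ^ ε := one_add_log_le hε hT hL hLT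
  have hlN : 1 + log (N : ℝ) ≤ 6 * (2 + 1 / ε) * T ^ ε := by
    have : log (N : ℝ) = 2 * log 2 + 6 * log L := by
      rw [hN]
      push_cast
      rw [Real.log_mul (by norm_num) (by positivity), Real.log_pow,
        show (4 : ℝ) = 2 ^ 2 by norm_num, Real.log_pow]
      push_cast
      ring
    rw [this]
    linarith [Real.log_two_lt_d9]
  have hlN0 : 0 ≤ 1 + log (N : ℝ) := by linarith [Real.log_natCast_nonneg N]
  calc _ ≤ 17 * ‖fresnelConst‖ ^ 2 * (D * 256 ^ ε * T ^ (6 * ε)) ^ 2 * T ^ 2 *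
        (6 * (2 + 1 / ε) * T ^ ε) ^ 2 := by gcongr
    _ = 17 * ‖fresnelConst‖ ^ 2 * (D * 256 ^ ε) ^ 2 * (6 * (2 + 1 / ε)) ^ 2 *
        (T ^ 2 * (T ^ (6 * ε)) ^ 2 * (T ^ ε) ^ 2) := by ring
    _ = _ := by
        congr 1
        rw [← Real.rpow_mul_natCast hTpos.le, ← Real.rpow_mul_natCast hTpos.le,
          ← Real.rpow_natCast T 2, ← Real.rpow_add hTpos, ← Real.rpow_add hTpos]
        congr 1
        push_cast
        ring

lemma exists_abs_integral_remainderModel_sq_sub_le {ε : ℝ} (hε : 0 < ε) (hε6 : ε ≤ 1 / 6) :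
    ∃ C : ℝ, 0 ≤ C ∧ ∀ (T : ℝ) (L : ℕ), 1 ≤ T → T ≤ L → (L : ℝ) ≤ 2 * T →
      |(∫ t in (1 : ℝ)..T, remainderModel L t ^ 2) - momentConst * T ^ ((5 : ℝ) / 2)| ≤
        C * T ^ (2 + 14 * ε) := by
  obtain ⟨C₁, hC₁, h₁⟩ := exists_abs_integral_trigPoly_sq_sub_le hε
  obtain ⟨C₂, hC₂, h₂⟩ := exists_abs_sum_levelCoeff_sq_sub_le hε hε6
  set a : ℝ := ‖fresnelConst‖ ^ 2 / 2 * (2 / 5 * (1 / √(2 * π)) ^ 3) with ha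
  have ha0 : 0 ≤ a := by positivity
  set S : ℝ := ∑' m, fullCoeff m ^ 2 with hS
  have hS0 : 0 < S := tsum_fullCoeff_sq_pos
  refine ⟨4 / π ^ 2 * (C₁ + a * C₂ + a * (S + C₂)), by positivity, fun T L hT hTL hLT => ?_⟩
  have hTpos : 0 < T := by linarith
  have hL : 1 ≤ L := by exact_mod_cast hT.trans hTL
  have hLr : (1 : ℝ) ≤ L := hT.trans hTL
  have k₁ := h₁ T L hT hL hLT
  have k₂ := h₂ L hL
  rw [integral_cube_sqrt hT] at k₁
  set SL := ∑ m ∈ Finset.Icc 1 (4 * L ^ 6), levelCoeff L m ^ 2 with hSL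
  simp_rw [remainderModel_sq]
  rw [intervalIntegral.integral_const_mul]
  set J := ∫ t in (1 : ℝ)..T, √(t / (2 * π)) ^ 3 *
    trigPoly (4 * L ^ 6) (levelCoeff L) √(t / (2 * π)) ^ 2
  set X := T ^ ((5 : ℝ) / 2) with hX
  have hXpos : 0 < X := by positivity
  have k₁' : |J - a * (X - 1) * SL| ≤ C₁ * T ^ (2 + 14 * ε) := by
    convert k₁ using 2
    rw [ha]
    ring
  have hSL0 : 0 ≤ SL := Finset.sum_nonneg fun _ _ => sq_nonneg _
  have hSL1 : SL ≤ S + C₂ := by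
    have h3 : (L : ℝ) ^ (3 * ε - 1 / 2) ≤ 1 := Real.rpow_le_one_of_one_le_of_nonpos hLr (by linarith)
    nlinarith [(abs_le.1 k₂).2]
  have hT1 : 1 ≤ T ^ (2 + 14 * ε) := Real.one_le_rpow hT (by linarith)
  have k₃ : X * |SL - S| ≤ C₂ * T ^ (2 + 14 * ε) := by
    calc X * |SL - S| ≤ X * (C₂ * (T : ℝ) ^ (3 * ε - 1 / 2)) := by
          refine mul_le_mul_of_nonneg_left (k₂.trans ?_) hXpos.le
          exact mul_le_mul_of_nonneg_left
            (Real.rpow_le_rpow_of_nonpos hTpos hTL (by linarith)) hC₂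
      _ = C₂ * T ^ (2 + 3 * ε) := by
          rw [mul_left_comm, hX, ← Real.rpow_add hTpos]
          congr 2
          ring
      _ ≤ _ := mul_le_mul_of_nonneg_left
          (Real.rpow_le_rpow_of_exponent_le hT (by linarith)) hC₂
  have e : 4 / π ^ 2 * J - momentConst * X =
      4 / π ^ 2 * ((J - a * (X - 1) * SL) + a * (X * (SL - S)) - a * SL) := by
    rw [momentConst]
    ring
  rw [e, abs_mul, abs_of_nonneg (by positivity : (0 : ℝ) ≤ 4 / π ^ 2),
    mul_assoc (4 / π ^ 2) (C₁ + a * C₂ + a * (S + C₂))]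
  refine mul_le_mul_of_nonneg_left ?_ (by positivity)
  refine (abs_sub _ _).trans ((add_le_add (abs_add_le _ _) le_rfl).trans ?_)
  rw [abs_mul a, abs_mul X, abs_mul a, abs_of_nonneg ha0, abs_of_nonneg hXpos.le, abs_of_nonneg hSL0]
  have k₄ : a * SL ≤ a * (S + C₂) * T ^ (2 + 14 * ε) := by
    have h5 : 0 ≤ a * (S + C₂) := by positivity
    nlinarith
  nlinarith [mul_le_mul_of_nonneg_left k₃ ha0]

/-- Second moment of the Weyl remainder:
`∫₁^T R(t)² dt = d₂ T^{5/2} + O_δ(T^{9/4+δ})` with `d₂ > 0`. -/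
theorem second_moment_weyl_remainder_heisenberg :
    ∃ d₂ : ℝ, 0 < d₂ ∧ ∀ δ : ℝ, 0 < δ → ∃ C : ℝ, 0 < C ∧ ∀ T : ℝ, 2 ≤ T →
      |(∫ t in (1:ℝ)..T, R t ^ 2) - d₂ * T ^ ((5 : ℝ) / 2)| ≤
        C * T ^ ((9 : ℝ) / 4 + δ) := by
  refine ⟨momentConst, momentConst_pos, fun δ hδ => ?_⟩
  set δ' := min δ 1 with hδ'
  have hδ'0 : 0 < δ' := lt_min hδ one_pos
  have hδ'1 : δ' ≤ 1 := min_le_right _ _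
  set ε := δ' / 14 with hε
  have hε0 : 0 < ε := by positivity
  obtain ⟨C₁, hC₁, h₁⟩ := exists_abs_integral_remainderModel_sq_sub_le hε0 (by linarith)
  obtain ⟨K, hK, h₂⟩ := exists_integral_sq_R_sub_remainderModel_le
  set G := K * (2 + 1 / ε) ^ 4 with hG
  have hG0 : 0 ≤ G := by positivity
  have hd := momentConst_pos
  refine ⟨2 * C₁ + momentConst + 2 * G, by positivity, fun T hT => ?_⟩
  have hT1 : 1 ≤ T := by linarith
  have hTpos : 0 < T := by linarith
  set L := ⌈T⌉₊ with hL
  have hTL : T ≤ L := Nat.le_ceil T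
  have hLT : (L : ℝ) ≤ 2 * T := by
    have := Nat.ceil_lt_add_one hTpos.le
    linarith
  have hL2 : 2 ≤ L := by exact_mod_cast hT.trans hTL
  have k₁ := h₁ T L hT1 hTL hLT
  have e14 : 14 * ε = δ' := by rw [hε]; ring
  rw [e14] at k₁
  have k₂ : ∫ t in (1 : ℝ)..T, (R t - remainderModel L t) ^ 2 ≤ G * T ^ (2 + δ') := by
    have hl : 0 ≤ 1 + log (L : ℝ) := by linarith [Real.log_natCast_nonneg L]
    calc _ ≤ K * T ^ 2 * (1 + log L) ^ 4 := h₂ L hL2 T hT1 hTL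
      _ ≤ K * T ^ 2 * ((2 + 1 / ε) * T ^ ε) ^ 4 := by
          gcongr
          exact one_add_log_le hε0 hT1 (by omega) hLT
      _ = G * T ^ (2 + 4 * ε) := by
          rw [Real.rpow_add hTpos, mul_comm 4 ε, show ε * 4 = ε * (4 : ℕ) by norm_num,
            Real.rpow_mul_natCast hTpos.le, Real.rpow_two]
          ring
      _ ≤ _ := mul_le_mul_of_nonneg_left
          (Real.rpow_le_rpow_of_exponent_le hT1 (by linarith)) hG0
  set η : ℝ := T ^ (-(1 / 4) : ℝ) with hη
  have hη0 : 0 < η := by positivity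
  have k₃ := abs_integral_sq_sub_le hT1 hη0 (intervalIntegrable_R_sq hT1)
    (((continuous_remainderModel L).pow 2).intervalIntegrable _ _) (intervalIntegrable_sq_sub hT1 L)
  set A := ∫ t in (1 : ℝ)..T, R t ^ 2
  set P := ∫ t in (1 : ℝ)..T, remainderModel L t ^ 2
  set D := ∫ t in (1 : ℝ)..T, (R t - remainderModel L t) ^ 2
  set Y := T ^ ((9 : ℝ) / 4 + δ') with hY
  have hYδ : Y ≤ T ^ ((9 : ℝ) / 4 + δ) :=
    Real.rpow_le_rpow_of_exponent_le hT1 (by linarith [min_le_left δ (1 : ℝ)])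
  have y₁ : T ^ (2 + δ') ≤ Y := Real.rpow_le_rpow_of_exponent_le hT1 (by linarith)
  have y₂ : η * T ^ ((5 : ℝ) / 2) ≤ Y := by
    rw [hη, ← Real.rpow_add hTpos]
    exact Real.rpow_le_rpow_of_exponent_le hT1 (by linarith)
  have y₃ : η * T ^ (2 + δ') ≤ Y := by
    rw [hη, ← Real.rpow_add hTpos]
    exact Real.rpow_le_rpow_of_exponent_le hT1 (by linarith)
  have y₄ : η⁻¹ * T ^ (2 + δ') ≤ Y := by
    rw [hη, ← Real.rpow_neg hTpos.le, ← Real.rpow_add hTpos]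
    exact Real.rpow_le_rpow_of_exponent_le hT1 (by linarith)
  have z₁ : η * P ≤ momentConst * Y + C₁ * Y := by
    have hP : P ≤ momentConst * T ^ ((5 : ℝ) / 2) + C₁ * T ^ (2 + δ') := by
      linarith [(abs_le.1 k₁).2]
    nlinarith [mul_le_mul_of_nonneg_left hP hη0.le, mul_le_mul_of_nonneg_left y₂ hd.le,
      mul_le_mul_of_nonneg_left y₃ hC₁]
  have z₂ : (1 + η⁻¹) * D ≤ 2 * G * Y := by
    have h := mul_le_mul_of_nonneg_left k₂ (by positivity : 0 ≤ 1 + η⁻¹)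
    nlinarith [mul_le_mul_of_nonneg_left y₁ hG0, mul_le_mul_of_nonneg_left y₄ hG0]
  have z₃ : |A - momentConst * T ^ ((5 : ℝ) / 2)| ≤ (2 * C₁ + momentConst + 2 * G) * Y := by
    refine (abs_sub_le A P _).trans ?_
    nlinarith [mul_le_mul_of_nonneg_left y₁ hC₁]
  exact z₃.trans (mul_le_mul_of_nonneg_left hYδ (by positivity))
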